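/- Let n ≥ 4 and C₀, Λ, b > 0. Suppose that for each i ∈ ℕ: K_i satisfies (K1) with constant C₀, (K2) with constant Λ and (K3); c_i : ∂'B₁⁺ → ℝ satisfies |c_i(x)| ≤ b for all x; u_i is a positive solution of the boundary Yamabe system on B₁⁺ with coefficients (K_i, c_i); x_i ∈ cl(ℝⁿ₊) ∩ B(0,1/2) is such that u_i(x_i) ≥ max over cl(B_{1/3}⁺) of u_i, there is σ_i → 0 with u_i(x_i) ≥ u_i(x) for all x ∈ B(x_i,σ_i) ∩ ℝⁿ₊ and u_i(x_i)^{2/(n−2)}·σ_i → ∞, and u_i(x_i) · (min over cl(B_{2/3}⁺) of u_i) > i. Then there exists a constant C₁ > 0, independent of i, such that x_{i,n} · u_i(x_i)^{2/(n−2)} ≤ C₁ for all i, where x_{i,n} is the n-th coordinate of x_i. -/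

import Mathlib

open Metric Set MeasureTheory Filter Topology

noncomputable section

abbrev Euc (n : ℕ) := EuclideanSpace ℝ (Fin n)

/-- Index of the last coordinate. -/
def lastIdx (n : ℕ) (h0 : 0 < n) : Fin n := ⟨n - 1, by omega⟩

/-- The open upper half-space `ℝⁿ₊ = {x : xₙ > 0}`. -/
def upperHalf (n : ℕ) (h0 : 0 < n) : Set (Euc n) := {x | 0 < x (lastIdx n h0)}

/-- The upper half-ball `B_r⁺ = B(0,r) ∩ ℝⁿ₊`. -/
def halfBall (n : ℕ) (h0 : 0 < n) (r : ℝ) : Set (Euc n) :=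
  Metric.ball (0 : Euc n) r ∩ upperHalf n h0

/-- The flat boundary portion `∂'B_r⁺ = B(0,r) ∩ {xₙ = 0}`. -/
def flatBdry (n : ℕ) (h0 : 0 < n) (r : ℝ) : Set (Euc n) :=
  Metric.ball (0 : Euc n) r ∩ {x | x (lastIdx n h0) = 0}

/-- Laplacian (within a set `s`) as the sum of pure second partial derivatives. -/
def lapWithin (n : ℕ) (s : Set (Euc n)) (u : Euc n → ℝ) (x : Euc n) : ℝ :=
  ∑ i : Fin n, iteratedFDerivWithin ℝ 2 u s x
    ![EuclideanSpace.single i (1 : ℝ), EuclideanSpace.single i (1 : ℝ)]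

/-- Normal derivative `∂u/∂xₙ` (within a set `s`). -/
def normalDerivWithin (n : ℕ) (h0 : 0 < n) (s : Set (Euc n)) (u : Euc n → ℝ) (x : Euc n) : ℝ :=
  fderivWithin ℝ u s x (EuclideanSpace.single (lastIdx n h0) (1 : ℝ))

/-- Positive solution of the boundary Yamabe system on `B₁⁺` with coefficients `(K, c)`. -/
def IsYamabeSol (n : ℕ) (h0 : 0 < n) (K c u : Euc n → ℝ) : Prop :=
  ContDiffOn ℝ 2 u (closure (halfBall n h0 1)) ∧
  (∀ x ∈ closure (halfBall n h0 1), 0 < u x) ∧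
  (∀ x ∈ halfBall n h0 1,
    lapWithin n (closure (halfBall n h0 1)) u x
      + K x * u x ^ (((n : ℝ) + 2) / ((n : ℝ) - 2)) = 0) ∧
  (∀ x ∈ flatBdry n h0 1,
    normalDerivWithin n h0 (closure (halfBall n h0 1)) u x
      = c x * u x ^ ((n : ℝ) / ((n : ℝ) - 2)))

/-- Condition (K1) with constant `C₀`. -/
def CondK1 (n : ℕ) (h0 : 0 < n) (C₀ : ℝ) (K : Euc n → ℝ) : Prop :=
  ContDiffOn ℝ (n - 2 : ℕ) K (closure (halfBall n h0 1)) ∧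
  ∀ x ∈ closure (halfBall n h0 1), ∀ j : ℕ, 1 ≤ j → j ≤ n - 2 →
    ‖iteratedFDerivWithin ℝ j K (closure (halfBall n h0 1)) x‖ ≤
      C₀ * ‖iteratedFDerivWithin ℝ 1 K (closure (halfBall n h0 1)) x‖ ^
        (((n : ℝ) - 2 - (j : ℝ)) / ((n : ℝ) - 3))

/-- Condition (K2) with constant `Λ`. -/
def CondK2 (n : ℕ) (h0 : 0 < n) (Λ : ℝ) (K : Euc n → ℝ) : Prop :=
  ∀ x ∈ closure (halfBall n h0 1),
    1 / Λ ≤ K x ∧ ∀ j : ℕ, 1 ≤ j → j ≤ n - 2 →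
      ‖iteratedFDerivWithin ℝ j K (closure (halfBall n h0 1)) x‖ ≤ Λ

/-- Condition (K3): `K` depends only on the first `n - 1` coordinates. -/
def CondK3 (n : ℕ) (h0 : 0 < n) (K : Euc n → ℝ) : Prop :=
  ∀ x ∈ closure (halfBall n h0 1), ∀ y ∈ closure (halfBall n h0 1),
    (∀ i : Fin n, i ≠ lastIdx n h0 → x i = y i) → K x = K y

section

/-- `g` is twice differentiable at `0`, with first and second derivatives `d₁`, `d₂`. -/
def HasD2 (g : ℝ → ℝ) (d₁ d₂ : ℝ) : Prop :=
  ∃ g' : ℝ → ℝ, (∀ᶠ s in 𝓝 0, HasDerivAt g (g' s) s) ∧ g' 0 = d₁ ∧ HasDerivAt g' d₂ 0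

namespace HasD2

variable {f g : ℝ → ℝ} {a b d₁ d₂ e₁ e₂ : ℝ}

lemma add (hf : HasD2 f d₁ d₂) (hg : HasD2 g e₁ e₂) :
    HasD2 (fun s => f s + g s) (d₁ + e₁) (d₂ + e₂) := by
  obtain ⟨f', hf, rfl, hf2⟩ := hf
  obtain ⟨g', hg, rfl, hg2⟩ := hg
  refine ⟨fun s => f' s + g' s, ?_, rfl, hf2.add hg2⟩
  filter_upwards [hf, hg] with s h1 h2 using h1.add h2

lemma mul (hf : HasD2 f d₁ d₂) (hg : HasD2 g e₁ e₂) :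
    HasD2 (fun s => f s * g s) (d₁ * g 0 + f 0 * e₁)
      (d₂ * g 0 + 2 * (d₁ * e₁) + f 0 * e₂) := by
  obtain ⟨f', hf, rfl, hf2⟩ := hf
  obtain ⟨g', hg, rfl, hg2⟩ := hg
  refine ⟨fun s => f' s * g s + f s * g' s, ?_, rfl, ?_⟩
  · filter_upwards [hf, hg] with s h1 h2 using h1.mul h2
  · have := (hf2.mul hg.self_of_nhds).add (hf.self_of_nhds.mul hg2)
    refine this.congr_deriv ?_
    ring

lemma const (c : ℝ) : HasD2 (fun _ => c) 0 0 :=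
  ⟨fun _ => 0, .of_forall fun s => hasDerivAt_const s c, rfl, hasDerivAt_const 0 0⟩

lemma id : HasD2 (fun s => s) 1 0 :=
  ⟨fun _ => 1, .of_forall fun s => hasDerivAt_id s, rfl, hasDerivAt_const 0 1⟩

lemma const_mul (c : ℝ) (hf : HasD2 f d₁ d₂) : HasD2 (fun s => c * f s) (c * d₁) (c * d₂) := by
  convert (const c).mul hf using 1 <;> ring

lemma comp_mul (c : ℝ) (hf : HasD2 f d₁ d₂) :
    HasD2 (fun s => f (c * s)) (c * d₁) (c ^ 2 * d₂) := by
  obtain ⟨f', hf, rfl, hf2⟩ := hf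
  have hc : Tendsto (fun s : ℝ => c * s) (𝓝 0) (𝓝 0) := by
    have : Continuous fun s : ℝ => c * s := by fun_prop
    simpa using this.tendsto 0
  have hd : ∀ s : ℝ, HasDerivAt (fun s : ℝ => c * s) c s := fun s => by
    simpa using (hasDerivAt_id s).const_mul c
  refine ⟨fun s => c * f' (c * s), ?_, by simp, ?_⟩
  · filter_upwards [hc.eventually hf] with s hs
    have := HasDerivAt.comp s hs (hd s)
    refine this.congr_deriv ?_
    ring
  · have h2 : HasDerivAt f' d₂ (c * 0) := by simpa using hf2
    have := (HasDerivAt.comp (0 : ℝ) h2 (hd 0)).const_mul c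
    refine this.congr_deriv ?_
    ring

/-- Chain rule: `φ` is a function of one real variable, twice differentiable at `f 0`. -/
lemma comp {φ φ' : ℝ → ℝ} {φ'' : ℝ} (hf : HasD2 f d₁ d₂)
    (h1 : ∀ᶠ t in 𝓝 (f 0), HasDerivAt φ (φ' t) t) (h2 : HasDerivAt φ' φ'' (f 0)) :
    HasD2 (fun s => φ (f s)) (φ' (f 0) * d₁) (φ'' * d₁ ^ 2 + φ' (f 0) * d₂) := by
  obtain ⟨f', hf, rfl, hf2⟩ := hf
  have h0 := hf.self_of_nhds
  refine ⟨fun s => φ' (f s) * f' s, ?_, rfl, ?_⟩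
  · filter_upwards [hf, h0.continuousAt.eventually h1] with s h h' using HasDerivAt.comp s h' h
  · refine ((HasDerivAt.comp (0 : ℝ) h2 h0).mul hf2).congr_deriv ?_
    simp only [Function.comp]; ring

lemma congr (hf : HasD2 f d₁ d₂) (h : ∀ᶠ s in 𝓝 0, g s = f s) : HasD2 g d₁ d₂ := by
  obtain ⟨f', hf, h1, hf2⟩ := hf
  refine ⟨f', ?_, h1, hf2⟩
  filter_upwards [hf, h.eventually_nhds] with s hs hs'
  exact hs.congr_of_eventuallyEq hs'

lemma nonneg_of_isLocalMin (hf : HasD2 f d₁ d₂) (hmin : IsLocalMin f 0) : 0 ≤ d₂ := by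
  by_contra! hneg
  obtain ⟨f', hf', rfl, hf2⟩ := hf
  have h0 : f' 0 = 0 := hmin.hasDerivAt_eq_zero hf'.self_of_nhds
  have hder : deriv f =ᶠ[𝓝 0] f' := by filter_upwards [hf'] with s hs using hs.deriv
  have hlm : IsLocalMax f 0 := by
    apply isLocalMax_of_deriv_deriv_neg
    · rw [hder.deriv_eq, hf2.deriv]; exact hneg
    · rw [hder.self_of_nhds, h0]
    · exact hf'.self_of_nhds.continuousAt
  have hconst : f =ᶠ[𝓝 0] fun _ => f 0 := by
    filter_upwards [hmin, hlm] with s h1 h2 using le_antisymm h2 h1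
  have : f' =ᶠ[𝓝 0] fun _ => 0 := by
    filter_upwards [hf', hconst.eventually_nhds] with s h1 h2
    exact h1.unique ((hasDerivAt_const s (f 0)).congr_of_eventuallyEq h2)
  have := hf2.unique ((hasDerivAt_const (0:ℝ) (0:ℝ)).congr_of_eventuallyEq this)
  linarith

end HasD2

variable {n : ℕ}

/-- `φ` has Laplacian `L` at `y`, computed along the lines of every orthonormal frame. -/
def HasLap (φ : Euc n → ℝ) (y : Euc n) (L : ℝ) : Prop :=
  ∀ B : OrthonormalBasis (Fin n) ℝ (Euc n), ∃ d₁ d₂ : Fin n → ℝ,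
    (∀ j, HasD2 (fun s => φ (y + s • B j)) (d₁ j) (d₂ j)) ∧ ∑ j, d₂ j = L

namespace HasLap

variable {φ ψ : Euc n → ℝ} {y : Euc n} {L M : ℝ}

lemma add (hφ : HasLap φ y L) (hψ : HasLap ψ y M) : HasLap (fun z => φ z + ψ z) y (L + M) := by
  intro B
  obtain ⟨d₁, d₂, h, rfl⟩ := hφ B
  obtain ⟨e₁, e₂, h', rfl⟩ := hψ B
  exact ⟨_, _, fun j => (h j).add (h' j), Finset.sum_add_distrib⟩

lemma const_mul (c : ℝ) (hφ : HasLap φ y L) : HasLap (fun z => c * φ z) y (c * L) := by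
  intro B
  obtain ⟨d₁, d₂, h, rfl⟩ := hφ B
  exact ⟨_, _, fun j => (h j).const_mul c, by rw [Finset.mul_sum]⟩

lemma neg (hφ : HasLap φ y L) : HasLap (fun z => -φ z) y (-L) := by
  simpa using hφ.const_mul (-1)

lemma sub (hφ : HasLap φ y L) (hψ : HasLap ψ y M) : HasLap (fun z => φ z - ψ z) y (L - M) := by
  simpa [sub_eq_add_neg] using hφ.add hψ.neg

lemma const (c : ℝ) : HasLap (fun _ : Euc n => c) y 0 :=
  fun _ => ⟨0, 0, fun _ => HasD2.const c, by simp⟩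

lemma congr (hφ : HasLap φ y L) (h : ψ =ᶠ[𝓝 y] φ) : HasLap ψ y L := by
  intro B
  obtain ⟨d₁, d₂, h', rfl⟩ := hφ B
  refine ⟨d₁, d₂, fun j => (h' j).congr ?_, rfl⟩
  have hc : Tendsto (fun s : ℝ => y + s • B j) (𝓝 0) (𝓝 y) := by
    have : Continuous fun s : ℝ => y + s • B j := by fun_prop
    simpa using this.tendsto 0
  exact hc.eventually h

lemma nonneg_of_isLocalMin (hφ : HasLap φ y L) (h : IsLocalMin φ y) : 0 ≤ L := by
  obtain ⟨d₁, d₂, h', rfl⟩ := hφ (EuclideanSpace.basisFun (Fin n) ℝ)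
  refine Finset.sum_nonneg fun j _ => (h' j).nonneg_of_isLocalMin ?_
  set e := EuclideanSpace.basisFun (Fin n) ℝ j
  have hc : Tendsto (fun s : ℝ => y + s • e) (𝓝 0) (𝓝 y) := by
    have : Continuous fun s : ℝ => y + s • e := by fun_prop
    simpa using this.tendsto 0
  have := hc.eventually h
  simpa [IsLocalMin, IsMinFilter] using this

/-- Rescaling. -/
lemma comp_affine (x : Euc n) (c : ℝ) (hφ : HasLap φ (x + c • y) L) :
    HasLap (fun z => φ (x + c • z)) y (c ^ 2 * L) := by
  intro B
  obtain ⟨d₁, d₂, h, rfl⟩ := hφ B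
  refine ⟨fun j => c * d₁ j, fun j => c ^ 2 * d₂ j, fun j => ?_, by rw [Finset.mul_sum]⟩
  have := (h j).comp_mul c
  simpa [smul_add, add_assoc, mul_smul] using this

lemma comp_isometry (I : Euc n ≃ₗᵢ[ℝ] Euc n) (hφ : HasLap φ (I y) L) :
    HasLap (fun z => φ (I z)) y L := by
  intro B
  obtain ⟨d₁, d₂, h, rfl⟩ := hφ (B.map I)
  exact ⟨d₁, d₂, fun j => by simpa using h j, rfl⟩

end HasLap

lemma hasD2_normSq (z e : Euc n) :
    HasD2 (fun s : ℝ => ‖z + s • e‖ ^ 2) (2 * inner ℝ z e) (2 * ‖e‖ ^ 2) := by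
  have h : (fun s : ℝ => ‖z + s • e‖ ^ 2) =
      fun s => ‖z‖ ^ 2 + (2 * inner ℝ z e * s + ‖e‖ ^ 2 * (s * s)) := by
    funext s
    rw [norm_add_sq_real, inner_smul_right, norm_smul, mul_pow, Real.norm_eq_abs, sq_abs]
    ring
  rw [h]
  convert (HasD2.const (‖z‖ ^ 2)).add ((HasD2.id.const_mul (2 * inner ℝ z e)).add
    ((HasD2.id.mul HasD2.id).const_mul (‖e‖ ^ 2))) using 1 <;> ring

lemma hasLap_normSq (x y : Euc n) : HasLap (fun z => ‖z - x‖ ^ 2) y (2 * n) := by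
  intro B
  refine ⟨fun j => 2 * inner ℝ (y - x) (B j), fun j => 2 * ‖B j‖ ^ 2, fun j => ?_, ?_⟩
  · simpa [add_sub_right_comm] using hasD2_normSq (y - x) (B j)
  · simp [mul_comm]

lemma hasLap_inner (e y : Euc n) : HasLap (fun z => inner ℝ e z) y 0 := by
  intro B
  refine ⟨fun j => inner ℝ e (B j), fun j => 0, fun j => ?_, by simp⟩
  have := (HasD2.const (inner ℝ e y)).add (HasD2.id.const_mul (inner ℝ e (B j)))
  simpa [inner_add_right, inner_smul_right, mul_comm] using this

lemma hasLap_innerSq (e y : Euc n) :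
    HasLap (fun z => (inner ℝ e z : ℝ) ^ 2) y (2 * ‖e‖ ^ 2) := by
  intro B
  refine ⟨fun j => 2 * (inner ℝ e y * inner ℝ e (B j)), fun j => 2 * (inner ℝ e (B j)) ^ 2,
    fun j => ?_, ?_⟩
  · have := (HasD2.const (inner ℝ e y)).add (HasD2.id.const_mul (inner ℝ e (B j)))
    have := this.mul this
    convert this using 1
    · funext s; simp [inner_add_right, inner_smul_right]; ring
    · simp; ring
    · simp; ring
  · rw [← Finset.mul_sum, B.sum_sq_inner_left]

lemma hasD2_normInv_pow (m : ℕ) {z : Euc n} (hz : z ≠ 0) (e : Euc n) :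
    HasD2 (fun s : ℝ => (‖z + s • e‖⁻¹) ^ m)
      (-(m:ℝ) * (‖z‖⁻¹) ^ (m + 2) * inner ℝ z e)
      ((m:ℝ) * (m + 2) * (‖z‖⁻¹) ^ (m + 4) * (inner ℝ z e) ^ 2
        - m * (‖z‖⁻¹) ^ (m + 2) * ‖e‖ ^ 2) := by
  have hr : 0 < ‖z‖ := norm_pos_iff.2 hz
  have hd : ∀ a : ℝ, ∀ t : ℝ, 0 < t → HasDerivAt (fun t : ℝ => t ^ a) (a * t ^ (a - 1)) t :=
    fun a t ht => Real.hasDerivAt_rpow_const (Or.inl ht.ne')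
  have h0 : 0 < ‖z + (0:ℝ) • e‖ ^ 2 := by simpa using by positivity
  have e1 : ∀ k : ℕ, ∀ t : ℝ, 0 < t → (t ^ 2) ^ (-(k:ℝ)/2) = (t⁻¹) ^ k := by
    intro k t ht
    rw [← Real.rpow_natCast, ← Real.rpow_mul ht.le, inv_pow, ← Real.rpow_natCast,
      ← Real.rpow_neg ht.le]
    congr 1; push_cast; ring
  have := (hasD2_normSq z e).comp (φ := fun t => t ^ (-(m:ℝ)/2))
    (φ' := fun t => (-(m:ℝ)/2) * t ^ (-(m:ℝ)/2 - 1))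
    (φ'' := (-(m:ℝ)/2) * ((-(m:ℝ)/2 - 1) * (‖z + (0:ℝ) • e‖ ^ 2) ^ (-(m:ℝ)/2 - 1 - 1)))
    (by filter_upwards [lt_mem_nhds h0] with t ht using hd _ t ht)
    ((hd _ _ h0).const_mul _)
  have ea : -(m:ℝ)/2 - 1 = -((m + 2 : ℕ):ℝ)/2 := by push_cast; ring
  have eb : -(m:ℝ)/2 - 1 - 1 = -((m + 4 : ℕ):ℝ)/2 := by push_cast; ring
  rw [eb, ea] at this
  simp only [zero_smul, add_zero, e1 _ _ hr] at this
  refine HasD2.congr (f := fun s => (‖z + s • e‖ ^ 2) ^ (-(m:ℝ)/2)) ?_ ?_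
  · convert this using 1
    · ring
    · push_cast; ring
  · have hc : ContinuousAt (fun s : ℝ => ‖z + s • e‖) 0 := by fun_prop
    have : 0 < ‖z + (0:ℝ) • e‖ := by simpa using hr
    filter_upwards [hc.eventually (lt_mem_nhds this)] with s hs
    rw [e1 _ _ hs]

/-- The radial functions `‖z - x‖⁻ᵐ`. -/
lemma hasLap_normInv_pow (m : ℕ) (x y : Euc n) (hxy : y ≠ x) :
    HasLap (fun z => (‖z - x‖⁻¹) ^ m) y (m * (m + 2 - n) * (‖y - x‖⁻¹) ^ (m + 2)) := by
  have hr : 0 < ‖y - x‖ := norm_pos_iff.2 (sub_ne_zero.2 hxy)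
  intro B
  have key := fun j => hasD2_normInv_pow m (sub_ne_zero.2 hxy) (B j)
  simp only [← add_sub_right_comm] at key
  refine ⟨_, _, key, ?_⟩
  rw [Finset.sum_sub_distrib, ← Finset.mul_sum, B.sum_sq_inner_left]
  have : (‖y - x‖⁻¹) ^ (m + 4) * ‖y - x‖ ^ 2 = (‖y - x‖⁻¹) ^ (m + 2) := by
    rw [show m + 4 = m + 2 + 2 from rfl, pow_add _ (m+2) 2, mul_assoc, ← mul_pow,
      inv_mul_cancel₀ hr.ne', one_pow, mul_one]
  simp only [B.norm_eq_one, one_pow, mul_one, Finset.sum_const, Finset.card_univ,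
    Fintype.card_fin, nsmul_eq_mul]
  rw [mul_assoc, this]; ring

end

section

variable {n : ℕ}

lemma HasD2.congr_right {f : ℝ → ℝ} {a b c : ℝ} (h : HasD2 f a b) (e : b = c) : HasD2 f a c :=
  e ▸ h

lemma hasD2_comp_curve {v : Euc n → ℝ} {γ γ' : ℝ → Euc n} {γ'' : Euc n}
    (hv : ContDiffAt ℝ 2 v (γ 0)) (h1 : ∀ᶠ s in 𝓝 0, HasDerivAt γ (γ' s) s)
    (h2 : HasDerivAt γ' γ'' 0) :
    HasD2 (fun s => v (γ s)) (fderiv ℝ v (γ 0) (γ' 0))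
      (iteratedFDeriv ℝ 2 v (γ 0) ![γ' 0, γ' 0] + fderiv ℝ v (γ 0) γ'') := by
  have hd : ∀ᶠ z in 𝓝 (γ 0), DifferentiableAt ℝ v z := by
    filter_upwards [hv.eventually (by simp)] with z hz using hz.differentiableAt (by simp)
  have hd2 : DifferentiableAt ℝ (fderiv ℝ v) (γ 0) :=
    (hv.fderiv_right (m := 1) (by norm_num)).differentiableAt (by simp)
  have h0 := h1.self_of_nhds
  refine ⟨fun s => fderiv ℝ v (γ s) (γ' s), ?_, rfl, ?_⟩
  · filter_upwards [h1, h0.continuousAt.eventually hd] with s hs hs'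
    exact hs'.hasFDerivAt.comp_hasDerivAt s hs
  · have := (hd2.hasFDerivAt.comp_hasDerivAt (0:ℝ) h0).clm_apply h2
    refine this.congr_deriv ?_
    simp [iteratedFDeriv_two_apply]

lemma hasLap_of_contDiffAt {v : Euc n → ℝ} {y : Euc n} (hv : ContDiffAt ℝ 2 v y) :
    HasLap v y (Laplacian.laplacian v y) := by
  intro B
  refine ⟨fun j => fderiv ℝ v y (B j), fun j => iteratedFDeriv ℝ 2 v y ![B j, B j],
    fun j => ?_, ?_⟩
  · have hd : ∀ s : ℝ, HasDerivAt (fun s : ℝ => y + s • B j) (B j) s := fun s => by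
      simpa using ((hasDerivAt_id s).smul_const (B j)).const_add y
    have := hasD2_comp_curve (v := v) (γ := fun s => y + s • B j) (γ' := fun _ => B j)
      (by simpa using hv) (.of_forall hd) (hasDerivAt_const 0 _)
    simpa using this
  · rw [InnerProductSpace.laplacian_eq_iteratedFDeriv_orthonormalBasis v B]

lemma HasLap.unique {v : Euc n → ℝ} {y : Euc n} {L M : ℝ} (h : HasLap v y L)
    (h' : HasLap v y M) : L = M := by
  have h1 := (h.sub h').congr (ψ := fun _ => 0) (by simp)
  have h2 := (h'.sub h).congr (ψ := fun _ => 0) (by simp)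
  have hm : IsLocalMin (fun _ : Euc n => (0:ℝ)) y := .of_forall fun _ => le_rfl
  linarith [h1.nonneg_of_isLocalMin hm, h2.nonneg_of_isLocalMin hm]

/-- The image of `y` under inversion in the sphere of centre `x` and radius `l`. -/
def inv (x : Euc n) (l : ℝ) (y : Euc n) : Euc n := x + (l * ‖y - x‖⁻¹) ^ 2 • (y - x)

/-- The Kelvin transform of `v` in the sphere of centre `x` and radius `l`. -/
def kelvin (x : Euc n) (l : ℝ) (v : Euc n → ℝ) (y : Euc n) : ℝ :=
  (l * ‖y - x‖⁻¹) ^ (n - 2) * v (inv x l y)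

lemma hasLap_kelvin {N : ℕ} {v : Euc (N + 2) → ℝ} {x y : Euc (N + 2)} {l L : ℝ} (hl : 0 < l)
    (hxy : y ≠ x) (hv : ContDiffAt ℝ 2 v (inv x l y)) (hL : HasLap v (inv x l y) L) :
    HasLap (kelvin x l v) y ((l * ‖y - x‖⁻¹) ^ (N + 4) * L) := by
  have hr : 0 < ‖y - x‖ := norm_pos_iff.2 (sub_ne_zero.2 hxy)
  set z := y - x with hz
  set ω := ‖z‖⁻¹ with hω
  have hωr : ω * ‖z‖ = 1 := inv_mul_cancel₀ hr.ne'
  intro B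
  set A := fderiv ℝ v (inv x l y)
  set H := iteratedFDeriv ℝ 2 v (inv x l y)
  -- the reflected frame
  set R := (ℝ ∙ z)ᗮ.reflection
  have hRB : ∀ j, R (B j) = B j - (2 * ω ^ 2 * inner ℝ z (B j)) • z := by
    intro j
    rw [Submodule.reflection_orthogonal_apply, Submodule.reflection_singleton_apply]
    rw [two_smul]
    simp only [hω, RCLike.ofReal_real_eq_id, id]
    match_scalars <;> field_simp <;> ring
  have hsum : ∑ j, H ![R (B j), R (B j)] = L := by
    have := InnerProductSpace.laplacian_eq_iteratedFDeriv_orthonormalBasis v (B.map R)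
    rw [← (hasLap_of_contDiffAt hv).unique hL, this]
    simp [H]
  have hz0 : z ≠ 0 := norm_pos_iff.1 hr
  have key : ∀ j, ∃ d₁, HasD2 (fun s => kelvin x l v (y + s • B j)) d₁
      (l ^ N * (N * (N + 2) * ω ^ (N + 4) * (inner ℝ z (B j)) ^ 2 - N * ω ^ (N + 2))
          * v (inv x l y)
        + 2 * ((l ^ N * (-N * ω ^ (N + 2) * inner ℝ z (B j))) *
          (l ^ 2 * ω ^ 2 * (A (B j) - 2 * ω ^ 2 * inner ℝ z (B j) * A z)))
        + (l * ω) ^ N * (l ^ 4 * ω ^ 4 * H ![R (B j), R (B j)]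
          + (l ^ 2 * (8 * ω ^ 6 * (inner ℝ z (B j)) ^ 2 - 2 * ω ^ 4) * A z
            - 4 * l ^ 2 * ω ^ 4 * inner ℝ z (B j) * A (B j)))) := by
    intro j
    have hf := (hasD2_normInv_pow N hz0 (B j)).const_mul (l ^ N)
    have hα := (hasD2_normInv_pow 2 hz0 (B j)).const_mul (l ^ 2)
    have hβ := HasD2.id.mul hα
    obtain ⟨α', hα1, hα2, hα3⟩ := hα
    obtain ⟨β', hβ1, hβ2, hβ3⟩ := hβ
    have hγ := hasD2_comp_curve (v := v)
      (γ := fun s => x + ((l ^ 2 * ‖z + s • B j‖⁻¹ ^ 2) • z +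
        (s * (l ^ 2 * ‖z + s • B j‖⁻¹ ^ 2)) • B j))
      (γ' := fun s => α' s • z + β' s • B j) (by simpa [mul_pow, inv] using hv)
      (by
        filter_upwards [hα1, hβ1] with s h1 h2
        exact ((h1.smul_const z).add (h2.smul_const (B j))).const_add x)
      ((hα3.smul_const z).add (hβ3.smul_const (B j)))
    have hγ0 : α' 0 • z + β' 0 • B j = (l ^ 2 * ω ^ 2) • R (B j) := by
      rw [hα2, hβ2, hRB]
      simp only [← hω, zero_smul, add_zero, Nat.cast_ofNat]
      match_scalars <;> ring
    rw [hγ0] at hγ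
    have hi : x + ((l ^ 2 * ‖z + (0:ℝ) • B j‖⁻¹ ^ 2) • z +
        ((0:ℝ) * (l ^ 2 * ‖z + (0:ℝ) • B j‖⁻¹ ^ 2)) • B j) = inv x l y := by
      simp [inv, mul_pow, hz]
    rw [hi] at hγ
    refine ⟨_, ((hf.mul hγ).congr (g := fun s => kelvin x l v (y + s • B j))
      (.of_forall fun s => ?_)).congr_right ?_⟩
    · have e1 : y + s • B j - x = z + s • B j := by rw [hz]; abel
      simp only [kelvin, inv, e1, Nat.add_sub_cancel, mul_pow]
      congr 3
      module
    · have hH : H ![(l ^ 2 * ω ^ 2) • R (B j), (l ^ 2 * ω ^ 2) • R (B j)] =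
          l ^ 4 * ω ^ 4 * H ![R (B j), R (B j)] := by
        have := H.map_smul_univ (fun _ => l ^ 2 * ω ^ 2) ![R (B j), R (B j)]
        simp only [Fin.prod_univ_two, smul_eq_mul] at this
        rw [show l ^ 4 * ω ^ 4 = (l ^ 2 * ω ^ 2) * (l ^ 2 * ω ^ 2) by ring, ← this]
        congr 1
        ext i : 1
        fin_cases i <;> rfl
      have hA : A ((l ^ 2 * ω ^ 2) • R (B j)) =
          l ^ 2 * ω ^ 2 * (A (B j) - 2 * ω ^ 2 * inner ℝ z (B j) * A z) := by
        rw [hRB]; simp only [map_smul, map_sub, smul_eq_mul]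
      have hAd : fderiv ℝ v (inv x l y) = A := rfl
      have hHd : iteratedFDeriv ℝ 2 v (inv x l y) = H := rfl
      simp only [hi, hAd, hHd, hH, hA]
      simp only [map_add, map_smul, smul_eq_mul, zero_smul, add_zero, ← hω, B.norm_eq_one,
        Nat.cast_ofNat, mul_pow]
      ring
  choose d₁ hd using key
  refine ⟨d₁, _, hd, ?_⟩
  have hc2 : ∑ j, (inner ℝ z (B j) : ℝ) ^ 2 = ‖z‖ ^ 2 := B.sum_sq_inner_left z
  have hcA : ∑ j, (inner ℝ z (B j) : ℝ) * A (B j) = A z := by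
    conv_rhs => rw [← B.sum_repr' z, map_sum]
    simp [real_inner_comm]
  have hz2 : ω ^ 2 * ‖z‖ ^ 2 = 1 := by rw [← mul_pow, hωr, one_pow]
  set V := v (inv x l y)
  trans ((l ^ N * (N * (N + 2)) * ω ^ (N + 4) * V + 4 * N * l ^ N * l ^ 2 * ω ^ (N + 2) * ω ^ 4 * A z
      + 8 * (l * ω) ^ N * l ^ 2 * ω ^ 6 * A z) * ∑ j, (inner ℝ z (B j) : ℝ) ^ 2
    + (- 2 * N * l ^ N * l ^ 2 * ω ^ (N + 2) * ω ^ 2 - 4 * (l * ω) ^ N * l ^ 2 * ω ^ 4) *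
      ∑ j, (inner ℝ z (B j) : ℝ) * A (B j)
    + (l * ω) ^ N * l ^ 4 * ω ^ 4 * ∑ j, H ![R (B j), R (B j)]
    + (- l ^ N * N * ω ^ (N + 2) * V - 2 * (l * ω) ^ N * l ^ 2 * ω ^ 4 * A z) *
      ∑ j : Fin (N + 2), (1 : ℝ))
  · simp only [Finset.mul_sum, ← Finset.sum_add_distrib]
    refine Finset.sum_congr rfl fun j _ => ?_
    ring
  · rw [hc2, hcA, hsum]
    simp only [Finset.sum_const, Finset.card_univ, Fintype.card_fin, nsmul_eq_mul]
    push_cast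
    linear_combination (l ^ N * (N * (N + 2)) * ω ^ (N + 2) * V
      + 4 * N * l ^ N * l ^ 2 * ω ^ (N + 4) * A z
      + 8 * (l * ω) ^ N * l ^ 2 * ω ^ 4 * A z) * hz2

end

section

variable {n : ℕ}

lemma min_principle {A U : Set (Euc n)} {φ : Euc n → ℝ} {c : ℝ} (hA : IsCompact A)
    (hU : IsOpen U) (hUA : U ⊆ A) (hφ : ContinuousOn φ A)
    (hlap : ∀ y ∈ U, ∃ L < 0, HasLap φ y L) (hbd : ∀ y ∈ A \ U, c ≤ φ y) :
    ∀ y ∈ A, c ≤ φ y := by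
  intro y hy
  obtain ⟨z, hz, hmin⟩ := hA.exists_isMinOn ⟨y, hy⟩ hφ
  refine le_trans ?_ (hmin hy)
  by_cases hzU : z ∈ U
  · obtain ⟨L, hL, hL'⟩ := hlap z hzU
    have : IsLocalMin φ z := hmin.isLocalMin (mem_of_superset (hU.mem_nhds hzU) hUA)
    linarith [hL'.nonneg_of_isLocalMin this]
  · exact hbd z ⟨hz, hzU⟩

/-- Comparison principle passing to the limit along a filter. -/
lemma limit_comparison (hn : 0 < n) {ι : Type*} {F : Filter ι} [F.NeBot] {A U : Set (Euc n)}
    {W : ι → Euc n → ℝ} {w : Euc n → ℝ} (hA : IsCompact A) (hU : IsOpen U) (hUA : U ⊆ A)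
    (hcont : ∀ᶠ i in F, ContinuousOn (W i) A)
    (hlap : ∀ δ > 0, ∀ᶠ i in F, ∀ y ∈ U, ∃ L ≤ δ, HasLap (W i) y L)
    (hlim : ∀ δ > 0, ∀ᶠ i in F, ∀ y ∈ A, |W i y - w y| ≤ δ)
    (hbd : ∀ y ∈ A \ U, 0 ≤ w y) : ∀ y ∈ A, 0 ≤ w y := by
  obtain ⟨ρ, hρ⟩ := hA.isBounded.subset_closedBall (0 : Euc n)
  have hn' : (0:ℝ) < n := by exact_mod_cast hn
  have key : ∀ η > 0, ∀ y ∈ A, -(η * (2 + ρ ^ 2)) ≤ w y := by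
    intro η hη y hy
    obtain ⟨i, h1, h2, h3⟩ := (hcont.and ((hlap (n * η) (by positivity)).and
      (hlim η hη))).exists
    have hle : ∀ y ∈ A, ‖y‖ ^ 2 ≤ ρ ^ 2 := fun y hy => by
      have := hρ hy
      rw [mem_closedBall_zero_iff] at this
      gcongr
    have := min_principle (φ := fun y => W i y + η * (ρ ^ 2 - ‖y - 0‖ ^ 2)) (c := -η) hA hU hUA
      (h1.add (by fun_prop)) ?_ ?_ y hy
    · have h4 := abs_le.1 (h3 y hy)
      have h5 : η * (ρ ^ 2 - ‖y - 0‖ ^ 2) ≤ η * ρ ^ 2 := by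
        gcongr; simp
      nlinarith
    · intro z hz
      obtain ⟨L, hL, hL'⟩ := h2 z hz
      refine ⟨_, ?_, hL'.add (((HasLap.const (ρ ^ 2)).sub (hasLap_normSq 0 z)).const_mul η)⟩
      have : 0 < n * η := by positivity
      nlinarith
    · intro z hz
      have h4 := abs_le.1 (h3 z hz.1)
      have h5 := hle z hz.1
      have h6 := hbd z hz
      have : 0 ≤ η * (ρ ^ 2 - ‖z - 0‖ ^ 2) := by
        rw [sub_zero]; exact mul_nonneg hη.le (by linarith)
      linarith
  intro y hy
  by_contra! hneg
  have hp : 0 < 2 + ρ ^ 2 := by positivity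
  have := key (-w y / (2 * (2 + ρ ^ 2))) (div_pos (by linarith) (by positivity)) y hy
  rw [div_mul_eq_mul_div, mul_div_mul_right _ _ hp.ne'] at this
  linarith

lemma nonneg_of_hasDerivWithinAt_right {f : ℝ → ℝ} {d : ℝ} (h : HasDerivWithinAt f d (Ici 0) 0)
    (hf : ∀ᶠ s in 𝓝[>] 0, f 0 ≤ f s) : 0 ≤ d := by
  have h1 := (hasDerivWithinAt_iff_tendsto_slope' (by simp)).1 (h.mono Ioi_subset_Ici_self)
  refine ge_of_tendsto h1 ?_
  filter_upwards [hf, self_mem_nhdsWithin] with s hs hs0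
  rw [slope_def_field]
  have : (0:ℝ) < s := hs0
  exact div_nonneg (by linarith) (by linarith)

/-- Interior gradient bound for functions with bounded Laplacian. -/
lemma norm_fderiv_le {u : Euc n → ℝ} {x₀ : Euc n} {d N₀ F : ℝ} (hd : 0 < d)
    (hu : ∀ y ∈ closedBall x₀ d, ContDiffAt ℝ 2 u y) (hN : ∀ y ∈ closedBall x₀ d, |u y| ≤ N₀)
    (hF : ∀ y ∈ closedBall x₀ d, ∃ L, HasLap u y L ∧ |L| ≤ F) :
    ‖fderiv ℝ u x₀‖ ≤ n * N₀ / d + F * d / 2 := by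
  have hN0 : 0 ≤ N₀ := (abs_nonneg _).trans (hN x₀ (by simp [hd.le]))
  have hF0 : 0 ≤ F := by
    obtain ⟨L, _, hL⟩ := hF x₀ (by simp [hd.le])
    exact (abs_nonneg _).trans hL
  have hdx : DifferentiableAt ℝ u x₀ := (hu x₀ (by simp [hd.le])).differentiableAt (by simp)
  have key : ∀ e : Euc n, ‖e‖ = 1 → ∀ F' > F,
      fderiv ℝ u x₀ e ≤ n * N₀ / d + F' * d / 2 := by
    intro e he F' hF'
    set R := (ℝ ∙ e)ᗮ.reflection with hR
    have hRe : ∀ z, R z = z - (2 * inner ℝ e z) • e := by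
      intro z
      rw [hR, Submodule.reflection_orthogonal_apply, Submodule.reflection_singleton_apply, two_smul]
      simp [he]
      module
    set Φ : Euc n → ℝ := fun z => (N₀ / d ^ 2) * (‖z - 0‖ ^ 2 +
      n * (d * inner ℝ e z - (inner ℝ e z) ^ 2)) + (F' / 2) * (d * inner ℝ e z - (inner ℝ e z) ^ 2)
      - (1 / 2) * (u (x₀ + (1:ℝ) • z) - u (x₀ + (1:ℝ) • R z)) with hΦ
    have hin : ∀ z, ‖z‖ ≤ d → x₀ + (1:ℝ) • z ∈ closedBall x₀ d := fun z hz => by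
      simpa using hz
    have hmain : ∀ z ∈ closedBall (0 : Euc n) d ∩ {z | 0 ≤ inner ℝ e z}, 0 ≤ Φ z := by
      have hce : Continuous fun z : Euc n => (inner ℝ e z : ℝ) := by fun_prop
      refine min_principle (U := ball (0 : Euc n) d ∩ {z | 0 < inner ℝ e z})
        ((isCompact_closedBall _ _).inter_right (isClosed_le continuous_const hce))
        (isOpen_ball.inter (isOpen_lt continuous_const hce))
        (fun z hz => ⟨ball_subset_closedBall hz.1, (mem_ofPred.1 hz.2).le⟩) ?_ ?_ ?_
      · have h1 : ContinuousOn (fun z : Euc n => u (x₀ + (1:ℝ) • z)) (closedBall 0 d) := by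
          intro z hz
          have h3 := hin z (by simpa using hz)
          exact ContinuousAt.continuousWithinAt (ContinuousAt.comp (f := fun z => x₀ + (1:ℝ) • z)
            (hu _ h3).continuousAt (by fun_prop))
        have h2 : ContinuousOn (fun z : Euc n => u (x₀ + (1:ℝ) • R z)) (closedBall 0 d) := by
          intro z hz
          have h3 := hin (R z) (by simpa using hz)
          exact ContinuousAt.continuousWithinAt (ContinuousAt.comp (f := fun z => x₀ + (1:ℝ) • R z)
            (hu _ h3).continuousAt (by fun_prop))
        have h3 := (h1.sub h2).mono (s := closedBall (0 : Euc n) d)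
          (t := closedBall (0 : Euc n) d ∩ {z | 0 ≤ inner ℝ e z}) inter_subset_left
        refine ContinuousOn.sub (by fun_prop) (h3.const_smul (1/2 : ℝ))
      · rintro z ⟨hz, hez⟩
        have hz' : ‖z‖ ≤ d := by simpa using (mem_ball.1 hz).le
        obtain ⟨L₁, hL₁, hL₁'⟩ := hF _ (hin z hz')
        obtain ⟨L₂, hL₂, hL₂'⟩ := hF _ (hin (R z) (by simpa using hz'))
        have hq : HasLap (fun z => d * inner ℝ e z - (inner ℝ e z : ℝ) ^ 2) z
            (d * 0 - 2 * ‖e‖ ^ 2) := ((hasLap_inner e z).const_mul d).sub (hasLap_innerSq e z)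
        refine ⟨_, ?_, ((((hasLap_normSq 0 z).add (hq.const_mul n)).const_mul (N₀ / d ^ 2)).add
          (hq.const_mul (F' / 2))).sub (((hL₁.comp_affine x₀ 1).sub
            ((hL₂.comp_affine x₀ 1).comp_isometry R)).const_mul (1 / 2))⟩
        rw [he]
        have := abs_le.1 hL₁'
        have := abs_le.1 hL₂'
        linarith
      · rintro z ⟨⟨hz, hez⟩, hzU⟩
        have hz' : ‖z‖ ≤ d := by simpa using hz
        have hez : 0 ≤ (inner ℝ e z : ℝ) := hez
        have hs : (inner ℝ e z : ℝ) ≤ d :=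
          (real_inner_le_norm e z).trans (by rw [he, one_mul]; exact hz')
        have hs2 : 0 ≤ d * inner ℝ e z - (inner ℝ e z : ℝ) ^ 2 := by nlinarith
        rcases hez.eq_or_lt with h0 | hpos
        · simp only [hΦ, hRe, ← h0]
          simp
          positivity
        · have hzd : ‖z‖ = d := by
            by_contra hne
            exact hzU ⟨by simpa using lt_of_le_of_ne hz' hne, hpos⟩
          have h1 := abs_le.1 (hN _ (hin z hz'))
          have h2 := abs_le.1 (hN _ (hin (R z) (by simpa using hz')))
          have h3 : N₀ / d ^ 2 * (‖z - 0‖ ^ 2 + n * (d * inner ℝ e z - (inner ℝ e z) ^ 2)) =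
              N₀ + N₀ / d ^ 2 * (n * (d * inner ℝ e z - (inner ℝ e z) ^ 2)) := by
            rw [sub_zero, hzd]; field_simp
          have h4 : 0 ≤ N₀ / d ^ 2 * (n * (d * inner ℝ e z - (inner ℝ e z) ^ 2)) := by positivity
          have h5 : 0 ≤ (F' / 2) * (d * inner ℝ e z - (inner ℝ e z) ^ 2) :=
            mul_nonneg (by linarith) hs2
          simp only [hΦ]
          rw [h3]
          linarith
    set D : ℝ → ℝ := fun s => (N₀ / d ^ 2) * (s ^ 2 + n * (d * s - s ^ 2))
      + (F' / 2) * (d * s - s ^ 2) - (1 / 2) * (u (x₀ + s • e) - u (x₀ + (-s) • e)) with hD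
    have hDΦ : ∀ s, 0 ≤ s → Φ (s • e) = D s := by
      intro s hs
      have hs' : inner ℝ e (s • e) = s := by simp [inner_smul_right, he]
      simp only [hΦ, hD, hRe, hs']
      congr 2
      · simp [norm_smul, he]
      · rw [show x₀ + (1:ℝ) • (s • e - (2 * s) • e) = x₀ + (-s) • e by module, one_smul]
    have hder : HasDerivAt D ((N₀ / d ^ 2) * (n * d) + (F' / 2) * d - fderiv ℝ u x₀ e) 0 := by
      have hl : ∀ a : ℝ, HasDerivAt (fun s : ℝ => u (x₀ + (a * s) • e)) (a * fderiv ℝ u x₀ e) 0 := by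
        intro a
        have h1 : HasDerivAt (fun s : ℝ => x₀ + (a * s) • e) (a • e) 0 := by
          simpa using (((hasDerivAt_id (0:ℝ)).const_mul a).smul_const e).const_add x₀
        have h2 : HasFDerivAt u (fderiv ℝ u x₀) (x₀ + (a * 0) • e) := by
          simpa using hdx.hasFDerivAt
        refine (h2.comp_hasDerivAt (0:ℝ) h1).congr_deriv ?_
        simp
      have h1 := hl 1
      have h2 := hl (-1)
      simp only [one_mul, neg_one_mul] at h1 h2
      have hq : HasDerivAt (fun s : ℝ => s ^ 2) 0 0 := by simpa using hasDerivAt_pow 2 (0:ℝ)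
      have hq2 : HasDerivAt (fun s : ℝ => d * s - s ^ 2) d 0 := by
        refine (((hasDerivAt_id (0:ℝ)).const_mul d).sub hq).congr_deriv ?_
        simp
      have := (((hq.add (hq2.const_mul (n:ℝ))).const_mul (N₀ / d ^ 2)).add
        (hq2.const_mul (F' / 2))).sub ((h1.sub h2).const_mul (1/2))
      refine this.congr_deriv ?_
      ring
    have hnn := nonneg_of_hasDerivWithinAt_right hder.hasDerivWithinAt (by
      have hD0 : D 0 = 0 := by simp [hD]
      filter_upwards [Ioo_mem_nhdsGT hd] with s hs
      rw [hD0, ← hDΦ s hs.1.le]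
      refine hmain _ ⟨?_, ?_⟩
      · simp [norm_smul, he, abs_of_pos hs.1, hs.2.le]
      · simp [inner_smul_right, he, hs.1.le])
    have : N₀ / d ^ 2 * (n * d) = n * N₀ / d := by field_simp
    linarith
  have key2 : ∀ e : Euc n, ‖e‖ = 1 → fderiv ℝ u x₀ e ≤ n * N₀ / d + F * d / 2 := by
    intro e he
    refine le_of_forall_pos_le_add fun ε hε => ?_
    have := key e he (F + 2 * ε / d) (by have : 0 < 2 * ε / d := by positivity
                                         linarith)
    rw [add_mul] at this
    have h2 : 2 * ε / d * d = 2 * ε := by field_simp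
    linarith
  refine ContinuousLinearMap.opNorm_le_bound _ (by positivity) fun w => ?_
  rcases eq_or_ne w 0 with rfl | hw
  · simp
  have hw' : 0 < ‖w‖ := norm_pos_iff.2 hw
  have h1 := key2 (‖w‖⁻¹ • w) (by rw [norm_smul, norm_inv, norm_norm, inv_mul_cancel₀ hw'.ne'])
  have h2 := key2 (-(‖w‖⁻¹ • w)) (by
    rw [norm_neg, norm_smul, norm_inv, norm_norm, inv_mul_cancel₀ hw'.ne'])
  rw [map_neg] at h2
  rw [map_smul, smul_eq_mul] at h1 h2
  have h3 : ‖w‖⁻¹ * fderiv ℝ u x₀ w * ‖w‖ = fderiv ℝ u x₀ w := by field_simp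
  rw [Real.norm_eq_abs, abs_le]
  constructor
  · nlinarith
  · nlinarith

/-- Tangent line inequality for the convex function `t ↦ tᵖ`. -/
lemma rpow_tangent {p a c : ℝ} (hp : 1 < p) (ha : 0 ≤ a) (hc : 0 ≤ c) :
    a ^ p - c ^ p ≤ p * a ^ (p - 1) * (a - c) := by
  rcases ha.eq_or_lt with rfl | ha
  · rw [Real.zero_rpow (by linarith), Real.zero_rpow (by linarith)]
    have := Real.rpow_nonneg hc p
    simp; linarith
  · have h1 := one_add_mul_self_le_rpow_one_add (s := c / a - 1)
      (by have := div_nonneg hc ha.le; linarith) hp.le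
    rw [show 1 + (c / a - 1) = c / a by ring, Real.div_rpow hc ha.le,
      le_div_iff₀ (Real.rpow_pos_of_pos ha p)] at h1
    have h2 : a ^ p = a ^ (p - 1) * a := by
      rw [← Real.rpow_add_one ha.ne']; congr 1; ring
    rw [h2] at h1 ⊢
    have h3 : (1 + p * (c / a - 1)) * (a ^ (p - 1) * a) =
        a ^ (p - 1) * a + p * a ^ (p - 1) * (c - a) := by field_simp
    linarith

end

section

variable {n N : ℕ}

/-- A ball truncated by the half-space `{y : -T ≤ y ℓ}`. -/
def dom (ℓ : Fin n) (ρ T : ℝ) : Set (Euc n) := {y | ‖y‖ ≤ ρ ∧ -T ≤ y ℓ}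

/-- The interior of `dom`. -/
def domInt (ℓ : Fin n) (ρ T : ℝ) : Set (Euc n) := {y | ‖y‖ < ρ ∧ -T < y ℓ}

/-- The inward normal direction. -/
abbrev nu (ℓ : Fin n) : Euc n := EuclideanSpace.single ℓ 1

lemma continuous_coord (ℓ : Fin n) : Continuous fun y : Euc n => y ℓ := by fun_prop

lemma isCompact_dom (ℓ : Fin n) (ρ T : ℝ) : IsCompact (dom ℓ ρ T) := by
  have h : dom ℓ ρ T = closedBall 0 ρ ∩ {y | -T ≤ y ℓ} := by ext; simp [dom]
  rw [h]
  exact (isCompact_closedBall _ _).inter_right (isClosed_le continuous_const (continuous_coord ℓ))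

lemma isOpen_domInt (ℓ : Fin n) (ρ T : ℝ) : IsOpen (domInt ℓ ρ T) :=
  (isOpen_lt continuous_norm continuous_const).inter
    (isOpen_lt continuous_const (continuous_coord ℓ))

lemma domInt_subset_dom (ℓ : Fin n) (ρ T : ℝ) : domInt ℓ ρ T ⊆ dom ℓ ρ T :=
  fun _ hy => ⟨hy.1.le, hy.2.le⟩

lemma touch {ℓ : Fin n} {ρ T r₀ : ℝ} {x y : Euc n} {W : Euc n → ℝ} (hy : y ∈ dom ℓ ρ T)
    (hyρ : ‖y‖ < ρ) (hr : r₀ < ‖y - x‖)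
    (hmin : ∀ z ∈ dom ℓ ρ T, r₀ ≤ ‖z - x‖ → W y ≤ W z) :
    (y ∈ domInt ℓ ρ T ∧ ∀ L, HasLap W y L → 0 ≤ L) ∨
    (y ℓ = -T ∧ ∀ d, HasDerivWithinAt (fun s : ℝ => W (y + s • nu ℓ)) d (Ici 0) 0 → 0 ≤ d) := by
  have hc : Continuous fun z : Euc n => ‖z - x‖ := by fun_prop
  have hev : ∀ᶠ z in 𝓝 y, ‖z‖ < ρ ∧ r₀ < ‖z - x‖ :=
    (continuous_norm.continuousAt.eventually_lt_const hyρ).and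
      (hc.continuousAt.eventually_const_lt hr)
  rcases hy.2.eq_or_lt with h | h
  · refine Or.inr ⟨h.symm, fun d hd => nonneg_of_hasDerivWithinAt_right hd ?_⟩
    have hcc : Tendsto (fun s : ℝ => y + s • nu ℓ) (𝓝[>] 0) (𝓝 y) := by
      have : Continuous fun s : ℝ => y + s • nu ℓ := by fun_prop
      have := this.tendsto 0
      simp only [zero_smul, add_zero] at this
      exact this.mono_left nhdsWithin_le_nhds
    filter_upwards [hcc.eventually hev, self_mem_nhdsWithin] with s hs hs0
    have hs0 : 0 < s := hs0
    simp only [zero_smul, add_zero]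
    refine hmin _ ⟨hs.1.le, ?_⟩ hs.2.le
    simp [← h, hs0.le]
  · refine Or.inl ⟨⟨hyρ, h⟩, fun L hL => hL.nonneg_of_isLocalMin ?_⟩
    filter_upwards [hev, (isOpen_domInt ℓ ρ T).mem_nhds ⟨hyρ, h⟩] with z hz hz'
    exact hmin z (domInt_subset_dom _ _ _ hz') hz.2.le

/-- The auxiliary function of the moving sphere argument. -/
def barrier (N : ℕ) (P S Q l ω : ℝ) : ℝ :=
  P * (ω ^ N / l - ω ^ (N + 1)) + S * ω ^ N - Q * (1 / l - ω)

lemma hasLap_barrier (P S Q l : ℝ) {x y : Euc (N + 2)} (hxy : y ≠ x) :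
    HasLap (fun z => barrier N P S Q l ‖z - x‖⁻¹) y
      (-(P * (N + 1) * ‖y - x‖⁻¹ ^ (N + 3) + Q * (N - 1) * ‖y - x‖⁻¹ ^ 3)) := by
  have h0 := hasLap_normInv_pow N x y hxy
  have h1 := hasLap_normInv_pow (N + 1) x y hxy
  have h2 := hasLap_normInv_pow 1 x y hxy
  simp only [pow_one] at h2
  have := ((((h0.const_mul (1/l)).sub h1).const_mul P).add (h0.const_mul S)).sub
    (((HasLap.const (1 / l)).sub h2).const_mul Q)
  have e : (fun z : Euc (N + 2) => barrier N P S Q l ‖z - x‖⁻¹) = fun z =>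
    P * (1 / l * ‖z - x‖⁻¹ ^ N - ‖z - x‖⁻¹ ^ (N + 1)) + S * ‖z - x‖⁻¹ ^ N
      - Q * (1 / l - ‖z - x‖⁻¹) := by
    funext z; simp only [barrier]; ring
  rw [e]
  convert this using 1
  push_cast
  ring

lemma norm_inv_sub {x y : Euc n} {l : ℝ} (hxy : y ≠ x) :
    ‖inv x l y - x‖ = l ^ 2 * ‖y - x‖⁻¹ := by
  have hr : 0 < ‖y - x‖ := norm_pos_iff.2 (sub_ne_zero.2 hxy)
  rw [inv, add_sub_cancel_left, norm_smul, Real.norm_eq_abs, abs_of_nonneg (by positivity)]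
  field_simp

lemma norm_inv_sub_le {x y : Euc n} {l : ℝ} (hl : 0 < l) (h : l ≤ ‖y - x‖) :
    ‖inv x l y - x‖ ≤ l := by
  have hr : 0 < ‖y - x‖ := hl.trans_le h
  rw [norm_inv_sub (fun h' => by simp [h'] at hr), ← div_eq_mul_inv, div_le_iff₀ hr]
  nlinarith

lemma continuousOn_kelvin {v : Euc n → ℝ} {x : Euc n} {K : Set (Euc n)} {l₁ : ℝ}
    (hv : ContinuousOn v K) (hK : closedBall x l₁ ⊆ K) :
    ContinuousOn (fun p : ℝ × Euc n => kelvin x p.1 v p.2)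
      {p | 0 < p.1 ∧ p.1 ≤ l₁ ∧ p.1 ≤ ‖p.2 - x‖} := by
  have h0 : ∀ p ∈ {p : ℝ × Euc n | 0 < p.1 ∧ p.1 ≤ l₁ ∧ p.1 ≤ ‖p.2 - x‖}, ‖p.2 - x‖ ≠ 0 :=
    fun p hp => (hp.1.trans_le hp.2.2).ne'
  have h1 : ContinuousOn (fun p : ℝ × Euc n => p.1 * ‖p.2 - x‖⁻¹)
      {p | 0 < p.1 ∧ p.1 ≤ l₁ ∧ p.1 ≤ ‖p.2 - x‖} :=
    continuousOn_fst.mul (ContinuousOn.inv₀ (by fun_prop) h0)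
  refine (h1.pow _).mul (hv.comp (f := fun p : ℝ × Euc n => inv x p.1 p.2) ?_ ?_)
  · exact continuousOn_const.add ((h1.pow 2).smul (by fun_prop))
  · intro p hp
    refine hK ?_
    rw [mem_closedBall, dist_eq_norm]
    exact (norm_inv_sub_le hp.1 hp.2.2).trans hp.2.1

lemma inv_self {x y : Euc n} {l : ℝ} (hl : 0 < l) (h : ‖y - x‖ = l) : inv x l y = y := by
  rw [inv, h, mul_inv_cancel₀ hl.ne']; simp

lemma kelvin_self {v : Euc n → ℝ} {x y : Euc n} {l : ℝ} (hl : 0 < l) (h : ‖y - x‖ = l) :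
    kelvin x l v y = v y := by
  rw [kelvin, inv_self hl h, h, mul_inv_cancel₀ hl.ne']; simp

/-- The moving sphere argument, with a barrier that keeps the first touching point away from
the sphere itself. -/
lemma sliding {ℓ : Fin (N + 2)} {ρ T l₀ l₁ P S Q : ℝ} {x : Euc (N + 2)} {v f : Euc (N + 2) → ℝ}
    (hl₀ : 0 < l₀) (hS : 0 < S)
    (hball : closedBall x l₁ ⊆ domInt ℓ ρ T) (hcont : ContinuousOn v (dom ℓ ρ T))
    (hsmooth : ∀ y ∈ domInt ℓ ρ T, ContDiffAt ℝ 2 v y)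
    (hf : ∀ y ∈ domInt ℓ ρ T, HasLap v y (f y))
    (hstart : ∀ y ∈ dom ℓ ρ T, l₀ ≤ ‖y - x‖ →
      0 < v y - kelvin x l₀ v y + barrier N P S Q l₀ ‖y - x‖⁻¹)
    (houter : ∀ l, l₀ ≤ l → l ≤ l₁ → ∀ y ∈ dom ℓ ρ T, l ≤ ‖y - x‖ → ‖y‖ = ρ →
      0 < v y - kelvin x l v y + barrier N P S Q l ‖y - x‖⁻¹)
    (hint : ∀ l, l₀ ≤ l → l ≤ l₁ → ∀ y ∈ domInt ℓ ρ T, l < ‖y - x‖ →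
      v y = kelvin x l v y - barrier N P S Q l ‖y - x‖⁻¹ →
      f y - (l * ‖y - x‖⁻¹) ^ (N + 4) * f (inv x l y)
        < P * (N + 1) * ‖y - x‖⁻¹ ^ (N + 3) + Q * (N - 1) * ‖y - x‖⁻¹ ^ 3)
    (hflat : ∀ l, l₀ ≤ l → l ≤ l₁ → ∀ y ∈ dom ℓ ρ T, ‖y‖ < ρ → y ℓ = -T → l < ‖y - x‖ →
      v y = kelvin x l v y - barrier N P S Q l ‖y - x‖⁻¹ →
      ∃ d < 0, HasDerivWithinAt (fun s : ℝ => v (y + s • nu ℓ) - kelvin x l v (y + s • nu ℓ)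
        + barrier N P S Q l ‖y + s • nu ℓ - x‖⁻¹) d (Ici 0) 0) :
    ∀ l, l₀ ≤ l → l ≤ l₁ → ∀ y ∈ dom ℓ ρ T, l ≤ ‖y - x‖ →
      0 < v y - kelvin x l v y + barrier N P S Q l ‖y - x‖⁻¹ := by
  set Ψ : ℝ × Euc (N + 2) → ℝ := fun p =>
    v p.2 - kelvin x p.1 v p.2 + barrier N P S Q p.1 ‖p.2 - x‖⁻¹ with hΨ
  set Z : Set (ℝ × Euc (N + 2)) := (Icc l₀ l₁ ×ˢ dom ℓ ρ T) ∩ {p | p.1 ≤ ‖p.2 - x‖} with hZ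
  have hZc : IsCompact Z := (isCompact_Icc.prod (isCompact_dom ℓ ρ T)).inter_right
    (isClosed_le continuous_fst (by fun_prop))
  have hΨc : ContinuousOn Ψ Z := by
    have h1 : ContinuousOn (fun p : ℝ × Euc (N + 2) => v p.2) Z :=
      hcont.comp continuousOn_snd (fun p hp => hp.1.2)
    have h2 : ContinuousOn (fun p : ℝ × Euc (N + 2) => kelvin x p.1 v p.2) Z :=
      (continuousOn_kelvin hcont (hball.trans (domInt_subset_dom _ _ _))).mono
        (fun p hp => ⟨hl₀.trans_le hp.1.1.1, hp.1.1.2, hp.2⟩)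
    have h3 : ContinuousOn (fun p : ℝ × Euc (N + 2) => ‖p.2 - x‖⁻¹) Z :=
      ContinuousOn.inv₀ (by fun_prop) (fun p hp => ((hl₀.trans_le hp.1.1.1).trans_le hp.2).ne')
    have h4 : ∀ p ∈ Z, p.1 ≠ 0 := fun p hp => (hl₀.trans_le hp.1.1.1).ne'
    refine (h1.sub h2).add ?_
    simp only [barrier]
    have h5 : ContinuousOn (fun p : ℝ × Euc (N + 2) => p.1) Z := continuousOn_fst
    exact ((continuousOn_const.mul (((h3.pow _).div h5 h4).sub (h3.pow _))).add
      (continuousOn_const.mul (h3.pow _))).sub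
      (continuousOn_const.mul ((continuousOn_const.div h5 h4).sub h3))
  by_contra! hbad
  obtain ⟨la, hla0, hla1, ya, hya, hya2, hya3⟩ := hbad
  have hBc : IsCompact (Z ∩ Ψ ⁻¹' Iic 0) :=
    hZc.of_isClosed_subset (hΨc.preimage_isClosed_of_isClosed hZc.isClosed isClosed_Iic)
      inter_subset_left
  obtain ⟨⟨l, y⟩, ⟨⟨⟨⟨hl0, hl1⟩, hy⟩, hyl⟩, hle⟩, hmin⟩ :=
    hBc.exists_isMinOn ⟨(la, ya), ⟨⟨⟨hla0, hla1⟩, hya⟩, hya2⟩, hya3⟩ continuousOn_fst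
  simp only at hl0 hl1 hy
  have hyl : l ≤ ‖y - x‖ := hyl
  have hle : Ψ (l, y) ≤ 0 := hle
  have hl : 0 < l := hl₀.trans_le hl0
  have hne : l₀ ≠ l := by
    rintro rfl
    exact absurd (hstart y hy hyl) (not_lt.2 hle)
  have hlt : l₀ < l := lt_of_le_of_ne hl0 hne
  have hnn : ∀ z ∈ dom ℓ ρ T, l ≤ ‖z - x‖ → 0 ≤ Ψ (l, z) := by
    intro z hz hzl
    have hcz : ContinuousWithinAt (fun l' : ℝ => Ψ (l', z)) (Ico l₀ l) l := by
      have := (hΨc (l, z) ⟨⟨⟨hl0, hl1⟩, hz⟩, hzl⟩)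
      refine ContinuousWithinAt.comp (f := fun l' : ℝ => (l', z)) (t := Z) this (by fun_prop) ?_
      intro l' hl'
      exact ⟨⟨⟨hl'.1, hl'.2.le.trans hl1⟩, hz⟩, hl'.2.le.trans hzl⟩
    have hcl : l ∈ closure (Ico l₀ l) := by
      rw [closure_Ico hne]; exact ⟨hl0, le_rfl⟩
    have : (𝓝[Ico l₀ l] l).NeBot := mem_closure_iff_nhdsWithin_neBot.1 hcl
    refine ge_of_tendsto hcz ?_
    filter_upwards [self_mem_nhdsWithin] with l' hl'
    by_contra! hneg
    have hmem : (l', z) ∈ Z ∩ Ψ ⁻¹' Iic 0 :=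
      ⟨⟨⟨⟨hl'.1, hl'.2.le.trans hl1⟩, hz⟩, hl'.2.le.trans hzl⟩, hneg.le⟩
    have : l ≤ l' := hmin hmem
    exact absurd hl'.2 (not_lt.2 this)
  have hzero : Ψ (l, y) = 0 := le_antisymm hle (hnn y hy hyl)
  have hyl' : l < ‖y - x‖ := by
    refine lt_of_le_of_ne hyl fun h => ?_
    have h1 : Ψ (l, y) = S * l⁻¹ ^ N := by
      simp only [hΨ, kelvin_self hl h.symm, barrier, ← h]
      have : l⁻¹ ^ (N + 1) = l⁻¹ ^ N / l := by rw [pow_succ, div_eq_mul_inv]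
      rw [this, one_div]; ring
    have : 0 < S * l⁻¹ ^ N := by positivity
    linarith
  have hxy : y ≠ x := fun h => by
    have := hl.trans hyl'
    simp [h] at this
  have hyρ : ‖y‖ < ρ := lt_of_le_of_ne hy.1 fun h =>
    absurd (houter l hl0 hl1 y hy hyl h) (not_lt.2 hle)
  have heq : v y = kelvin x l v y - barrier N P S Q l ‖y - x‖⁻¹ := by
    simp only [hΨ] at hzero
    linarith
  rcases touch (W := fun z => Ψ (l, z)) hy hyρ hyl' (fun z hz hz' => by
    rw [hzero]; exact hnn z hz hz') with ⟨hyi, hL⟩ | ⟨hyT, hd⟩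
  · have hmem : inv x l y ∈ domInt ℓ ρ T := hball (by
      rw [mem_closedBall, dist_eq_norm]
      exact (norm_inv_sub_le hl hyl).trans hl1)
    have := hL _ (((hf y hyi).sub (hasLap_kelvin hl hxy (hsmooth _ hmem) (hf _ hmem))).add
      (hasLap_barrier P S Q l hxy))
    have := hint l hl0 hl1 y hyi hyl' heq
    linarith
  · obtain ⟨d, hd0, hd1⟩ := hflat l hl0 hl1 y hy hyρ hyT hyl' heq
    exact absurd (hd d hd1) (not_le.2 hd0)

end

section

variable {n N : ℕ}

/-- A rescaled solution `v` with rescaled curvature `k`, at scale `ε`, whose flat boundary is the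
hyperplane `{y : y ℓ = -T}`. -/
structure Resc (ℓ : Fin (N + 2)) (C : ℝ) (v k : Euc (N + 2) → ℝ) (q : Euc (N + 2))
    (g ε T R A : ℝ) : Prop where
  ε_pos : 0 < ε
  cont : ContinuousOn v (dom ℓ (8 * ε)⁻¹ T)
  pos : ∀ y ∈ dom ℓ (8 * ε)⁻¹ T, 0 < v y
  smooth : ∀ y ∈ domInt ℓ (8 * ε)⁻¹ T, ContDiffAt ℝ 2 v y
  eqn : ∀ y ∈ domInt ℓ (8 * ε)⁻¹ T, HasLap v y (-(k y * v y ^ (1 + 4 / (N : ℝ))))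
  flat : ∀ y, ‖y‖ < (8 * ε)⁻¹ → y ℓ = -T → ∃ d ≤ C * v y ^ (1 + 2 / (N : ℝ)),
    HasDerivWithinAt (fun s : ℝ => v (y + s • nu ℓ)) d (Ici 0) 0
  low : ∀ y ∈ dom ℓ (8 * ε)⁻¹ T, A * ε ^ N ≤ v y
  v_zero : v 0 = 1
  v_le : ∀ y ∈ domInt ℓ (8 * ε)⁻¹ T, ‖y‖ < R → v y ≤ 1
  k_pos : ∀ y ∈ dom ℓ (8 * ε)⁻¹ T, 0 < k y
  k_le : ∀ y ∈ dom ℓ (8 * ε)⁻¹ T, k y ≤ C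
  k_zero : k 0 = 1
  g_nonneg : 0 ≤ g
  g_pow : g ^ (N - 1) = ‖q‖
  q_le : ‖q‖ ≤ C
  k_diff : ∀ r, ∀ y ∈ dom ℓ (8 * ε)⁻¹ T, ∀ z ∈ dom ℓ (8 * ε)⁻¹ T, ‖y‖ ≤ r → ‖z‖ ≤ r →
    |k y - k z - ε * inner ℝ q (y - z)| ≤
      C * ε * ‖y - z‖ * (ε * r * (g + ε * r) ^ (N - 2))

/-- A blow-up sequence whose flat boundaries recede to infinity along `F`. -/
structure BlowupSeq (ℓ : Fin (N + 2)) (C : ℝ) (F : Ultrafilter ℕ) (v k : ℕ → Euc (N + 2) → ℝ)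
    (q : ℕ → Euc (N + 2)) (g ε T R A : ℕ → ℝ) : Prop where
  two_le : 2 ≤ N
  one_le : 1 ≤ C
  resc : ∀ i, Resc ℓ C (v i) (k i) (q i) (g i) (ε i) (T i) (R i) (A i)
  ε_lim : Tendsto ε F (𝓝 0)
  T_lim : Tendsto T F atTop
  R_lim : Tendsto R F atTop
  A_lim : Tendsto A F atTop

lemma HasD2.hasDerivAt {f : ℝ → ℝ} {a b : ℝ} (h : HasD2 f a b) : HasDerivAt f a 0 := by
  obtain ⟨f', h1, rfl, _⟩ := h
  exact h1.self_of_nhds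

lemma hasDerivAt_normInv_pow (m : ℕ) {x y : Euc n} (hxy : y ≠ x) (ℓ : Fin n) :
    HasDerivAt (fun s : ℝ => ‖y + s • nu ℓ - x‖⁻¹ ^ m)
      (m * ‖y - x‖⁻¹ ^ (m + 2) * (x ℓ - y ℓ)) 0 := by
  have := (hasD2_normInv_pow m (sub_ne_zero.2 hxy) (nu ℓ)).hasDerivAt
  simp only [← add_sub_right_comm] at this
  refine this.congr_deriv ?_
  simp [nu, EuclideanSpace.inner_single_right]
  ring

lemma hasDerivAt_kelvin {v : Euc (N + 2) → ℝ} {x y : Euc (N + 2)} {l : ℝ} {ℓ : Fin (N + 2)}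
    {L : ℝ} (hxy : y ≠ x)
    (hv : DifferentiableAt ℝ v (inv x l y)) (hL : ‖fderiv ℝ v (inv x l y)‖ ≤ L) :
    ∃ d, HasDerivAt (fun s : ℝ => kelvin x l v (y + s • nu ℓ)) d 0 ∧
      |d - N * l ^ N * ‖y - x‖⁻¹ ^ (N + 2) * (x ℓ - y ℓ) * v (inv x l y)| ≤
        (|l| * ‖y - x‖⁻¹) ^ N * (3 * l ^ 2 * ‖y - x‖⁻¹ ^ 2 * L) := by
  have hr : 0 < ‖y - x‖ := norm_pos_iff.2 (sub_ne_zero.2 hxy)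
  have hα := (hasDerivAt_normInv_pow 2 hxy ℓ).const_mul (l ^ 2)
  have hγ : HasDerivAt (fun s : ℝ => inv x l (y + s • nu ℓ))
      ((l ^ 2 * ‖y - x‖⁻¹ ^ 2) • (nu ℓ : Euc (N + 2)) +
        (l ^ 2 * (2 * ‖y - x‖⁻¹ ^ 4 * (x ℓ - y ℓ))) • (y - x)) 0 := by
    have h1 : HasDerivAt (fun s : ℝ => y + s • nu ℓ - x) (nu ℓ : Euc (N + 2)) 0 := by
      simpa using (((hasDerivAt_id (0:ℝ)).smul_const (nu ℓ : Euc (N+2))).const_add y).sub_const x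
    have := (hα.smul h1).const_add x
    simp only [zero_smul, add_zero] at this
    refine (this.congr_of_eventuallyEq (.of_forall fun s => ?_))
    simp [inv, mul_pow]
  have hv' : HasFDerivAt v (fderiv ℝ v (inv x l y)) (inv x l (y + (0:ℝ) • nu ℓ)) := by
    simpa using hv.hasFDerivAt
  have hf := ((hasDerivAt_normInv_pow N hxy ℓ).const_mul (l ^ N)).mul
    (hv'.comp_hasDerivAt (0:ℝ) hγ)
  refine ⟨_, hf.congr_of_eventuallyEq (.of_forall fun s => ?_), ?_⟩
  · simp [kelvin, mul_pow]
  · have hc : |x ℓ - y ℓ| ≤ ‖y - x‖ := by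
      have := PiLp.norm_apply_le (y - x) ℓ
      rwa [Real.norm_eq_abs, PiLp.sub_apply, abs_sub_comm] at this
    set w := (l ^ 2 * ‖y - x‖⁻¹ ^ 2) • (nu ℓ : Euc (N + 2)) +
        (l ^ 2 * (2 * ‖y - x‖⁻¹ ^ 4 * (x ℓ - y ℓ))) • (y - x) with hw
    have hwn : ‖w‖ ≤ 3 * l ^ 2 * ‖y - x‖⁻¹ ^ 2 := by
      refine (norm_add_le _ _).trans ?_
      rw [norm_smul, norm_smul, Real.norm_eq_abs, Real.norm_eq_abs, abs_mul, abs_mul, abs_mul,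
        abs_mul, abs_of_nonneg (show 0 ≤ l ^ 2 by positivity),
        abs_of_nonneg (show 0 ≤ ‖y - x‖⁻¹ ^ 2 by positivity),
        abs_of_nonneg (show 0 ≤ ‖y - x‖⁻¹ ^ 4 by positivity)]
      have h2 : |x ℓ - y ℓ| * ‖y - x‖ ≤ ‖y - x‖ * ‖y - x‖ := by gcongr
      have h3 : l ^ 2 * (|2| * ‖y - x‖⁻¹ ^ 4 * |x ℓ - y ℓ|) * ‖y - x‖ ≤
          l ^ 2 * (2 * ‖y - x‖⁻¹ ^ 2) := by
        rw [abs_two]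
        calc _ = l ^ 2 * (2 * ‖y - x‖⁻¹ ^ 4 * (|x ℓ - y ℓ| * ‖y - x‖)) := by ring
          _ ≤ l ^ 2 * (2 * ‖y - x‖⁻¹ ^ 4 * (‖y - x‖ * ‖y - x‖)) := by gcongr
          _ = _ := by field_simp
      have h4 : ‖(nu ℓ : Euc (N + 2))‖ = 1 := by simp [nu]
      rw [h4]
      linarith
    have hA : |fderiv ℝ v (inv x l y) w| ≤ 3 * l ^ 2 * ‖y - x‖⁻¹ ^ 2 * L := by
      have := (fderiv ℝ v (inv x l y)).le_of_opNorm_le hL w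
      rw [Real.norm_eq_abs] at this
      refine this.trans ?_
      rw [mul_comm]
      have : 0 ≤ L := (norm_nonneg _).trans hL
      gcongr
    simp only [zero_smul, add_zero, Function.comp]
    rw [show ∀ a b c d e : ℝ, l ^ N * (a * b * c) * d + e - a * l ^ N * b * c * d = e by
      intros; ring]
    rw [abs_mul, abs_mul, abs_pow, abs_pow, abs_inv, abs_norm, ← mul_pow]
    gcongr

namespace BlowupSeq

variable {ℓ : Fin (N + 2)} {C : ℝ} {F : Ultrafilter ℕ} {v k : ℕ → Euc (N + 2) → ℝ}
  {q : ℕ → Euc (N + 2)} {g ε T R A : ℕ → ℝ}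

lemma N_pos (h : BlowupSeq ℓ C F v k q g ε T R A) : (0:ℝ) < N := by
  have := h.two_le
  exact_mod_cast (by omega : 0 < N)

lemma eventually_ball (h : BlowupSeq ℓ C F v k q g ε T R A) (X : ℝ) :
    ∀ᶠ i in F, X < (8 * ε i)⁻¹ ∧ X < T i ∧ X < R i ∧
      closedBall (0 : Euc (N + 2)) X ⊆ domInt ℓ (8 * ε i)⁻¹ (T i) := by
  have h1 : ∀ᶠ i in F, ε i < (8 * (|X| + 1))⁻¹ := h.ε_lim.eventually_lt_const (by positivity)
  filter_upwards [h1, h.T_lim.eventually_gt_atTop X, h.R_lim.eventually_gt_atTop X]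
    with i h1 h2 h3
  have hε := (h.resc i).ε_pos
  have h4 : X < (8 * ε i)⁻¹ := by
    rw [lt_inv_comm₀ hε (by positivity)] at h1
    rw [mul_inv]
    have := le_abs_self X
    linarith
  refine ⟨h4, h2, h3, fun y hy => ?_⟩
  rw [mem_closedBall_zero_iff] at hy
  refine ⟨hy.trans_lt h4, ?_⟩
  have := (abs_le.1 ((PiLp.norm_apply_le y ℓ).trans hy)).1
  linarith

/-- The uniform Lipschitz constant of a blow-up sequence. -/
def lip (N : ℕ) (C : ℝ) : ℝ := (N + 2 : ℕ) + C / 2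

lemma lip_pos (h : BlowupSeq ℓ C F v k q g ε T R A) : 0 < lip N C := by
  have := h.one_le
  unfold lip
  positivity

lemma rpow_le_one' (h : BlowupSeq ℓ C F v k q g ε T R A) {t : ℝ} (h0 : 0 ≤ t) (h1 : t ≤ 1) :
    t ^ (1 + 4 / (N : ℝ)) ≤ 1 := Real.rpow_le_one h0 h1 (by have := h.N_pos; positivity)

lemma eventually_lip (h : BlowupSeq ℓ C F v k q g ε T R A) (X : ℝ) :
    ∀ᶠ i in F, (∀ y ∈ ball (0 : Euc (N + 2)) X, ‖fderiv ℝ (v i) y‖ ≤ lip N C) ∧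
      ∀ y ∈ ball (0 : Euc (N + 2)) X, ∀ z ∈ ball (0 : Euc (N + 2)) X,
        |v i y - v i z| ≤ lip N C * ‖y - z‖ := by
  filter_upwards [h.eventually_ball (X + 1)] with i ⟨_, _, h3, h4⟩
  have hr := h.resc i
  have hsub : ∀ y ∈ ball (0 : Euc (N + 2)) X, ∀ z ∈ closedBall y 1,
      z ∈ domInt ℓ (8 * ε i)⁻¹ (T i) ∧ ‖z‖ < R i := by
    intro y hy z hz
    rw [mem_ball_zero_iff] at hy
    rw [mem_closedBall, dist_eq_norm] at hz
    have : ‖z‖ ≤ X + 1 := by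
      have := norm_add_le (z - y) y
      rw [sub_add_cancel] at this
      linarith
    exact ⟨h4 (by simpa using this), this.trans_lt h3⟩
  have hder : ∀ y ∈ ball (0 : Euc (N + 2)) X, ‖fderiv ℝ (v i) y‖ ≤ lip N C := by
    intro y hy
    have := norm_fderiv_le (u := v i) (x₀ := y) (d := 1) (N₀ := 1) (F := C) one_pos
      (fun z hz => hr.smooth z (hsub y hy z hz).1) (fun z hz => ?_) (fun z hz => ?_)
    · simpa [lip] using this
    · have h1 := hsub y hy z hz
      rw [abs_of_pos (hr.pos z (domInt_subset_dom _ _ _ h1.1))]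
      exact hr.v_le z h1.1 h1.2
    · have h1 := hsub y hy z hz
      have h2 := domInt_subset_dom _ _ _ h1.1
      refine ⟨_, hr.eqn z h1.1, ?_⟩
      have h5 := h.rpow_le_one' (hr.pos z h2).le (hr.v_le z h1.1 h1.2)
      have h6 := Real.rpow_nonneg (hr.pos z h2).le (1 + 4 / (N : ℝ))
      have h7 := hr.k_le z h2
      have h8 := hr.k_pos z h2
      rw [abs_neg, abs_of_nonneg (by positivity)]
      nlinarith
  refine ⟨hder, fun y hy z hz => ?_⟩
  have := (convex_ball (0 : Euc (N + 2)) X).norm_image_sub_le_of_norm_fderiv_le (𝕜 := ℝ)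
    (f := v i) (fun w hw => (hr.smooth w (hsub w hw w (by simp)).1).differentiableAt (by simp))
    hder hz hy
  simpa [Real.norm_eq_abs] using this

/-- Uniform lower bound by the fundamental solution. -/
lemma eventually_lower (h : BlowupSeq ℓ C F v k q g ε T R A) :
    ∃ c > 0, ∀ᶠ i in F, ∀ y ∈ dom ℓ (8 * ε i)⁻¹ (T i), c * (1 + ‖y‖)⁻¹ ^ N ≤ v i y := by
  set L := lip N C
  have hL : 0 < L := h.lip_pos
  have hL1 : 1 ≤ L := by
    have := h.one_le
    simp only [L, lip]; push_cast
    have : (0:ℝ) ≤ N := by positivity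
    linarith
  set δ := (2 * L)⁻¹ with hδ
  have hδ0 : 0 < δ := by positivity
  have hδ1 : δ < 1 := by rw [hδ]; exact inv_lt_one_of_one_lt₀ (by linarith)
  set c := δ ^ N / 2 with hc
  have hc0 : 0 < c := by positivity
  have hNp := h.N_pos
  refine ⟨c, hc0, ?_⟩
  set p := 1 + 2 / (N : ℝ) with hp
  filter_upwards [h.eventually_ball 1, h.eventually_lip 1,
    h.A_lim.eventually_ge_atTop (c * 8 ^ N),
    h.T_lim.eventually_gt_atTop (C * c ^ p / (c * N)), h.T_lim.eventually_gt_atTop 0]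
    with i ⟨h1, h2, h3, h4⟩ ⟨_, h5⟩ h6 h7 h8
  have hr := h.resc i
  have hε := hr.ε_pos
  have hsmall : ∀ y : Euc (N + 2), ‖y‖ ≤ δ → 1 / 2 ≤ v i y := by
    intro y hy
    have := h5 y (by simpa using hy.trans_lt hδ1) 0 (by simp)
    rw [hr.v_zero, sub_zero] at this
    have h9 : L * ‖y‖ ≤ 1 / 2 := by
      calc L * ‖y‖ ≤ L * δ := by gcongr
        _ = 1 / 2 := by rw [hδ]; field_simp
    have := (abs_le.1 this).1
    linarith
  have hfar : ∀ y ∈ dom ℓ (8 * ε i)⁻¹ (T i), δ ≤ ‖y - 0‖ →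
      0 ≤ v i y - c * ‖y - 0‖⁻¹ ^ N := by
    set W : Euc (N + 2) → ℝ := fun y => v i y - c * ‖y - 0‖⁻¹ ^ N with hW
    set D := dom ℓ (8 * ε i)⁻¹ (T i) ∩ {y | δ ≤ ‖y - 0‖} with hD
    have hDc : IsCompact D := (isCompact_dom _ _ _).inter_right
      (isClosed_le continuous_const (by fun_prop))
    have hWc : ContinuousOn W D := by
      refine (hr.cont.mono inter_subset_left).sub (continuousOn_const.mul
        (ContinuousOn.pow (ContinuousOn.inv₀ (by fun_prop) fun y hy => ?_) _))
      exact (hδ0.trans_le hy.2).ne'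
    intro y hy hyδ
    obtain ⟨z, ⟨hz, hzδ⟩, hmin⟩ := hDc.exists_isMinOn ⟨y, hy, hyδ⟩ hWc
    refine le_trans ?_ (hmin ⟨hy, hyδ⟩)
    have hzδ : δ ≤ ‖z - 0‖ := hzδ
    by_contra! hneg
    have hz0 : 0 < ‖z - 0‖ := hδ0.trans_le hzδ
    have hzne : z ≠ 0 := by rintro rfl; simp at hz0
    have hzδ' : δ < ‖z - 0‖ := by
      refine lt_of_le_of_ne hzδ fun he => ?_
      have := hsmall z (by rw [sub_zero] at he; exact he.ge)
      have h9 : c * ‖z - 0‖⁻¹ ^ N = 1 / 2 := by rw [← he, hc, div_mul_eq_mul_div, ← mul_pow, mul_inv_cancel₀ hδ0.ne', one_pow]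
      simp only [hW] at hneg
      linarith
    have hzρ : ‖z‖ < (8 * ε i)⁻¹ := by
      refine lt_of_le_of_ne hz.1 fun he => ?_
      have h9 := hr.low z hz
      have h10 : c * ‖z - 0‖⁻¹ ^ N ≤ A i * ε i ^ N := by
        rw [sub_zero, he, inv_inv, mul_pow, ← mul_assoc]
        gcongr
      simp only [hW] at hneg
      linarith
    rcases touch (W := W) hz hzρ hzδ' (fun w hw hw' => hmin ⟨hw, hw'⟩) with ⟨hzi, hlap⟩ | ⟨hzT, hd⟩
    · have := hlap _ ((hr.eqn z hzi).sub ((hasLap_normInv_pow N 0 z hzne).const_mul c))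
      have h9 : 0 < k i z * v i z ^ (1 + 4 / (N : ℝ)) :=
        mul_pos (hr.k_pos z hz) (Real.rpow_pos_of_pos (hr.pos z hz) _)
      push_cast at this
      simp only [sub_self, mul_zero, zero_mul, sub_zero] at this
      linarith
    · obtain ⟨d, hd1, hd2⟩ := hr.flat z hzρ hzT
      have := hd _ (hd2.sub ((hasDerivAt_normInv_pow N hzne ℓ).const_mul c).hasDerivWithinAt)
      rw [hzT] at this
      simp only [hW] at hneg
      set ω := ‖z - 0‖⁻¹ with hω
      have hω0 : 0 < ω := by positivity
      have h9 : v i z ^ p ≤ c ^ p * ω ^ (N + 2) := by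
        calc v i z ^ p ≤ (c * ω ^ N) ^ p :=
              Real.rpow_le_rpow (hr.pos z hz).le (by linarith) (by positivity)
          _ = c ^ p * ω ^ (N + 2) := by
              rw [Real.mul_rpow hc0.le (by positivity), ← Real.rpow_natCast ω N,
                ← Real.rpow_mul hω0.le, ← Real.rpow_natCast ω (N + 2)]
              congr 2
              rw [hp]; push_cast; field_simp
      have h10 : C * v i z ^ p ≤ C * (c ^ p * ω ^ (N + 2)) :=
        mul_le_mul_of_nonneg_left h9 (by linarith [h.one_le])
      have h11 : C * c ^ p < T i * (c * N) := by
        rwa [div_lt_iff₀ (by positivity)] at h7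
      have h12 : C * c ^ p * ω ^ (N + 2) < T i * (c * N) * ω ^ (N + 2) := by gcongr
      simp at this
      nlinarith
  intro y hy
  have hy1 : 0 < 1 + ‖y‖ := by positivity
  rcases le_or_gt δ ‖y - 0‖ with hyδ | hyδ
  · have := hfar y hy hyδ
    rw [sub_zero] at this hyδ
    have h9 : (1 + ‖y‖)⁻¹ ^ N ≤ ‖y‖⁻¹ ^ N := by
      have := hδ0.trans_le hyδ
      gcongr; linarith
    nlinarith
  · have := hsmall y (by rw [sub_zero] at hyδ; exact hyδ.le)
    have h9 : (1 + ‖y‖)⁻¹ ^ N ≤ 1 := pow_le_one₀ (by positivity)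
      (inv_le_one_of_one_le₀ (by linarith [norm_nonneg y]))
    have h10 : c ≤ 1 / 2 := by
      rw [hc]; have := pow_le_one₀ (n := N) hδ0.le hδ1.le; linarith
    nlinarith

end BlowupSeq

end

section

variable {n N : ℕ}

/-- `V` is a limit of the functions `v i` along `F`. -/
structure BlowupLim (F : Ultrafilter ℕ) (v : ℕ → Euc (N + 2) → ℝ) (L : ℝ)
    (V : Euc (N + 2) → ℝ) : Prop where
  zero : V 0 = 1
  pos : ∀ y, 0 < V y
  le_one : ∀ y, V y ≤ 1
  lip : ∀ y z, |V y - V z| ≤ L * ‖y - z‖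
  unif : ∀ X, ∀ δ > 0, ∀ᶠ i in F, ∀ y ∈ closedBall (0 : Euc (N + 2)) X, |v i y - V y| ≤ δ

lemma BlowupLim.continuous {F : Ultrafilter ℕ} {v : ℕ → Euc (N + 2) → ℝ} {L : ℝ}
    {V : Euc (N + 2) → ℝ} (hV : BlowupLim F v L V) : Continuous V := by
  refine (LipschitzWith.of_dist_le_mul (K := L.toNNReal) fun y z => ?_).continuous
  rw [Real.dist_eq, dist_eq_norm]
  exact (hV.lip y z).trans (by gcongr; exact Real.le_coe_toNNReal L)

lemma BlowupLim.tendsto {F : Ultrafilter ℕ} {v : ℕ → Euc (N + 2) → ℝ} {L : ℝ}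
    {V : Euc (N + 2) → ℝ} (hV : BlowupLim F v L V) (y : Euc (N + 2)) :
    Tendsto (fun i => v i y) F (𝓝 (V y)) := by
  rw [Metric.tendsto_nhds]
  intro δ hδ
  filter_upwards [hV.unif ‖y‖ (δ / 2) (by positivity)] with i hi
  have := hi y (by simp)
  rw [Real.dist_eq]
  linarith

namespace BlowupSeq

variable {ℓ : Fin (N + 2)} {C : ℝ} {F : Ultrafilter ℕ} {v k : ℕ → Euc (N + 2) → ℝ}
  {q : ℕ → Euc (N + 2)} {g ε T R A : ℕ → ℝ}

lemma eventually_mem (h : BlowupSeq ℓ C F v k q g ε T R A) (X : ℝ) :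
    ∀ᶠ i in F, ∀ y ∈ closedBall (0 : Euc (N + 2)) X,
      y ∈ domInt ℓ (8 * ε i)⁻¹ (T i) ∧ y ∈ dom ℓ (8 * ε i)⁻¹ (T i) ∧ 0 < v i y ∧ v i y ≤ 1 := by
  filter_upwards [h.eventually_ball X] with i ⟨_, _, h3, h4⟩ y hy
  have h5 := h4 hy
  have h6 := domInt_subset_dom _ _ _ h5
  exact ⟨h5, h6, (h.resc i).pos y h6,
    (h.resc i).v_le y h5 ((mem_closedBall_zero_iff.1 hy).trans_lt h3)⟩

lemma exists_lim (h : BlowupSeq ℓ C F v k q g ε T R A) :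
    ∃ V, BlowupLim F v (lip N C) V ∧ ∃ c > 0, ∀ y, c * (1 + ‖y‖)⁻¹ ^ N ≤ V y := by
  have hex : ∀ y, ∃ a, Tendsto (fun i => v i y) F (𝓝 a) := by
    intro y
    obtain ⟨a, _, ha⟩ := (isCompact_Icc (a := (0:ℝ)) (b := 1)).ultrafilter_le_nhds
      (F.map fun i => v i y) (by
        rw [le_principal_iff]
        change ∀ᶠ i in F, v i y ∈ Icc (0:ℝ) 1
        filter_upwards [h.eventually_mem ‖y‖] with i hi
        have := hi y (by simp)
        exact ⟨this.2.2.1.le, this.2.2.2⟩)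
    exact ⟨a, ha⟩
  choose V hV using hex
  obtain ⟨c, hc, hlow⟩ := h.eventually_lower
  have hlowV : ∀ y, c * (1 + ‖y‖)⁻¹ ^ N ≤ V y := by
    intro y
    refine ge_of_tendsto (hV y) ?_
    filter_upwards [hlow, h.eventually_mem ‖y‖] with i h1 h2
    exact h1 y (h2 y (by simp)).2.1
  have hlip : ∀ y z, |V y - V z| ≤ lip N C * ‖y - z‖ := by
    intro y z
    refine le_of_tendsto ((hV y).sub (hV z)).abs ?_
    filter_upwards [h.eventually_lip (‖y‖ + ‖z‖ + 1)] with i ⟨_, h1⟩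
    exact h1 y (by simp; linarith [norm_nonneg z]) z (by simp; linarith [norm_nonneg y])
  refine ⟨V, ⟨?_, fun y => ?_, fun y => ?_, hlip, ?_⟩, c, hc, hlowV⟩
  · refine tendsto_nhds_unique (hV 0) ?_
    simp only [(h.resc _).v_zero]
    exact tendsto_const_nhds
  · exact lt_of_lt_of_le (by positivity) (hlowV y)
  · refine le_of_tendsto (hV y) ?_
    filter_upwards [h.eventually_mem ‖y‖] with i h2
    exact (h2 y (by simp)).2.2.2
  · intro X δ hδ
    have hL := h.lip_pos
    obtain ⟨t, htX, htf, ht⟩ := (isCompact_closedBall (0 : Euc (N + 2)) X).finite_cover_balls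
      (e := δ / (3 * lip N C)) (by positivity)
    have h1 : ∀ᶠ i in F, ∀ z ∈ t, |v i z - V z| ≤ δ / 3 := by
      rw [eventually_all_finite htf]
      intro z hz
      filter_upwards [(Metric.tendsto_nhds.1 (hV z)) (δ / 3) (by positivity)] with i hi
      rw [Real.dist_eq] at hi
      exact hi.le
    filter_upwards [h1, h.eventually_lip (X + 1)] with i h1 ⟨_, h2⟩ y hy
    obtain ⟨z, hz, hyz⟩ := mem_iUnion₂.1 (ht hy)
    rw [mem_ball, dist_eq_norm] at hyz
    have hzX := htX hz
    rw [mem_closedBall_zero_iff] at hy hzX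
    have h3 := h2 y (by simp; linarith) z (by simp; linarith)
    have h4 := h1 z hz
    have h5 := hlip y z
    have h6 : lip N C * ‖y - z‖ ≤ δ / 3 := by
      calc lip N C * ‖y - z‖ ≤ lip N C * (δ / (3 * lip N C)) := by gcongr
        _ = δ / 3 := by field_simp
    rw [abs_le] at h3 h4 h5 ⊢
    constructor <;> linarith [h3.1, h3.2, h4.1, h4.2, h5.1, h5.2]

lemma g_le (h : BlowupSeq ℓ C F v k q g ε T R A) (i : ℕ) : g i ≤ C := by
  by_contra! hc
  have h1 := h.one_le
  have h2 : g i ≤ g i ^ (N - 1) :=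
    le_self_pow₀ (by linarith) (by have := h.two_le; omega)
  have := (h.resc i).q_le
  rw [← (h.resc i).g_pow] at this
  linarith

lemma eventually_k_sub (h : BlowupSeq ℓ C F v k q g ε T R A) {X : ℝ} (hX : 0 ≤ X) :
    ∃ B ≥ 0, ∀ᶠ i in F, ∀ y ∈ closedBall (0 : Euc (N + 2)) X,
      ∀ z ∈ closedBall (0 : Euc (N + 2)) X, |k i y - k i z| ≤ B * ε i := by
  have hC := h.one_le
  refine ⟨2 * X * C * (1 + (C + 1) ^ (N - 2)), by positivity, ?_⟩
  have h1 : ∀ᶠ i in F, ε i < (X + 1)⁻¹ := h.ε_lim.eventually_lt_const (by positivity)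
  filter_upwards [h1, h.eventually_mem X] with i h1 h2 y hy z hz
  have hε := (h.resc i).ε_pos
  have hr := (h.resc i).k_diff X y (h2 y hy).2.1 z (h2 z hz).2.1 (by simpa using hy)
    (by simpa using hz)
  rw [mem_closedBall_zero_iff] at hy hz
  have h3 : ‖y - z‖ ≤ 2 * X := (norm_sub_le _ _).trans (by linarith)
  have h4 : |ε i * inner ℝ (q i) (y - z)| ≤ ε i * (C * (2 * X)) := by
    rw [abs_mul, abs_of_pos hε]
    gcongr
    refine (abs_real_inner_le_norm _ _).trans ?_
    gcongr
    exact (h.resc i).q_le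
  have h5 : ε i * X ≤ 1 := by
    rw [lt_inv_comm₀ hε (by positivity), ] at h1
    have : X ≤ (ε i)⁻¹ := by linarith
    calc ε i * X ≤ ε i * (ε i)⁻¹ := by gcongr
      _ = 1 := mul_inv_cancel₀ hε.ne'
  have h6 : ε i * X * (g i + ε i * X) ^ (N - 2) ≤ 1 * (C + 1) ^ (N - 2) := by
    have := (h.resc i).g_nonneg
    gcongr
    exact h.g_le i
  have h7 : C * ε i * ‖y - z‖ * (ε i * X * (g i + ε i * X) ^ (N - 2)) ≤
      C * ε i * (2 * X) * (1 * (C + 1) ^ (N - 2)) := by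
    have := (h.resc i).g_nonneg
    gcongr
  have h8 := abs_add_le (k i y - k i z - ε i * inner ℝ (q i) (y - z)) (ε i * inner ℝ (q i) (y - z))
  rw [sub_add_cancel] at h8
  nlinarith

lemma eventually_k_one (h : BlowupSeq ℓ C F v k q g ε T R A) (X : ℝ) {δ : ℝ} (hδ : 0 < δ) :
    ∀ᶠ i in F, ∀ y ∈ closedBall (0 : Euc (N + 2)) X, |k i y - 1| ≤ δ := by
  obtain ⟨B, hB, h1⟩ := h.eventually_k_sub (abs_nonneg X)
  have h2 : ∀ᶠ i in F, ε i < δ / (B + 1) := h.ε_lim.eventually_lt_const (by positivity)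
  filter_upwards [h1, h2] with i h1 h2 y hy
  rw [mem_closedBall_zero_iff] at hy
  have := h1 y (by simpa using hy.trans (le_abs_self X)) 0 (by simp)
  rw [(h.resc i).k_zero] at this
  have hε := (h.resc i).ε_pos
  rw [lt_div_iff₀ (by positivity)] at h2
  nlinarith

/-- The limit of a blow-up sequence does not dominate all its Kelvin transforms. -/
lemma false_of_kelvin_le (h : BlowupSeq ℓ C F v k q g ε T R A) {L : ℝ} {V : Euc (N + 2) → ℝ}
    (hV : BlowupLim F v L V)
    (hk : ∀ x l, 0 < l → ∀ y, l ≤ ‖y - x‖ → kelvin x l V y ≤ V y) : False := by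
  have hmono : ∀ y z, V z ≤ V y := by
    intro y z
    by_cases hyz : y = z
    · rw [hyz]
    have key : ∀ t ∈ Ioo (0:ℝ) 1, t ^ N * V z ≤ V y := by
      intro t ⟨ht0, ht1⟩
      have ht : 0 < 1 - t ^ 2 := by nlinarith
      set x := (1 - t ^ 2)⁻¹ • (z - t ^ 2 • y) with hx
      have hyx : y - x = (1 - t ^ 2)⁻¹ • (y - z) := by
        have : y = (1 - t ^ 2)⁻¹ • ((1 - t ^ 2) • y) := by
          rw [smul_smul, inv_mul_cancel₀ ht.ne', one_smul]
        rw [hx]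
        nth_rw 1 [this]
        module
      have hn : 0 < ‖y - x‖ := by
        rw [hyx, norm_smul, Real.norm_eq_abs, abs_of_pos (by positivity)]
        have := norm_pos_iff.2 (sub_ne_zero.2 hyz)
        positivity
      have h1 := hk x (t * ‖y - x‖) (by positivity) y (by nlinarith)
      have h2 : t * ‖y - x‖ * ‖y - x‖⁻¹ = t := by field_simp
      have h3 : inv x (t * ‖y - x‖) y = z := by
        have h4 : (1 - t ^ 2) • (y - x) = y - z := by
          rw [hyx, smul_smul, mul_inv_cancel₀ ht.ne', one_smul]
        rw [inv, h2]
        have : x + t ^ 2 • (y - x) = y - (1 - t ^ 2) • (y - x) := by module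
        rw [this, h4]
        abel
      rwa [kelvin, h2, h3, show N + 2 - 2 = N by omega] at h1
    have hlim : Tendsto (fun t : ℝ => t ^ N * V z) (𝓝[<] 1) (𝓝 (1 ^ N * V z)) :=
      (Continuous.tendsto (by fun_prop) 1).mono_left nhdsWithin_le_nhds
    rw [one_pow, one_mul] at hlim
    refine le_of_tendsto hlim ?_
    filter_upwards [Ioo_mem_nhdsLT (show (0:ℝ) < 1 by norm_num)] with t ht using key t ht
  have hV1 : ∀ y, V y = 1 := fun y => by
    rw [← hV.zero]; exact le_antisymm (hmono _ _) (hmono _ _)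
  set c : ℝ := 1 / (32 * (N + 2)) with hc
  have hc0 : 0 < c := by positivity
  have hlap : ∀ᶠ i in F, ∀ y ∈ ball (0 : Euc (N + 2)) 1, ∃ L ≤ 0,
      HasLap (fun y => v i y - 1 - c * (1 - ‖y - 0‖ ^ 2)) y L := by
    filter_upwards [h.eventually_mem 1, h.eventually_k_one 1 (show (0:ℝ) < 1 / 2 by norm_num),
      hV.unif 1 (1 / 2) (by norm_num)] with i h1 h2 h3 y hy
    have hy := ball_subset_closedBall hy
    obtain ⟨h4, h5, h6, h7⟩ := h1 y hy
    refine ⟨_, ?_, (((h.resc i).eqn y h4).sub (HasLap.const 1)).sub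
      ((((HasLap.const 1).sub (hasLap_normSq 0 y)).const_mul c))⟩
    have h8 := (abs_le.1 (h2 y hy)).1
    have h9 := (abs_le.1 (h3 y hy)).1
    rw [hV1] at h9
    have hN := h.N_pos
    have h10 : (1 / 8 : ℝ) ≤ v i y ^ (1 + 4 / (N : ℝ)) := by
      calc (1 / 8 : ℝ) = (1 / 2) ^ (3:ℝ) := by norm_num
        _ ≤ (1 / 2) ^ (1 + 4 / (N : ℝ)) := by
          refine Real.rpow_le_rpow_of_exponent_ge (by norm_num) (by norm_num) ?_
          have : 4 / (N : ℝ) ≤ 2 := by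
            rw [div_le_iff₀ hN]
            have : (2:ℝ) ≤ N := by exact_mod_cast h.two_le
            linarith
          linarith
        _ ≤ _ := Real.rpow_le_rpow (by norm_num) (by linarith) (by positivity)
    have h11 : 1 / 2 * (1 / 8) ≤ k i y * v i y ^ (1 + 4 / (N : ℝ)) :=
      mul_le_mul (by linarith) h10 (by norm_num) (by linarith)
    have h12 : c * (2 * (N + 2)) = 1 / 16 := by rw [hc]; field_simp; norm_num
    push_cast
    linarith
  have := limit_comparison (n := N + 2) (by omega) (F := (F : Filter ℕ))
    (A := closedBall 0 1) (U := ball 0 1)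
    (W := fun i y => v i y - 1 - c * (1 - ‖y - 0‖ ^ 2)) (w := fun y => - c * (1 - ‖y - 0‖ ^ 2))
    (isCompact_closedBall _ _) isOpen_ball ball_subset_closedBall ?_ ?_ ?_ ?_ 0 (by simp)
  · simp at this; linarith
  · filter_upwards [h.eventually_mem 1] with i hi
    have := (h.resc i).cont.mono (fun y hy => (hi y hy).2.1)
    fun_prop
  · intro δ hδ
    filter_upwards [hlap] with i hi y hy
    obtain ⟨L, hL, hL'⟩ := hi y hy
    exact ⟨L, by linarith, hL'⟩
  · intro δ hδ
    filter_upwards [hV.unif 1 δ hδ] with i hi y hy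
    have := hi y hy
    rw [hV1] at this
    rwa [show v i y - 1 - c * (1 - ‖y - 0‖ ^ 2) - -c * (1 - ‖y - 0‖ ^ 2) = v i y - 1 by ring]
  · rintro y ⟨hy, hy'⟩
    simp at hy hy'
    have : ‖y‖ = 1 := le_antisymm hy hy'
    simp [this]

end BlowupSeq

end

section

variable {n N : ℕ}

lemma kelvin_eq (x y : Euc (N + 2)) (l : ℝ) (v : Euc (N + 2) → ℝ) :
    kelvin x l v y = (l * ‖y - x‖⁻¹) ^ N * v (inv x l y) := by
  rw [kelvin, show N + 2 - 2 = N by omega]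

lemma mul_norm_inv_le_one {x y : Euc n} {l : ℝ} (hl : 0 < l) (h : l ≤ ‖y - x‖) :
    l * ‖y - x‖⁻¹ ≤ 1 := by
  rw [← div_eq_mul_inv, div_le_one (hl.trans_le h)]
  exact h

/-- Small Kelvin transforms lie below `v`, up to the barrier. -/
lemma start_pos {D : Set (Euc (N + 2))} {x : Euc (N + 2)} {v : Euc (N + 2) → ℝ}
    {l r₀ m L c P S Q : ℝ} (hN : 1 ≤ N) (hl : 0 < l) (hlr : l ≤ r₀)
    (hm : ∀ y ∈ closedBall x r₀, m ≤ v y)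
    (hlip : ∀ y ∈ closedBall x r₀, ∀ z ∈ closedBall x r₀, |v y - v z| ≤ L * ‖y - z‖)
    (hL : 0 ≤ L) (hLr : 4 * (L * r₀) ≤ m) (hv1 : ∀ y ∈ closedBall x r₀, v y ≤ 1)
    (hfar : ∀ y ∈ D, r₀ ≤ ‖y - x‖ → c * ‖y - x‖⁻¹ ^ N ≤ v y) (hc : 2 * l ^ N ≤ c)
    (hQv : ∀ y ∈ D, 2 * Q < l * v y) (hP : 0 ≤ P) (hS : 0 < S) (hQ : 0 ≤ Q)
    {y : Euc (N + 2)} (hy : y ∈ D) (hly : l ≤ ‖y - x‖) :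
    0 < v y - kelvin x l v y + barrier N P S Q l ‖y - x‖⁻¹ := by
  have hr : 0 < ‖y - x‖ := hl.trans_le hly
  have hxy : y ≠ x := fun h => by simp [h] at hr
  have hτ1 := mul_norm_inv_le_one hl hly
  set ω := ‖y - x‖⁻¹ with hω
  have hω0 : 0 < ω := by positivity
  set τ := l * ω with hτ
  have hτ0 : 0 < τ := by positivity
  have hz : inv x l y ∈ closedBall x r₀ := by
    rw [mem_closedBall, dist_eq_norm]
    exact (norm_inv_sub_le hl hly).trans hlr
  have hb : S * ω ^ N - Q / l * (1 - τ) ≤ barrier N P S Q l ω := by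
    have h1 : 0 ≤ P * (ω ^ N / l - ω ^ (N + 1)) := by
      refine mul_nonneg hP ?_
      have : ω ^ N / l - ω ^ (N + 1) = ω ^ N / l * (1 - τ) := by
        rw [hτ, pow_succ]; field_simp
      rw [this]
      have : 0 ≤ 1 - τ := by linarith
      positivity
    have h2 : Q * (1 / l - ω) = Q / l * (1 - τ) := by rw [hτ]; field_simp
    rw [barrier, h2]
    linarith
  have hQl : Q / l < v y / 2 := by
    rw [div_lt_iff₀ hl]; have := hQv y hy; linarith
  have hSω : 0 < S * ω ^ N := by positivity
  have hQ0 : 0 ≤ Q / l := by positivity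
  rw [kelvin_eq]
  rcases le_total ‖y - x‖ r₀ with h | h
  · have hyb : y ∈ closedBall x r₀ := by rwa [mem_closedBall, dist_eq_norm]
    have h1 := (abs_le.1 (hlip y hyb _ hz)).1
    have h2 : ‖y - inv x l y‖ ≤ 2 * r₀ * (1 - τ) := by
      have : y - inv x l y = (1 - τ ^ 2) • (y - x) := by rw [inv]; module
      rw [this, norm_smul, Real.norm_eq_abs, abs_of_nonneg (by nlinarith)]
      nlinarith [mul_nonneg (sub_nonneg.2 hτ1) (sub_nonneg.2 h),
        mul_nonneg (mul_nonneg (sub_nonneg.2 hτ1) (sub_nonneg.2 hτ1)) hr.le]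
    have h3 : τ ^ N ≤ τ := pow_le_of_le_one hτ0.le hτ1 (by omega)
    have h4 : L * ‖y - inv x l y‖ ≤ m / 2 * (1 - τ) := by
      calc _ ≤ L * (2 * r₀ * (1 - τ)) := by gcongr
        _ = 2 * (L * r₀) * (1 - τ) := by ring
        _ ≤ _ := by
          have : 0 ≤ 1 - τ := by linarith
          gcongr; linarith
    have hm' := hm y hyb
    have hm0 : 0 ≤ m := le_trans (by have := hl.trans_le hlr; positivity) hLr
    have h5 : τ ^ N * v (inv x l y) ≤ τ ^ N * (v y + m / 2 * (1 - τ)) := by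
      gcongr; linarith
    have h6 : τ ^ N * (v y + m / 2 * (1 - τ)) ≤ τ * v y + m / 2 * (1 - τ) := by
      have : τ ^ N * (m / 2 * (1 - τ)) ≤ 1 * (m / 2 * (1 - τ)) := by
        have : 0 ≤ 1 - τ := by linarith
        gcongr; linarith
      nlinarith
    nlinarith
  · have h1 := hfar y hy h
    have h2 := hv1 _ hz
    have h3 : τ ^ N * v (inv x l y) ≤ l ^ N * ω ^ N := by
      rw [← mul_pow]
      exact mul_le_of_le_one_right (by positivity) h2
    have h4 : 2 * l ^ N * ω ^ N ≤ c * ω ^ N := by gcongr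
    nlinarith

namespace BlowupSeq

variable {ℓ : Fin (N + 2)} {C : ℝ} {F : Ultrafilter ℕ} {v k : ℕ → Euc (N + 2) → ℝ}
  {q : ℕ → Euc (N + 2)} {g ε T R A : ℕ → ℝ}

lemma eventually_mem_ball (h : BlowupSeq ℓ C F v k q g ε T R A) (x : Euc (N + 2)) (l : ℝ) :
    ∀ᶠ i in F, ∀ y ∈ closedBall x l,
      y ∈ domInt ℓ (8 * ε i)⁻¹ (T i) ∧ y ∈ dom ℓ (8 * ε i)⁻¹ (T i) ∧ 0 < v i y ∧ v i y ≤ 1 := by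
  filter_upwards [h.eventually_mem (‖x‖ + l)] with i hi y hy
  refine hi y ?_
  rw [mem_closedBall_zero_iff]
  rw [mem_closedBall, dist_eq_norm] at hy
  have := norm_add_le x (y - x)
  rw [add_sub_cancel] at this
  linarith

lemma eventually_start_of_lt (h : BlowupSeq ℓ C F v k q g ε T R A) (x : Euc (N + 2)) {l₁ : ℝ}
    (hl₁ : 0 < l₁) : ∃ l₀ > 0, l₀ ≤ l₁ ∧ ∀ᶠ i in F, ∀ D ⊆ dom ℓ (8 * ε i)⁻¹ (T i), ∀ P S Q : ℝ,
      0 ≤ P → 0 < S → 0 ≤ Q → (∀ y ∈ D, 2 * Q < l₀ * v i y) → ∀ y ∈ D, l₀ ≤ ‖y - x‖ →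
        0 < v i y - kelvin x l₀ (v i) y + barrier N P S Q l₀ ‖y - x‖⁻¹ := by
  obtain ⟨c, hc, hlow⟩ := h.eventually_lower
  have hL := h.lip_pos
  set L := lip N C
  set m := c * (1 + (‖x‖ + l₁))⁻¹ ^ N with hm
  have hm0 : 0 < m := by positivity
  set r₀ := min l₁ (m / (4 * L)) with hr₀
  have hr0 : 0 < r₀ := lt_min hl₁ (by positivity)
  set a := (1 + ‖x‖) / r₀ + 1 with ha
  have ha1 : 1 ≤ a := by
    have : 0 ≤ (1 + ‖x‖) / r₀ := by positivity
    linarith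
  have hN1 : 1 ≤ N := by have := h.two_le; omega
  set κ := 1 / 2 * min c 1 / a with hκ
  have hκ0 : 0 < κ := by have : 0 < min c 1 := lt_min hc one_pos; positivity
  refine ⟨min r₀ κ, lt_min hr0 hκ0, (min_le_left _ _).trans (min_le_left _ _), ?_⟩
  set l₀ := min r₀ κ with hl₀
  have hl0 : 0 < l₀ := lt_min hr0 hκ0
  filter_upwards [hlow, h.eventually_mem_ball x l₁, h.eventually_lip (‖x‖ + l₁ + 1)]
    with i h1 h2 ⟨_, h3⟩ D hD P S Q hP hS hQ hQv y hy hly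
  have hε := (h.resc i).ε_pos
  have hrl : r₀ ≤ l₁ := min_le_left _ _
  have hball : ∀ y ∈ closedBall x r₀, y ∈ closedBall x l₁ := closedBall_subset_closedBall hrl
  have hnorm : ∀ y ∈ closedBall x r₀, ‖y‖ ≤ ‖x‖ + l₁ := by
    intro y hy
    rw [mem_closedBall, dist_eq_norm] at hy
    have := norm_add_le x (y - x)
    rw [add_sub_cancel] at this
    linarith
  refine start_pos (D := D) (r₀ := r₀) (m := m) (L := L) (c := c / a ^ N)
    hN1 hl0 (min_le_left _ _) ?_ ?_ hL.le ?_
    (fun y hy => (h2 y (hball y hy)).2.2.2) ?_ ?_ hQv hP hS hQ hy hly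
  · intro y hy
    refine le_trans ?_ (h1 y (h2 y (hball y hy)).2.1)
    rw [hm]
    have := hnorm y hy
    gcongr
  · intro y hy z hz
    have := hnorm y hy
    have := hnorm z hz
    exact h3 y (by simp; linarith) z (by simp; linarith)
  · have : r₀ ≤ m / (4 * L) := min_le_right _ _
    rw [le_div_iff₀ (by positivity)] at this
    linarith
  · intro y hy hry
    refine le_trans ?_ (h1 y (hD hy))
    have h5 : 1 + ‖y‖ ≤ a * ‖y - x‖ := by
      have h6 := norm_add_le (y - x) x
      rw [sub_add_cancel] at h6
      have h7 : 1 + ‖x‖ ≤ (1 + ‖x‖) / r₀ * ‖y - x‖ := by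
        calc 1 + ‖x‖ = (1 + ‖x‖) / r₀ * r₀ := by field_simp
          _ ≤ _ := by gcongr
      rw [ha]; linarith
    have h8 : 0 < ‖y - x‖ := hr0.trans_le hry
    rw [div_mul_eq_mul_div, mul_div_assoc, ← div_pow]
    refine mul_le_mul_of_nonneg_left ?_ hc.le
    gcongr
    rw [div_eq_mul_inv, ← mul_inv]
    gcongr
    linarith
  · have h5 : l₀ ≤ κ := min_le_right _ _
    rw [le_div_iff₀ (by positivity)]
    have h6 : l₀ * a ≤ 1 / 2 * min c 1 := by
      rwa [hκ, le_div_iff₀ (by positivity)] at h5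
    calc 2 * l₀ ^ N * a ^ N = 2 * (l₀ * a) ^ N := by rw [mul_pow]; ring
      _ ≤ 2 * (l₀ * a) := by
        gcongr
        refine pow_le_of_le_one (by positivity) (h6.trans ?_) (by omega)
        have := min_le_right c 1
        linarith
      _ ≤ c := by
        have := min_le_left c 1
        linarith

lemma eventually_start (h : BlowupSeq ℓ C F v k q g ε T R A) (x : Euc (N + 2)) {l₁ : ℝ}
    (hl₁ : 0 < l₁) : ∃ l₀ > 0, l₀ ≤ l₁ ∧ ∀ C' : ℝ, ∀ᶠ i in F, ∀ P S Q : ℝ, 0 ≤ P → 0 < S → 0 ≤ Q →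
      Q ≤ C' * ε i ^ N → ∀ y ∈ dom ℓ (8 * ε i)⁻¹ (T i), l₀ ≤ ‖y - x‖ →
        0 < v i y - kelvin x l₀ (v i) y + barrier N P S Q l₀ ‖y - x‖⁻¹ := by
  obtain ⟨l₀, hl0, hl01, hst⟩ := h.eventually_start_of_lt x hl₁
  refine ⟨l₀, hl0, hl01, fun C' => ?_⟩
  filter_upwards [hst, h.A_lim.eventually_gt_atTop (2 * C' / l₀)] with i h1 h4 P S Q hP hS hQ hQC
  refine h1 _ subset_rfl P S Q hP hS hQ fun y hy => ?_
  have hε := (h.resc i).ε_pos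
  have h5 := (h.resc i).low y hy
  rw [div_lt_iff₀ hl0] at h4
  have h6 : 0 < ε i ^ N := by positivity
  calc 2 * Q ≤ 2 * (C' * ε i ^ N) := by gcongr
    _ = 2 * C' * ε i ^ N := by ring
    _ < A i * l₀ * ε i ^ N := by gcongr
    _ = l₀ * (A i * ε i ^ N) := by ring
    _ ≤ _ := by gcongr

lemma eventually_outer (h : BlowupSeq ℓ C F v k q g ε T R A) (x : Euc (N + 2)) {l₀ l₁ : ℝ}
    (hl₀ : 0 < l₀) (C' : ℝ) : ∀ᶠ i in F, ∀ P S Q : ℝ, 0 ≤ P → 0 < S → 0 ≤ Q →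
      Q ≤ C' * ε i ^ N → ∀ l, l₀ ≤ l → l ≤ l₁ → ∀ y ∈ dom ℓ (8 * ε i)⁻¹ (T i), l ≤ ‖y - x‖ →
        ‖y‖ = (8 * ε i)⁻¹ → 0 < v i y - kelvin x l (v i) y + barrier N P S Q l ‖y - x‖⁻¹ := by
  filter_upwards [h.eventually_mem_ball x l₁, h.eventually_ball (2 * ‖x‖),
    h.A_lim.eventually_gt_atTop (l₁ ^ N * 16 ^ N + C' / l₀)]
    with i h1 ⟨h2, _⟩ h3 P S Q hP hS hQ hQC l hl0 hl1 y hy hly hyρ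
  have hε := (h.resc i).ε_pos
  have hl : 0 < l := hl₀.trans_le hl0
  have hl₁ : 0 < l₁ := hl.trans_le hl1
  have hr : 0 < ‖y - x‖ := hl.trans_le hly
  have hτ1 := mul_norm_inv_le_one hl hly
  have hz : inv x l y ∈ closedBall x l₁ := by
    rw [mem_closedBall, dist_eq_norm]
    exact (norm_inv_sub_le hl hly).trans hl1
  have hω : ‖y - x‖⁻¹ ≤ 16 * ε i := by
    have h5 := norm_sub_norm_le y x
    rw [hyρ] at h5
    rw [inv_le_comm₀ hr (by positivity)]
    have : (8 * ε i)⁻¹ = 2 * (16 * ε i)⁻¹ := by field_simp; norm_num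
    linarith
  set ω := ‖y - x‖⁻¹
  have hω0 : 0 < ω := by positivity
  have h4 : kelvin x l (v i) y ≤ l₁ ^ N * 16 ^ N * ε i ^ N := by
    rw [kelvin_eq, ← mul_pow, ← mul_pow]
    calc _ ≤ (l * ω) ^ N * 1 := by gcongr; exact (h1 _ hz).2.2.2
      _ = (l * ω) ^ N := mul_one _
      _ ≤ _ := by
        rw [mul_assoc]
        gcongr
  have h5 : -(C' / l₀ * ε i ^ N) < barrier N P S Q l ω := by
    have h1 : 0 ≤ P * (ω ^ N / l - ω ^ (N + 1)) := by
      refine mul_nonneg hP ?_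
      have : ω ^ N / l - ω ^ (N + 1) = ω ^ N / l * (1 - l * ω) := by
        rw [pow_succ]; field_simp
      rw [this]
      have : 0 ≤ 1 - l * ω := by linarith
      positivity
    have h2 : Q * (1 / l - ω) ≤ C' / l₀ * ε i ^ N := by
      calc Q * (1 / l - ω) ≤ Q * (1 / l) := by gcongr; linarith
        _ ≤ Q * (1 / l₀) := by gcongr
        _ ≤ C' * ε i ^ N * (1 / l₀) := by gcongr
        _ = _ := by ring
    have h3 : 0 < S * ω ^ N := by positivity
    rw [barrier]
    linarith
  have h6 := (h.resc i).low y hy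
  have h7 : (l₁ ^ N * 16 ^ N + C' / l₀) * ε i ^ N < A i * ε i ^ N := by gcongr
  nlinarith

end BlowupSeq

end

section

variable {n N : ℕ}

namespace BlowupSeq

variable {ℓ : Fin (N + 2)} {C : ℝ} {F : Ultrafilter ℕ} {v k : ℕ → Euc (N + 2) → ℝ}
  {q : ℕ → Euc (N + 2)} {g ε T R A : ℕ → ℝ}

lemma hasDerivAt_barrier (P S Q l : ℝ) {x y : Euc (N + 2)} (hxy : y ≠ x) (ℓ : Fin (N + 2)) :
    HasDerivAt (fun s : ℝ => barrier N P S Q l ‖y + s • nu ℓ - x‖⁻¹)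
      ((x ℓ - y ℓ) * (P * (N * ‖y - x‖⁻¹ ^ (N + 2) / l - (N + 1) * ‖y - x‖⁻¹ ^ (N + 3))
        + S * (N * ‖y - x‖⁻¹ ^ (N + 2)) + Q * ‖y - x‖⁻¹ ^ 3)) 0 := by
  have h0 := hasDerivAt_normInv_pow N hxy ℓ
  have h1 := hasDerivAt_normInv_pow (N + 1) hxy ℓ
  have h2 := hasDerivAt_normInv_pow 1 hxy ℓ
  simp only [pow_one] at h2
  have := ((((h0.div_const l).sub h1).const_mul P).add (h0.const_mul S)).sub
    ((h2.const_sub (1 / l)).const_mul Q)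
  refine this.congr_deriv ?_
  push_cast
  ring

set_option maxHeartbeats 1000000 in
lemma eventually_flat (h : BlowupSeq ℓ C F v k q g ε T R A) (x : Euc (N + 2)) {l₀ l₁ : ℝ}
    (hl₀ : 0 < l₀) (hl₁ : l₀ ≤ l₁) {C' : ℝ} (hC' : 0 ≤ C') {P S : ℕ → ℝ}
    (hP : Tendsto P F (𝓝 0)) (hS : Tendsto S F (𝓝 0)) : ∀ᶠ i in F, ∀ Q : ℝ,
      0 ≤ P i → 0 < S i → 0 ≤ Q →
      Q ≤ C' * ε i ^ N → ∀ l, l₀ ≤ l → l ≤ l₁ → ∀ y ∈ dom ℓ (8 * ε i)⁻¹ (T i),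
        ‖y‖ < (8 * ε i)⁻¹ → y ℓ = -T i → l < ‖y - x‖ →
        v i y = kelvin x l (v i) y - barrier N (P i) (S i) Q l ‖y - x‖⁻¹ →
        ∃ d < 0, HasDerivWithinAt (fun s : ℝ => v i (y + s • nu ℓ) - kelvin x l (v i) (y + s • nu ℓ)
          + barrier N (P i) (S i) Q l ‖y + s • nu ℓ - x‖⁻¹) d (Ici 0) 0 := by
  obtain ⟨c, hc, hlow⟩ := h.eventually_lower
  have hL := h.lip_pos
  set L := lip N C
  have hl1 : 0 < l₁ := hl₀.trans_le hl₁
  have hNp := h.N_pos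
  set m := c * (1 + (‖x‖ + l₁))⁻¹ ^ N with hm
  have hm0 : 0 < m := by positivity
  set C3 := l₁ ^ N + C' / l₀ with hC3
  have hC30 : 0 < C3 := by positivity
  set p := 1 + 2 / (N : ℝ) with hp
  set K1 := C * C3 ^ p + l₁ ^ N * (3 * l₁ ^ 2 * L) with hK1
  set m1 := N * l₀ ^ N * m with hm1
  have hm10 : 0 < m1 := by positivity
  have hlim : Tendsto (fun i => N * (P i / l₀ + S i) + C' * ε i) F (𝓝 0) := by
    have := (((hP.div_const l₀).add hS).const_mul (N:ℝ)).add (h.ε_lim.const_mul C')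
    simpa using this
  filter_upwards [hlow, h.eventually_mem_ball x l₁, h.eventually_lip (‖x‖ + l₁ + 1),
    h.eventually_ball ‖x‖,
    hlim.eventually_lt_const (show 0 < m1 / 2 by positivity),
    h.T_lim.eventually_gt_atTop (2 * K1 / m1 + ‖x‖)]
    with i h1 h2 ⟨h3, _⟩ ⟨h4, _⟩ h5 h6 Q hP0 hS0 hQ0 hQC l hl0 hll1 y hy hyρ hyT hly heq
  have hε := (h.resc i).ε_pos
  have hl : 0 < l := hl₀.trans_le hl0
  have hr : 0 < ‖y - x‖ := hl.trans hly
  have hxy : y ≠ x := fun h => by simp [h] at hr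
  have hτ1 := mul_norm_inv_le_one hl hly.le
  have hz : inv x l y ∈ closedBall x l₁ := by
    rw [mem_closedBall, dist_eq_norm]
    exact (norm_inv_sub_le hl hly.le).trans hll1
  have hzn : ‖inv x l y‖ ≤ ‖x‖ + l₁ := by
    rw [mem_closedBall, dist_eq_norm] at hz
    have := norm_add_le x (inv x l y - x)
    rw [add_sub_cancel] at this
    linarith
  have hmz : m ≤ v i (inv x l y) := by
    refine le_trans ?_ (h1 _ (h2 _ hz).2.1)
    rw [hm]; gcongr
  obtain ⟨dv, hdv, hdv'⟩ := (h.resc i).flat y hyρ hyT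
  obtain ⟨dk, hdk', hdk⟩ := hasDerivAt_kelvin (ℓ := ℓ) hxy
    (((h.resc i).smooth _ (h2 _ hz).1).differentiableAt (by simp))
    (h3 (inv x l y) (by simp; linarith))
  have hdb := hasDerivAt_barrier (P i) (S i) Q l hxy ℓ
  refine ⟨_, ?_, (hdv'.sub hdk'.hasDerivWithinAt).add hdb.hasDerivWithinAt⟩
  have hεω : ε i ≤ ‖y - x‖⁻¹ := by
    rw [le_inv_comm₀ hε hr]
    have h7 := norm_sub_le y x
    have : (8 * ε i)⁻¹ = (ε i)⁻¹ / 8 := by field_simp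
    have : 0 < (ε i)⁻¹ := by positivity
    linarith
  set ω := ‖y - x‖⁻¹ with hω
  have hω0 : 0 < ω := by positivity
  have hεN : ε i ^ N ≤ ω ^ N := by gcongr
  have hQω : Q ≤ C' * ω ^ N := hQC.trans (by gcongr)
  -- upper bound for `v`
  have hvy : v i y ≤ C3 * ω ^ N := by
    have h7 : 0 ≤ P i * (ω ^ N / l - ω ^ (N + 1)) := by
      refine mul_nonneg hP0 ?_
      have : ω ^ N / l - ω ^ (N + 1) = ω ^ N / l * (1 - l * ω) := by
        rw [pow_succ]; field_simp
      rw [this]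
      have : 0 ≤ 1 - l * ω := by linarith
      positivity
    have h8 : Q * (1 / l - ω) ≤ C' / l₀ * ω ^ N := by
      calc Q * (1 / l - ω) ≤ Q * (1 / l) := by gcongr; linarith
        _ ≤ Q * (1 / l₀) := by gcongr
        _ ≤ C' * ω ^ N * (1 / l₀) := by gcongr
        _ = _ := by ring
    have h9 : 0 < S i * ω ^ N := by positivity
    have h10 : kelvin x l (v i) y ≤ l₁ ^ N * ω ^ N := by
      rw [kelvin_eq, ← mul_pow]
      calc _ ≤ (l * ω) ^ N * 1 := by gcongr; exact (h2 _ hz).2.2.2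
        _ = (l * ω) ^ N := mul_one _
        _ ≤ _ := by gcongr
    rw [heq, barrier, hC3]
    linarith
  have hvy0 := (h.resc i).pos y hy
  have hdv2 : dv ≤ C * C3 ^ p * ω ^ (N + 2) := by
    have h9 : v i y ^ p ≤ C3 ^ p * ω ^ (N + 2) := by
      calc v i y ^ p ≤ (C3 * ω ^ N) ^ p :=
            Real.rpow_le_rpow hvy0.le hvy (by positivity)
        _ = _ := by
            rw [Real.mul_rpow hC30.le (by positivity), ← Real.rpow_natCast ω N,
              ← Real.rpow_mul hω0.le, ← Real.rpow_natCast ω (N + 2)]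
            congr 2
            rw [hp]; push_cast; field_simp
    calc dv ≤ C * v i y ^ p := hdv
      _ ≤ C * (C3 ^ p * ω ^ (N + 2)) := by have := h.one_le; gcongr
      _ = _ := by ring
  set T' := x ℓ - y ℓ with hT'
  have hT'1 : 2 * K1 / m1 < T' := by
    have := (abs_le.1 (PiLp.norm_apply_le x ℓ)).1
    rw [hT', hyT]; linarith
  have hK10 : 0 ≤ K1 := by have := h.one_le; positivity
  have hT'0 : 0 < T' := lt_of_le_of_lt (by positivity) hT'1
  have hdk2 : m1 * T' * ω ^ (N + 2) - l₁ ^ N * (3 * l₁ ^ 2 * L) * ω ^ (N + 2) ≤ dk := by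
    have h7 := (abs_le.1 hdk).1
    have h8 : (|l| * ω) ^ N * (3 * l ^ 2 * ω ^ 2 * L) ≤
        l₁ ^ N * (3 * l₁ ^ 2 * L) * ω ^ (N + 2) := by
      rw [abs_of_pos hl]
      calc (l * ω) ^ N * (3 * l ^ 2 * ω ^ 2 * L) ≤ (l₁ * ω) ^ N * (3 * l₁ ^ 2 * ω ^ 2 * L) := by
            gcongr
        _ = _ := by ring
    have h9 : m1 * T' * ω ^ (N + 2) ≤ N * l ^ N * ω ^ (N + 2) * T' * v i (inv x l y) := by
      calc m1 * T' * ω ^ (N + 2) = N * l₀ ^ N * ω ^ (N + 2) * T' * m := by rw [hm1]; ring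
        _ ≤ _ := by gcongr
    linarith
  have hb : T' * (P i * (N * ω ^ (N + 2) / l - (N + 1) * ω ^ (N + 3))
      + S i * (N * ω ^ (N + 2)) + Q * ω ^ 3) ≤
      T' * ((N * (P i / l₀ + S i) + C' * ε i) * ω ^ (N + 2)) := by
    gcongr
    have h7 : P i * (N * ω ^ (N + 2) / l - (N + 1) * ω ^ (N + 3)) ≤
        P i * (N * ω ^ (N + 2) / l₀) := by
      gcongr
      have : N * ω ^ (N + 2) / l ≤ N * ω ^ (N + 2) / l₀ := by gcongr
      have : 0 < (N + 1) * ω ^ (N + 3) := by positivity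
      linarith
    have h8 : Q * ω ^ 3 ≤ C' * ε i * ω ^ (N + 2) := by
      have h9 : ε i ^ N = ε i * ε i ^ (N - 1) := by
        rw [← pow_succ']; congr 1; have := h.two_le; omega
      have h10 : ω ^ (N + 2) = ω ^ (N - 1) * ω ^ 3 := by
        rw [← pow_add]; congr 1; have := h.two_le; omega
      rw [h10]
      calc Q * ω ^ 3 ≤ C' * (ε i * ε i ^ (N - 1)) * ω ^ 3 := by rw [← h9]; gcongr
        _ ≤ C' * (ε i * ω ^ (N - 1)) * ω ^ 3 := by gcongr
        _ = _ := by ring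
    calc _ ≤ P i * (N * ω ^ (N + 2) / l₀) + S i * (N * ω ^ (N + 2)) + C' * ε i * ω ^ (N + 2) := by
          linarith
      _ = _ := by ring
  have h7 : (N * (P i / l₀ + S i) + C' * ε i) * ω ^ (N + 2) ≤ m1 / 2 * ω ^ (N + 2) := by gcongr
  have h8 : T' * ((N * (P i / l₀ + S i) + C' * ε i) * ω ^ (N + 2)) ≤
      T' * (m1 / 2 * ω ^ (N + 2)) := by gcongr
  have h9 : K1 < m1 / 2 * T' := by
    rw [div_lt_iff₀ hm10] at hT'1; linarith
  have h10 : K1 * ω ^ (N + 2) < m1 / 2 * T' * ω ^ (N + 2) := by gcongr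
  rw [hK1] at h10
  linarith

/-- The moving sphere method on the full domains. -/
lemma kelvin_le_of_interior (h : BlowupSeq ℓ C F v k q g ε T R A) {L : ℝ} {V : Euc (N + 2) → ℝ}
    (hV : BlowupLim F v L V) (x : Euc (N + 2)) {l₁ : ℝ} (hl₁ : 0 < l₁) :
    ∃ l₀ > 0, l₀ ≤ l₁ ∧ ∀ (C' : ℝ) (P S Q : ℕ → ℝ), 0 ≤ C' → (∀ᶠ i in F, 0 ≤ P i) →
      (∀ᶠ i in F, 0 < S i) → (∀ᶠ i in F, 0 ≤ Q i ∧ Q i ≤ C' * ε i ^ N) →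
      Tendsto P F (𝓝 0) → Tendsto S F (𝓝 0) →
      (∀ᶠ i in F, ∀ l, l₀ ≤ l → l ≤ l₁ → ∀ y ∈ domInt ℓ (8 * ε i)⁻¹ (T i), l < ‖y - x‖ →
        (k i (inv x l y) - k i y) * kelvin x l (v i) y ^ (1 + 4 / (N : ℝ)) +
          C * (1 + 4 / (N : ℝ)) * kelvin x l (v i) y ^ (4 / (N : ℝ)) *
            (P i * (‖y - x‖⁻¹ ^ N / l - ‖y - x‖⁻¹ ^ (N + 1)) + S i * ‖y - x‖⁻¹ ^ N) <
        P i * (N + 1) * ‖y - x‖⁻¹ ^ (N + 3) + Q i * (N - 1) * ‖y - x‖⁻¹ ^ 3) →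
      ∀ y, l₁ ≤ ‖y - x‖ → kelvin x l₁ V y ≤ V y := by
  obtain ⟨l₀, hl₀, hl01, hstart⟩ := h.eventually_start x hl₁
  refine ⟨l₀, hl₀, hl01, fun C' P S Q hC' hP0 hS0 hQ hP hS hint => ?_⟩
  have hNp := h.N_pos
  have key : ∀ᶠ i in F, ∀ l, l₀ ≤ l → l ≤ l₁ → ∀ y ∈ dom ℓ (8 * ε i)⁻¹ (T i), l ≤ ‖y - x‖ →
      0 < v i y - kelvin x l (v i) y + barrier N (P i) (S i) (Q i) l ‖y - x‖⁻¹ := by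
    filter_upwards [hP0, hS0, hQ, hint, hstart C', h.eventually_outer x hl₀ (l₁ := l₁) C',
      h.eventually_flat x hl₀ hl01 hC' hP hS, h.eventually_mem_ball x l₁]
      with i hP0 hS0 ⟨hQ0, hQ1⟩ hint h1 h2 h3 h4
    have hr := h.resc i
    refine sliding hl₀ hS0 (fun y hy => (h4 y hy).1) hr.cont hr.smooth hr.eqn
      (h1 _ _ _ hP0 hS0 hQ0 hQ1) (h2 _ _ _ hP0 hS0 hQ0 hQ1) ?_ (h3 _ hP0 hS0 hQ0 hQ1)
    intro l hl0 hl1 y hy hly heq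
    refine lt_of_le_of_lt ?_ (hint l hl0 hl1 y hy hly)
    have hl : 0 < l := hl₀.trans_le hl0
    have hτ1 := mul_norm_inv_le_one hl hly.le
    have hz : inv x l y ∈ closedBall x l₁ := by
      rw [mem_closedBall, dist_eq_norm]
      exact (norm_inv_sub_le hl hly.le).trans hl1
    have hr0 : 0 < ‖y - x‖ := hl.trans hly
    have hvz := (h4 _ hz).2.2.1
    set ω := ‖y - x‖⁻¹
    have hω0 : 0 < ω := by positivity
    have hyd := domInt_subset_dom _ _ _ hy
    have ha0 : 0 < kelvin x l (v i) y := by rw [kelvin_eq]; positivity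
    have hap : (l * ω) ^ (N + 4) * v i (inv x l y) ^ (1 + 4 / (N : ℝ)) =
        kelvin x l (v i) y ^ (1 + 4 / (N : ℝ)) := by
      rw [kelvin_eq, Real.mul_rpow (by positivity) hvz.le, ← Real.rpow_natCast _ N,
        ← Real.rpow_mul (by positivity), ← Real.rpow_natCast _ (N + 4)]
      congr 2
      push_cast; field_simp
    set a := kelvin x l (v i) y
    have htan := rpow_tangent (p := 1 + 4 / (N : ℝ)) (a := a) (c := v i y)
      (by have : 0 < 4 / (N : ℝ) := by positivity
          linarith) ha0.le (hr.pos y hyd).le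
    rw [show 1 + 4 / (N : ℝ) - 1 = 4 / N by ring] at htan
    set b' := P i * (ω ^ N / l - ω ^ (N + 1)) + S i * ω ^ N with hb'
    have hb'0 : 0 ≤ b' := by
      have : ω ^ N / l - ω ^ (N + 1) = ω ^ N / l * (1 - l * ω) := by
        rw [pow_succ]; field_simp
      rw [hb', this]
      have : 0 ≤ 1 - l * ω := by linarith
      positivity
    have hab : a - v i y ≤ b' := by
      rw [heq, barrier, hb']
      have : 0 ≤ 1 / l - ω := by
        rw [sub_nonneg, le_div_iff₀ hl]; linarith
      have : 0 ≤ Q i * (1 / l - ω) := by positivity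
      linarith
    have hk0 := hr.k_pos y hyd
    have hk1 := hr.k_le y hyd
    have h5 : k i y * (a ^ (1 + 4 / (N : ℝ)) - v i y ^ (1 + 4 / (N : ℝ))) ≤
        C * (1 + 4 / (N : ℝ)) * a ^ (4 / (N : ℝ)) * b' := by
      have h6 : (0:ℝ) ≤ (1 + 4 / (N : ℝ)) * a ^ (4 / (N : ℝ)) := by positivity
      calc _ ≤ k i y * ((1 + 4 / (N : ℝ)) * a ^ (4 / (N : ℝ)) * b') := by
            gcongr
            exact htan.trans (by gcongr)
        _ ≤ C * ((1 + 4 / (N : ℝ)) * a ^ (4 / (N : ℝ)) * b') := by gcongr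
        _ = _ := by ring
    rw [mul_neg, mul_left_comm, hap]
    linarith
  intro y hy
  have hQl : Tendsto Q F (𝓝 0) := by
    have h1 : Tendsto (fun i => C' * ε i ^ N) F (𝓝 0) := by
      have := (h.ε_lim.pow N).const_mul C'
      rwa [zero_pow (by have := h.two_le; omega), mul_zero] at this
    exact squeeze_zero' (hQ.mono fun i hi => hi.1) (hQ.mono fun i hi => hi.2) h1
  have h1 : Tendsto (fun i => v i y - kelvin x l₁ (v i) y +
      barrier N (P i) (S i) (Q i) l₁ ‖y - x‖⁻¹) F (𝓝 (V y - kelvin x l₁ V y + 0)) := by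
    refine ((hV.tendsto y).sub ((hV.tendsto _).const_mul _)).add ?_
    have := ((hP.mul_const (‖y - x‖⁻¹ ^ N / l₁ - ‖y - x‖⁻¹ ^ (N + 1))).add
      (hS.mul_const (‖y - x‖⁻¹ ^ N))).sub (hQl.mul_const (1 / l₁ - ‖y - x‖⁻¹))
    simpa [barrier] using this
  have h2 : 0 ≤ V y - kelvin x l₁ V y + 0 := by
    refine ge_of_tendsto h1 ?_
    filter_upwards [key, h.eventually_mem ‖y‖] with i h3 h4
    exact (h3 l₁ hl01 le_rfl y (h4 y (by simp)).2.1 hy).le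
  linarith

end BlowupSeq

end

section

variable {n N : ℕ}

namespace BlowupSeq

variable {ℓ : Fin (N + 2)} {C : ℝ} {F : Ultrafilter ℕ} {v k : ℕ → Euc (N + 2) → ℝ}
  {q : ℕ → Euc (N + 2)} {g ε T R A : ℕ → ℝ}

set_option maxHeartbeats 1000000 in
/-- If `V` decays slower than its Kelvin transforms at radius `l₁` about `x`, then it dominates
that Kelvin transform. -/
lemma kelvin_le_of_lt (h : BlowupSeq ℓ C F v k q g ε T R A) {L : ℝ} {V : Euc (N + 2) → ℝ}
    (hV : BlowupLim F v L V) {x : Euc (N + 2)} {l₁ β X₀ : ℝ} (hl₁ : 0 < l₁)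
    (hβ : ∀ y, X₀ ≤ ‖y‖ → β ≤ V y * ‖y‖ ^ N) (hx : l₁ ^ N * V x < β)
    {y : Euc (N + 2)} (hy : l₁ ≤ ‖y - x‖) : kelvin x l₁ V y ≤ V y := by
  obtain ⟨l₀, hl₀, hl01, hstart⟩ := h.eventually_start_of_lt x hl₁
  obtain ⟨c, hc, hlow⟩ := h.eventually_lower
  have hNp := h.N_pos
  have hC := h.one_le
  have hL : 0 ≤ L := by
    have h1 := (abs_nonneg _).trans (hV.lip (nu ℓ) 0)
    simpa [nu] using h1
  obtain ⟨s, hs0, hsX, hsy, hsl, hs⟩ : ∃ s : ℝ, 0 < s ∧ X₀ ≤ s ∧ ‖y‖ ≤ s ∧ l₁ < s ∧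
      (l₁ * (1 + ‖x‖ * s⁻¹)) ^ N * (V x + L * l₁ ^ 2 * s⁻¹) < β := by
    have h1 : Tendsto (fun u : ℝ => (l₁ * (1 + ‖x‖ * u)) ^ N * (V x + L * l₁ ^ 2 * u)) (𝓝 0)
        (𝓝 ((l₁ * (1 + ‖x‖ * 0)) ^ N * (V x + L * l₁ ^ 2 * 0))) :=
      Continuous.tendsto (by fun_prop) 0
    simp only [mul_zero, add_zero, mul_one] at h1
    have h2 := (h1.comp tendsto_inv_atTop_zero).eventually_lt_const hx
    obtain ⟨s, h3, h4, h5, h6, h7⟩ := (h2.and ((eventually_gt_atTop 0).and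
      ((eventually_ge_atTop X₀).and ((eventually_ge_atTop ‖y‖).and
        (eventually_gt_atTop l₁))))).exists
    exact ⟨s, h4, h5, h6, h7, h3⟩
  set ρ := s + ‖x‖ with hρ
  have hρ0 : 0 < ρ := by positivity
  set m := β * ρ⁻¹ ^ N - (l₁ * s⁻¹) ^ N * (V x + L * l₁ ^ 2 * s⁻¹) with hm
  have hm0 : 0 < m := by
    have h1 : l₁ * (1 + ‖x‖ * s⁻¹) * ρ⁻¹ = l₁ * s⁻¹ := by
      rw [hρ]; field_simp
    have h2 : (l₁ * (1 + ‖x‖ * s⁻¹)) ^ N * (V x + L * l₁ ^ 2 * s⁻¹) * ρ⁻¹ ^ N < β * ρ⁻¹ ^ N := by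
      gcongr
    rw [mul_right_comm, ← mul_pow, h1] at h2
    rw [hm]; linarith
  set w := (ρ + ‖x‖)⁻¹ with hw
  have hw0 : 0 < w := by positivity
  set p := 1 + 4 / (N : ℝ) with hp
  have hp0 : 0 < p := by positivity
  set σ := w ^ 3 / (4 * (C * p * l₀⁻¹ ^ N)) with hσ
  have hσ0 : 0 < σ := by positivity
  set η₀ := min (l₀ * m / 4) (l₀ * (c * (1 + ρ)⁻¹ ^ N) / 2) with hη₀
  have hη₀0 : 0 < η₀ := lt_min (by positivity) (by positivity)
  have key : ∀ η ∈ Ioo 0 η₀, ∀ᶠ i in F, 0 < v i y - kelvin x l₁ (v i) y +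
      barrier N 0 (σ * η) η l₁ ‖y - x‖⁻¹ := by
    intro η ⟨hη0, hη1⟩
    have hηm : η < l₀ * m / 4 := hη1.trans_le (min_le_left _ _)
    have hηc : η < l₀ * (c * (1 + ρ)⁻¹ ^ N) / 2 := hη1.trans_le (min_le_right _ _)
    obtain ⟨B, hB, hk⟩ := h.eventually_k_sub hρ0.le
    filter_upwards [hstart, hlow, h.eventually_mem ρ, hV.unif ρ (m / 4) (by positivity), hk,
      h.ε_lim.eventually_lt_const (show 0 < η * w ^ 3 / (4 * (B + 1)) by positivity)]
      with i h1 h2 h3 h4 h5 h6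
    have hr := h.resc i
    have hε := hr.ε_pos
    have hdom : dom ℓ ρ (ρ + 1) ⊆ closedBall 0 ρ := fun z hz => by simpa using hz.1
    have hdomI : domInt ℓ ρ (ρ + 1) ⊆ closedBall 0 ρ := fun z hz => by simpa using hz.1.le
    have hball : closedBall x l₁ ⊆ domInt ℓ ρ (ρ + 1) := fun z hz => by
      rw [mem_closedBall, dist_eq_norm] at hz
      have h7 := norm_add_le x (z - x)
      rw [add_sub_cancel] at h7
      have h8 : ‖z‖ < ρ := by rw [hρ]; linarith
      have h9 := (abs_le.1 (PiLp.norm_apply_le z ℓ)).1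
      exact ⟨h8, by linarith⟩
    have hinvball : ∀ l, 0 < l → l ≤ l₁ → ∀ z, l ≤ ‖z - x‖ → inv x l z ∈ closedBall x l₁ := by
      intro l hl hl1 z hz
      rw [mem_closedBall, dist_eq_norm]
      exact (norm_inv_sub_le hl hz).trans hl1
    refine sliding (f := fun y => -(k i y * v i y ^ (1 + 4 / (N : ℝ)))) hl₀ (by positivity) hball
      (hr.cont.mono fun z hz => (h3 z (hdom hz)).2.1)
      (fun z hz => hr.smooth z (h3 z (hdomI hz)).1) (fun z hz => hr.eqn z (h3 z (hdomI hz)).1)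
      (h1 _ (fun z hz => (h3 z (hdom hz)).2.1) _ _ _ le_rfl (by positivity) hη0.le ?_)
      ?_ ?_ ?_ l₁ hl01 le_rfl y ?_ hy
    · intro z hz
      have h7 := h2 z (h3 z (hdom hz)).2.1
      have h8 : c * (1 + ρ)⁻¹ ^ N ≤ c * (1 + ‖z‖)⁻¹ ^ N := by
        have := hz.1
        gcongr
      nlinarith
    · intro l hl0 hl1 z hz hlz hzρ
      have hl : 0 < l := hl₀.trans_le hl0
      have hz' := domInt_subset_dom _ _ _ (hball (hinvball l hl hl1 z hlz))
      have hτ1 := mul_norm_inv_le_one hl hlz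
      have hsz : s ≤ ‖z - x‖ := by
        have := norm_sub_norm_le z x
        rw [hzρ, hρ] at this; linarith
      have hzx : z ≠ x := fun h => by
        rw [h, sub_self, norm_zero] at hsz; linarith
      have hin := norm_inv_sub (l := l) hzx
      have hωs : ‖z - x‖⁻¹ ≤ s⁻¹ := by gcongr
      have hω0 : 0 < ‖z - x‖⁻¹ := inv_pos.2 (hs0.trans_le hsz)
      set ω := ‖z - x‖⁻¹
      have h7 := (abs_le.1 (h4 z (hdom hz))).1
      have h8 := (abs_le.1 (h4 _ (hdom hz'))).2
      have h9 : β * ρ⁻¹ ^ N ≤ V z := by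
        have := hβ z (by rw [hzρ, hρ]; linarith [norm_nonneg x])
        rw [hzρ] at this
        rw [inv_pow, ← div_eq_mul_inv, div_le_iff₀ (by positivity)]
        exact this
      have h10 : V (inv x l z) ≤ V x + L * l₁ ^ 2 * s⁻¹ := by
        have h11 := (abs_le.1 (hV.lip (inv x l z) x)).2
        have h12 : L * ‖inv x l z - x‖ ≤ L * l₁ ^ 2 * s⁻¹ := by
          rw [hin, mul_assoc L]; gcongr
        linarith
      have h11 : (l * ω) ^ N ≤ (l₁ * s⁻¹) ^ N := by gcongr
      have h12 : (l * ω) ^ N ≤ 1 := pow_le_one₀ (by positivity) hτ1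
      have h13 : (l * ω) ^ N * v i (inv x l z) ≤
          (l₁ * s⁻¹) ^ N * (V x + L * l₁ ^ 2 * s⁻¹) + m / 4 := by
        have := hV.pos (inv x l z)
        calc (l * ω) ^ N * v i (inv x l z) ≤ (l * ω) ^ N * (V (inv x l z) + m / 4) := by
              gcongr; linarith
          _ = (l * ω) ^ N * V (inv x l z) + (l * ω) ^ N * (m / 4) := by ring
          _ ≤ (l₁ * s⁻¹) ^ N * (V x + L * l₁ ^ 2 * s⁻¹) + 1 * (m / 4) := by gcongr
          _ = _ := by ring
      have h14 : -(m / 4) < barrier N 0 (σ * η) η l ω := by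
        have h15 : η * (1 / l - ω) ≤ η * (1 / l₀) := by
          gcongr
          have : 1 / l ≤ 1 / l₀ := by gcongr
          linarith
        have h16 : η * (1 / l₀) < m / 4 := by
          rw [mul_one_div, div_lt_iff₀ hl₀]; linarith
        have h17 : 0 < σ * η * ω ^ N := by positivity
        rw [barrier]; linarith
      rw [kelvin_eq]
      linarith
    · intro l hl0 hl1 z hz hlz heq
      have hl : 0 < l := hl₀.trans_le hl0
      have hzb := hdomI hz
      have hz' := hdomI (hball (hinvball l hl hl1 z hlz.le))
      have hτ1 := mul_norm_inv_le_one hl hlz.le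
      have hr0 : 0 < ‖z - x‖ := hl.trans hlz
      have hωw : w ≤ ‖z - x‖⁻¹ := by
        rw [hw]; gcongr
        exact (norm_sub_le _ _).trans (by have := hz.1; linarith)
      have hωl : ‖z - x‖⁻¹ ≤ l₀⁻¹ := by gcongr; linarith
      set ω := ‖z - x‖⁻¹ with hω
      have hω0 : 0 < ω := by positivity
      obtain ⟨_, h7, h8, h9⟩ := h3 _ hz'
      obtain ⟨_, h7', h8', h9'⟩ := h3 _ hzb
      have hap : (l * ω) ^ (N + 4) * v i (inv x l z) ^ p = kelvin x l (v i) z ^ p := by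
        rw [kelvin_eq, Real.mul_rpow (by positivity) h8.le, ← Real.rpow_natCast _ N,
          ← Real.rpow_mul (by positivity), ← Real.rpow_natCast _ (N + 4)]
        congr 2
        rw [hp]; push_cast; field_simp
      have ha0 : 0 ≤ kelvin x l (v i) z := by rw [kelvin_eq]; positivity
      have ha1 : kelvin x l (v i) z ≤ 1 := by
        rw [kelvin_eq]
        exact mul_le_one₀ (pow_le_one₀ (by positivity) hτ1) h8.le h9
      set a := kelvin x l (v i) z
      have htan := rpow_tangent (p := p) (a := a) (c := v i z)
        (by have : 0 < 4 / (N : ℝ) := by positivity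
            linarith) ha0 h8'.le
      have hab : a - v i z ≤ σ * η * l₀⁻¹ ^ N := by
        have h10 : 0 ≤ η * (1 / l - ω) := by
          have : 0 ≤ 1 / l - ω := by
            rw [sub_nonneg, le_div_iff₀ hl]; linarith
          positivity
        have h11 : σ * η * ω ^ N ≤ σ * η * l₀⁻¹ ^ N := by gcongr
        rw [heq, barrier]
        linarith
      have h10 : k i z * (a ^ p - v i z ^ p) ≤ η * w ^ 3 / 4 := by
        have h11 : a ^ (p - 1) ≤ 1 := Real.rpow_le_one ha0 ha1 (by rw [hp, add_sub_cancel_left]; positivity)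
        have h12 : 0 ≤ a ^ (p - 1) := Real.rpow_nonneg ha0 _
        have h13 := hr.k_pos z h7'
        calc k i z * (a ^ p - v i z ^ p) ≤ k i z * (p * a ^ (p - 1) * (σ * η * l₀⁻¹ ^ N)) := by
              gcongr; exact htan.trans (by gcongr)
          _ ≤ C * (p * 1 * (σ * η * l₀⁻¹ ^ N)) := by
              gcongr; exact hr.k_le z h7'
          _ = _ := by rw [hσ]; field_simp
      have h11 : (k i (inv x l z) - k i z) * a ^ p ≤ η * w ^ 3 / 4 := by
        have h12 := (le_abs_self _).trans (h5 _ hz' z hzb)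
        have h13 : a ^ p ≤ 1 := Real.rpow_le_one ha0 ha1 hp0.le
        have h14 : 0 ≤ a ^ p := Real.rpow_nonneg ha0 _
        rw [lt_div_iff₀ (by positivity)] at h6
        calc _ ≤ B * ε i * a ^ p := by gcongr
          _ ≤ B * ε i * 1 := by gcongr
          _ ≤ _ := by linarith
      have h12 : η * w ^ 3 ≤ η * (N - 1) * ω ^ 3 := by
        have h13 : (1:ℝ) ≤ N - 1 := by
          have : (2:ℝ) ≤ N := by exact_mod_cast h.two_le
          linarith
        calc η * w ^ 3 = η * 1 * w ^ 3 := by ring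
          _ ≤ _ := by gcongr
      have h13 : 0 < η * w ^ 3 := by positivity
      rw [mul_neg, mul_left_comm, hap, zero_mul, zero_mul, zero_add]
      linarith
    · intro l _ _ z hz _ hzT
      have h7 := (abs_le.1 (PiLp.norm_apply_le z ℓ)).1
      have := hz.1
      rw [hzT] at h7
      linarith [h7.trans' (neg_le_neg this)]
    · have h7 := (abs_le.1 (PiLp.norm_apply_le y ℓ)).1
      have h8 : ‖y‖ ≤ ρ := by rw [hρ]; linarith [norm_nonneg x]
      exact ⟨h8, by linarith⟩
  have h1 : ∀ η ∈ Ioo 0 η₀, 0 ≤ V y - kelvin x l₁ V y + barrier N 0 (σ * η) η l₁ ‖y - x‖⁻¹ := by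
    intro η hη
    refine ge_of_tendsto (((hV.tendsto y).sub ((hV.tendsto _).const_mul _)).add_const _)
      ((key η hη).mono fun i hi => hi.le)
  have h2 : Tendsto (fun η => V y - kelvin x l₁ V y + barrier N 0 (σ * η) η l₁ ‖y - x‖⁻¹) (𝓝[>] 0)
      (𝓝 (V y - kelvin x l₁ V y + barrier N 0 (σ * 0) 0 l₁ ‖y - x‖⁻¹)) := by
    refine (Continuous.tendsto ?_ 0).mono_left nhdsWithin_le_nhds
    unfold barrier
    fun_prop
  have h3 : 0 ≤ V y - kelvin x l₁ V y + barrier N 0 (σ * 0) 0 l₁ ‖y - x‖⁻¹ := by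
    refine ge_of_tendsto h2 ?_
    filter_upwards [Ioo_mem_nhdsGT hη₀0] with η hη using h1 η hη
  simp [barrier] at h3
  linarith

end BlowupSeq

end

section

variable {n N : ℕ}

/-- The Green's function of the exterior of a ball. -/
def extGreen (l : ℝ) (y₀ y : Euc (N + 2)) : ℝ :=
  ‖y - y₀‖⁻¹ ^ N - (l * ‖y₀‖⁻¹) ^ N * ‖y - (l * ‖y₀‖⁻¹) ^ 2 • y₀‖⁻¹ ^ N

lemma hasLap_extGreen {l : ℝ} {y₀ y : Euc (N + 2)} (hl : 0 < l) (h0 : l < ‖y₀‖) (hy : l ≤ ‖y‖)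
    (hyy : y ≠ y₀) : HasLap (extGreen l y₀) y 0 := by
  have h00 : 0 < ‖y₀‖ := hl.trans h0
  have hne : y ≠ (l * ‖y₀‖⁻¹) ^ 2 • y₀ := by
    rintro rfl
    rw [norm_smul, Real.norm_eq_abs, abs_of_nonneg (by positivity)] at hy
    have : (l * ‖y₀‖⁻¹) ^ 2 * ‖y₀‖ = l * (l * ‖y₀‖⁻¹) := by field_simp
    rw [this] at hy
    have : l * ‖y₀‖⁻¹ < 1 := by rwa [← div_eq_mul_inv, div_lt_one h00]
    nlinarith
  have := (hasLap_normInv_pow N y₀ y hyy).sub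
    ((hasLap_normInv_pow N _ y hne).const_mul ((l * ‖y₀‖⁻¹) ^ N))
  convert this using 1
  · rfl
  · push_cast
    ring

lemma extGreen_eq_zero {l : ℝ} {y₀ y : Euc (N + 2)} (hl : 0 < l) (h0 : l < ‖y₀‖) (hy : ‖y‖ = l) :
    extGreen l y₀ y = 0 := by
  have h00 : 0 < ‖y₀‖ := hl.trans h0
  have h1 : ‖y - (l * ‖y₀‖⁻¹) ^ 2 • y₀‖ = l * ‖y₀‖⁻¹ * ‖y - y₀‖ := by
    rw [← sq_eq_sq₀ (by positivity) (by positivity),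
      mul_pow (l * ‖y₀‖⁻¹) ‖y - y₀‖ 2, norm_sub_sq_real, norm_sub_sq_real,
      inner_smul_right, norm_smul, hy, Real.norm_eq_abs, abs_of_nonneg (by positivity)]
    field_simp
    ring
  have h2 : l * ‖y₀‖⁻¹ ≠ 0 := by positivity
  rw [extGreen, h1, mul_inv, ← mul_pow, ← mul_assoc, mul_inv_cancel₀ h2, one_mul, sub_self]

lemma extGreen_le {l : ℝ} {y₀ y : Euc (N + 2)} (hl : 0 < l) :
    extGreen l y₀ y ≤ ‖y - y₀‖⁻¹ ^ N := by
  have : 0 ≤ (l * ‖y₀‖⁻¹) ^ N * ‖y - (l * ‖y₀‖⁻¹) ^ 2 • y₀‖⁻¹ ^ N := by positivity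
  rw [extGreen]; linarith

lemma continuousOn_extGreen {l : ℝ} {y₀ : Euc (N + 2)} (hl : 0 < l) (h0 : l < ‖y₀‖)
    {D : Set (Euc (N + 2))} (hD : ∀ y ∈ D, l ≤ ‖y‖ ∧ y ≠ y₀) :
    ContinuousOn (extGreen l y₀) D := by
  intro y hy
  obtain ⟨h1, h2⟩ := hD y hy
  have h00 : 0 < ‖y₀‖ := hl.trans h0
  have hne : y - (l * ‖y₀‖⁻¹) ^ 2 • y₀ ≠ 0 := by
    rw [sub_ne_zero]
    rintro rfl
    rw [norm_smul, Real.norm_eq_abs, abs_of_nonneg (by positivity)] at h1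
    have : (l * ‖y₀‖⁻¹) ^ 2 * ‖y₀‖ = l * (l * ‖y₀‖⁻¹) := by field_simp
    rw [this] at h1
    have : l * ‖y₀‖⁻¹ < 1 := by rwa [← div_eq_mul_inv, div_lt_one h00]
    nlinarith
  refine ContinuousAt.continuousWithinAt ?_
  unfold extGreen
  have h3 := norm_ne_zero_iff.2 (sub_ne_zero.2 h2)
  have h4 := norm_ne_zero_iff.2 hne
  fun_prop (disch := assumption)

namespace BlowupSeq

variable {ℓ : Fin (N + 2)} {C : ℝ} {F : Ultrafilter ℕ} {v k : ℕ → Euc (N + 2) → ℝ}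
  {q : ℕ → Euc (N + 2)} {g ε T R A : ℕ → ℝ}

lemma sub_kelvin_ge (h : BlowupSeq ℓ C F v k q g ε T R A) {L : ℝ} {V : Euc (N + 2) → ℝ}
    (hV : BlowupLim F v L V) {l a μ ρ : ℝ} {y₀ : Euc (N + 2)} (hl : 0 < l) (h0 : l < ‖y₀‖)
    (ha : 0 < a) (hμ : 0 ≤ μ) (hρ : ‖y₀‖ < ρ)
    (hk : ∀ y, l ≤ ‖y‖ → kelvin 0 l V y ≤ V y)
    (hμ' : ∀ y, ‖y - y₀‖ ≤ a → μ ≤ V y - kelvin 0 l V y) {y : Euc (N + 2)}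
    (hly : l ≤ ‖y‖) (hyρ : ‖y‖ ≤ ρ) (hay : a ≤ ‖y - y₀‖) :
    μ * a ^ N * (extGreen l y₀ y - (ρ - ‖y₀‖)⁻¹ ^ N) ≤ V y - kelvin 0 l V y := by
  have hNp := h.N_pos
  have hρ0 : 0 < ρ := (hl.trans h0).trans hρ
  have hlρ : l < ρ := h0.trans hρ
  set p := 1 + 4 / (N : ℝ) with hp
  have hp0 : 0 < p := by positivity
  set D : Set (Euc (N + 2)) := {y | l ≤ ‖y‖ ∧ ‖y‖ ≤ ρ ∧ a ≤ ‖y - y₀‖} with hD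
  set U : Set (Euc (N + 2)) := {y | l < ‖y‖ ∧ ‖y‖ < ρ ∧ a < ‖y - y₀‖} with hU
  have hDc : IsCompact D := by
    refine (isCompact_closedBall (0 : Euc (N + 2)) ρ).of_isClosed_subset ?_
      (fun y hy => by simpa using hy.2.1)
    exact (isClosed_le continuous_const continuous_norm).inter
      ((isClosed_le continuous_norm continuous_const).inter
        (isClosed_le continuous_const (continuous_id.sub continuous_const).norm))
  have hUo : IsOpen U :=
    (isOpen_lt continuous_const continuous_norm).inter
      ((isOpen_lt continuous_norm continuous_const).inter
        (isOpen_lt continuous_const (continuous_id.sub continuous_const).norm))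
  have hUD : U ⊆ D := fun y hy => ⟨hy.1.le, hy.2.1.le, hy.2.2.le⟩
  have hDne : ∀ y ∈ D, l ≤ ‖y‖ ∧ y ≠ y₀ := fun y hy => ⟨hy.1, fun h => by
    have := hy.2.2
    rw [h, sub_self, norm_zero] at this
    linarith⟩
  have hinv : ∀ y ∈ D, inv 0 l y ∈ closedBall (0 : Euc (N + 2)) ρ ∧ l * ‖y - 0‖⁻¹ ≤ 1 := by
    intro y hy
    have hy' : l ≤ ‖y - 0‖ := by rw [sub_zero]; exact hy.1
    refine ⟨?_, mul_norm_inv_le_one hl hy'⟩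
    rw [mem_closedBall, dist_eq_norm]
    exact (norm_inv_sub_le hl hy').trans hlρ.le
  have hkd : ∀ δ > 0, ∀ᶠ i in F, ∀ y ∈ D,
      |(v i y - kelvin 0 l (v i) y) - (V y - kelvin 0 l V y)| ≤ δ := by
    intro δ hδ
    filter_upwards [hV.unif ρ (δ / 2) (by positivity)] with i hi y hy
    obtain ⟨h1, h2⟩ := hinv y hy
    have h3 := hi y (by simpa using hy.2.1)
    have h4 := hi _ h1
    have h5 : |(l * ‖y - 0‖⁻¹) ^ N * (v i (inv 0 l y) - V (inv 0 l y))| ≤ 1 * (δ / 2) := by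
      rw [abs_mul, abs_of_nonneg (by positivity)]
      gcongr
      exact pow_le_one₀ (by positivity) h2
    rw [kelvin_eq, kelvin_eq]
    rw [abs_le] at *
    constructor <;> nlinarith
  set m := μ * a ^ N with hm
  have hm0 : 0 ≤ m := by positivity
  have hGc : ContinuousOn (extGreen l y₀) D := continuousOn_extGreen hl h0 hDne
  have := limit_comparison (n := N + 2) (by omega) (F := (F : Filter ℕ)) (A := D) (U := U)
    (W := fun i y => v i y - kelvin 0 l (v i) y - m * extGreen l y₀ y + m * (ρ - ‖y₀‖)⁻¹ ^ N)
    (w := fun y => V y - kelvin 0 l V y - m * extGreen l y₀ y + m * (ρ - ‖y₀‖)⁻¹ ^ N)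
    hDc hUo hUD ?_ ?_ ?_ ?_ y ⟨hly, hyρ, hay⟩
  · linarith
  · filter_upwards [h.eventually_mem ρ] with i hi
    have h1 : ContinuousOn (v i) (closedBall 0 ρ) :=
      (h.resc i).cont.mono (fun y hy => (hi y hy).2.1)
    have h2 := continuousOn_kelvin (n := N + 2) (x := 0) (l₁ := l) h1
      (closedBall_subset_closedBall hlρ.le)
    have h3 : ContinuousOn (kelvin 0 l (v i)) D :=
      h2.comp (f := fun y => (l, y)) (by fun_prop)
        (fun y hy => ⟨hl, le_rfl, by simpa using hy.1⟩)
    have h4 : ContinuousOn (v i) D := h1.mono fun y hy => by simpa using hy.2.1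
    fun_prop
  · intro δ hδ
    have hC := h.one_le
    obtain ⟨B, hB, hkB⟩ := h.eventually_k_sub hρ0.le
    filter_upwards [h.eventually_mem ρ, hkB, hkd (δ / (2 * (C * p))) (by positivity),
      h.ε_lim.eventually_lt_const (show 0 < δ / (2 * (B + 1)) by positivity)]
      with i h1 h2 h3 h4 y hy
    have hr := h.resc i
    have hε := hr.ε_pos
    have hyD := hUD hy
    obtain ⟨h5, h6⟩ := hinv y hyD
    have hyb : y ∈ closedBall (0 : Euc (N + 2)) ρ := by simpa using hyD.2.1
    obtain ⟨hz1, hz2, hz3, hz4⟩ := h1 _ h5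
    obtain ⟨hy1, hy2, hy3, hy4⟩ := h1 _ hyb
    have hy0 : y ≠ 0 := by
      rintro rfl
      have := hyD.1
      rw [norm_zero] at this; linarith
    refine ⟨_, ?_, (((hr.eqn y hy1).sub (hasLap_kelvin hl hy0 (hr.smooth _ hz1)
      (hr.eqn _ hz1))).sub ((hasLap_extGreen hl h0 hyD.1 (hDne y hyD).2).const_mul m)).add
      (HasLap.const _)⟩
    have h7 := (abs_le.1 (h3 y hyD)).1
    have h8 := hk y hyD.1
    have hω0 : 0 ≤ ‖y - 0‖⁻¹ := by positivity
    set ω := ‖y - 0‖⁻¹ with hω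
    have hap : (l * ω) ^ (N + 4) * v i (inv 0 l y) ^ p = kelvin 0 l (v i) y ^ p := by
      rw [kelvin_eq, Real.mul_rpow (by positivity) hz3.le, ← Real.rpow_natCast _ N,
        ← Real.rpow_mul (by positivity), ← Real.rpow_natCast _ (N + 4)]
      congr 2
      rw [hp]; push_cast; field_simp
    have ha0 : 0 ≤ kelvin 0 l (v i) y := by rw [kelvin_eq]; positivity
    have ha1 : kelvin 0 l (v i) y ≤ 1 := by
      rw [kelvin_eq]
      exact mul_le_one₀ (pow_le_one₀ (by positivity) h6) hz3.le hz4
    set b := kelvin 0 l (v i) y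
    have htan := rpow_tangent (p := p) (a := b) (c := v i y)
      (by have : 0 < 4 / (N : ℝ) := by positivity
          linarith) ha0 hy3.le
    have h9 : b ^ (p - 1) ≤ 1 :=
      Real.rpow_le_one ha0 ha1 (by rw [hp, add_sub_cancel_left]; positivity)
    have h10 : 0 ≤ b ^ (p - 1) := Real.rpow_nonneg ha0 _
    have h11 : k i y * (b ^ p - v i y ^ p) ≤ δ / 2 := by
      have h13 := hr.k_pos y hy2
      calc k i y * (b ^ p - v i y ^ p) ≤ k i y * (p * b ^ (p - 1) * (δ / (2 * (C * p)))) := by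
            gcongr
            exact htan.trans (by gcongr; linarith)
        _ ≤ C * (p * 1 * (δ / (2 * (C * p)))) := by
            gcongr; exact hr.k_le y hy2
        _ = _ := by field_simp
    have h12 : (k i (inv 0 l y) - k i y) * b ^ p ≤ δ / 2 := by
      have h12 := (le_abs_self _).trans (h2 _ h5 y hyb)
      have h13 : b ^ p ≤ 1 := Real.rpow_le_one ha0 ha1 hp0.le
      have h14 : 0 ≤ b ^ p := Real.rpow_nonneg ha0 _
      rw [lt_div_iff₀ (by positivity)] at h4
      calc _ ≤ B * ε i * b ^ p := by gcongr
        _ ≤ B * ε i * 1 := by gcongr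
        _ ≤ _ := by linarith
    rw [mul_neg, mul_left_comm, hap]
    linarith
  · intro δ hδ
    filter_upwards [hkd δ hδ] with i hi y hy
    have := hi y hy
    convert this using 2
    ring
  · rintro y ⟨hy, hyU⟩
    have hρ' : 0 < (ρ - ‖y₀‖)⁻¹ := inv_pos.2 (sub_pos.2 hρ)
    have h1 : 0 ≤ m * (ρ - ‖y₀‖)⁻¹ ^ N := by positivity
    have h2 := hk y hy.1
    by_cases hyl : ‖y‖ = l
    · rw [extGreen_eq_zero hl h0 hyl]
      linarith
    by_cases hyr : ‖y‖ = ρ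
    · have h3 : extGreen l y₀ y ≤ (ρ - ‖y₀‖)⁻¹ ^ N := by
        refine (extGreen_le hl).trans ?_
        have h4 := norm_sub_norm_le y y₀
        rw [hyr] at h4
        have := sub_pos.2 hρ
        gcongr
      have := mul_le_mul_of_nonneg_left h3 hm0
      linarith
    have hya : ‖y - y₀‖ = a := by
      by_contra hne
      exact hyU ⟨lt_of_le_of_ne hy.1 (Ne.symm hyl), lt_of_le_of_ne hy.2.1 hyr,
        lt_of_le_of_ne hy.2.2 (Ne.symm hne)⟩
    have h3 := hμ' y hya.le
    have h4 : m * extGreen l y₀ y ≤ μ := by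
      calc m * extGreen l y₀ y ≤ m * ‖y - y₀‖⁻¹ ^ N := by gcongr; exact extGreen_le hl
        _ = μ := by rw [hya, hm, mul_assoc, ← mul_pow, mul_inv_cancel₀ ha.ne']; simp
    linarith

end BlowupSeq

end

section

variable {n N : ℕ}

namespace BlowupSeq

variable {ℓ : Fin (N + 2)} {C : ℝ} {F : Ultrafilter ℕ} {v k : ℕ → Euc (N + 2) → ℝ}
  {q : ℕ → Euc (N + 2)} {g ε T R A : ℕ → ℝ}

lemma sub_kelvin_ge' (h : BlowupSeq ℓ C F v k q g ε T R A) {L : ℝ} {V : Euc (N + 2) → ℝ}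
    (hV : BlowupLim F v L V) {l a μ : ℝ} {y₀ : Euc (N + 2)} (hl : 0 < l) (h0 : l < ‖y₀‖)
    (ha : 0 < a) (hμ : 0 ≤ μ) (hk : ∀ y, l ≤ ‖y‖ → kelvin 0 l V y ≤ V y)
    (hμ' : ∀ y, ‖y - y₀‖ ≤ a → μ ≤ V y - kelvin 0 l V y) {y : Euc (N + 2)}
    (hly : l ≤ ‖y‖) (hay : a ≤ ‖y - y₀‖) :
    μ * a ^ N * extGreen l y₀ y ≤ V y - kelvin 0 l V y := by
  have hNp := h.N_pos
  have h1 : Tendsto (fun ρ : ℝ => (ρ - ‖y₀‖)⁻¹ ^ N) atTop (𝓝 0) := by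
    have := (tendsto_inv_atTop_zero.comp (tendsto_atTop_add_const_right atTop (-‖y₀‖)
      (tendsto_id (α := ℝ)))).pow N
    rw [zero_pow (Nat.cast_pos.1 hNp).ne'] at this
    exact this
  have h2 := (h1.const_sub (extGreen l y₀ y)).const_mul (μ * a ^ N)
  rw [sub_zero] at h2
  refine le_of_tendsto h2 ?_
  filter_upwards [eventually_gt_atTop ‖y₀‖, eventually_ge_atTop ‖y‖] with ρ h3 h4
  exact h.sub_kelvin_ge hV hl h0 ha hμ h3 hk hμ' hly h4 hay

lemma exists_tail_gt (h : BlowupSeq ℓ C F v k q g ε T R A) {L : ℝ} {V : Euc (N + 2) → ℝ}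
    (hV : BlowupLim F v L V) {l : ℝ} {y₀ : Euc (N + 2)} (hl : 0 < l) (h0 : l < ‖y₀‖)
    (hk : ∀ y, l ≤ ‖y‖ → kelvin 0 l V y ≤ V y) (hy₀ : kelvin 0 l V y₀ < V y₀) :
    ∃ β > l ^ N, ∃ X, ∀ y, X ≤ ‖y‖ → β ≤ V y * ‖y‖ ^ N := by
  have hN := (Nat.cast_pos.1 h.N_pos).ne'
  have h00 : 0 < ‖y₀‖ := hl.trans h0
  set μ := (V y₀ - kelvin 0 l V y₀) / 2 with hμ
  have hμ0 : 0 < μ := by rw [hμ]; linarith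
  obtain ⟨a, ha, hμ'⟩ : ∃ a > 0, ∀ y, ‖y - y₀‖ ≤ a → μ ≤ V y - kelvin 0 l V y := by
    have hc : ContinuousAt (fun y => V y - kelvin 0 l V y) y₀ := by
      have h1 : ContinuousAt (fun y : Euc (N + 2) => ‖y - 0‖⁻¹) y₀ := by
        have : ‖y₀ - 0‖ ≠ 0 := by rw [sub_zero]; exact h00.ne'
        fun_prop (disch := assumption)
      have h2 : ContinuousAt (fun y : Euc (N + 2) => inv 0 l y) y₀ := by
        unfold inv
        fun_prop
      have h3 : ContinuousAt (fun y => V (inv 0 l y)) y₀ :=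
        ContinuousAt.comp hV.continuous.continuousAt h2
      have h4 := hV.continuous.continuousAt (x := y₀)
      simp only [kelvin_eq]
      exact h4.sub (((h1.const_mul l).pow N).mul h3)
    have := hc.eventually_const_le (show μ < _ by rw [hμ]; linarith)
    obtain ⟨a, ha, h1⟩ := Metric.eventually_nhds_iff.1 this
    refine ⟨a / 2, by positivity, fun y hy => h1 ?_⟩
    rw [dist_eq_norm]; linarith
  set m := μ * a ^ N with hm
  have hm0 : 0 < m := by positivity
  set α := l * ‖y₀‖⁻¹ with hα
  have hα0 : 0 < α := by positivity
  have hα1 : α < 1 := by rwa [hα, ← div_eq_mul_inv, div_lt_one h00]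
  set f : ℝ → ℝ := fun t => l ^ N * (1 - L * (l ^ 2 * t)) +
    m * ((1 + ‖y₀‖ * t)⁻¹ ^ N - α ^ N * (1 - l * t)⁻¹ ^ N) with hf
  have hf0 : f 0 = l ^ N + m * (1 - α ^ N) := by simp [hf]
  have hκ : 0 < m * (1 - α ^ N) :=
    mul_pos hm0 (sub_pos.2 (pow_lt_one₀ hα0.le hα1 hN))
  have hfc : ContinuousAt f 0 := by
    have h1 : 1 + ‖y₀‖ * (0:ℝ) ≠ 0 := by simp
    have h2 : 1 - l * (0:ℝ) ≠ 0 := by simp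
    rw [hf]
    fun_prop (disch := assumption)
  obtain ⟨t₀, ht₀, hft⟩ := Metric.eventually_nhds_iff.1
    (hfc.eventually_const_le (show l ^ N + m * (1 - α ^ N) / 2 < f 0 by rw [hf0]; linarith))
  refine ⟨_, by linarith, max (2 * l) (max (2 * t₀⁻¹) (‖y₀‖ + a)), fun y hy => (hft (y := ‖y‖⁻¹) ?_).trans ?_⟩
  · have h1 : 2 * t₀⁻¹ ≤ ‖y‖ := (le_max_left _ _).trans ((le_max_right _ _).trans hy)
    rw [Real.dist_eq, sub_zero, abs_of_nonneg (by positivity)]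
    have h2 : t₀⁻¹ < ‖y‖ := by have : 0 < t₀⁻¹ := by positivity
                               linarith
    exact inv_lt_of_inv_lt₀ ht₀ h2
  have h1 : 2 * l ≤ ‖y‖ := (le_max_left _ _).trans hy
  have h2 : ‖y₀‖ + a ≤ ‖y‖ := (le_max_right _ _).trans ((le_max_right _ _).trans hy)
  have hy0 : 0 < ‖y‖ := by linarith
  have h3 := norm_sub_norm_le y y₀
  have h4 : a ≤ ‖y - y₀‖ := by linarith
  have h5 := h.sub_kelvin_ge' hV hl h0 ha hμ0.le hk hμ' (y := y) (by linarith) h4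
  have hyz : y ≠ 0 := norm_pos_iff.1 hy0
  have h6 : l ^ N * (1 - L * (l ^ 2 * ‖y‖⁻¹)) ≤ kelvin 0 l V y * ‖y‖ ^ N := by
    have h7 := (abs_le.1 (hV.lip (inv 0 l y) 0)).1
    rw [norm_inv_sub hyz, hV.zero, sub_zero] at h7
    rw [kelvin_eq, sub_zero, mul_pow, mul_right_comm, mul_assoc (l ^ N), ← mul_pow,
      inv_mul_cancel₀ hy0.ne', one_pow, mul_one]
    gcongr
    linarith
  have h8 : (1 + ‖y₀‖ * ‖y‖⁻¹)⁻¹ ^ N - α ^ N * (1 - l * ‖y‖⁻¹)⁻¹ ^ N ≤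
      extGreen l y₀ y * ‖y‖ ^ N := by
    have h9 : l * ‖y‖⁻¹ < 1 := by rw [← div_eq_mul_inv, div_lt_one hy0]; linarith
    have h10 : ‖α ^ 2 • y₀‖ ≤ l := by
      rw [norm_smul, Real.norm_eq_abs, abs_of_nonneg (by positivity)]
      have : α ^ 2 * ‖y₀‖ = l * α := by rw [hα]; field_simp
      rw [this]; nlinarith
    have h11 := norm_sub_norm_le y (α ^ 2 • y₀)
    have h12 := norm_sub_le y y₀
    have h13 : 0 < ‖y - α ^ 2 • y₀‖ := by linarith
    have h14 : 0 < ‖y - y₀‖ := by linarith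
    have he : extGreen l y₀ y * ‖y‖ ^ N =
        (‖y - y₀‖⁻¹ * ‖y‖) ^ N - α ^ N * (‖y - α ^ 2 • y₀‖⁻¹ * ‖y‖) ^ N := by
      rw [extGreen, mul_pow _ ‖y‖, mul_pow _ ‖y‖]
      ring
    rw [he]
    have h15 : (1 + ‖y₀‖ * ‖y‖⁻¹)⁻¹ ≤ ‖y - y₀‖⁻¹ * ‖y‖ := by
      rw [inv_mul_eq_div, inv_le_iff_one_le_mul₀ (by positivity)]
      have : ‖y‖ / ‖y - y₀‖ * (1 + ‖y₀‖ * ‖y‖⁻¹) = (‖y‖ + ‖y₀‖) / ‖y - y₀‖ := by field_simp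
      rw [this, one_le_div h14]; exact h12
    have h16 : ‖y - α ^ 2 • y₀‖⁻¹ * ‖y‖ ≤ (1 - l * ‖y‖⁻¹)⁻¹ := by
      rw [inv_mul_eq_div, le_inv_comm₀ (by positivity) (by linarith), inv_div,
        le_div_iff₀ hy0]
      have : (1 - l * ‖y‖⁻¹) * ‖y‖ = ‖y‖ - l := by field_simp
      rw [this]; linarith
    gcongr
  have h17 := mul_le_mul_of_nonneg_right h5 (show 0 ≤ ‖y‖ ^ N by positivity)
  have h18 := mul_le_mul_of_nonneg_left h8 hm0.le
  simp only [hf]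
  nlinarith

lemma decay (h : BlowupSeq ℓ C F v k q g ε T R A) {V : Euc (N + 2) → ℝ}
    (hV : BlowupLim F v (lip N C) V) {c : ℝ} (hc : 0 < c) (hlow : ∀ y, c * (1 + ‖y‖)⁻¹ ^ N ≤ V y) :
    ∃ B > 0, ∀ y, V y ≤ B * (1 + ‖y‖)⁻¹ ^ N := by
  have hN := (Nat.cast_pos.1 h.N_pos).ne'
  set S : Set ℝ := {B | 0 < B ∧ ∃ X, ∀ y, X ≤ ‖y‖ → B ≤ V y * ‖y‖ ^ N} with hS
  have hSne : c * (2⁻¹) ^ N ∈ S := by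
    refine ⟨by positivity, 1, fun y hy => ?_⟩
    have h1 : (2:ℝ)⁻¹ ≤ (1 + ‖y‖)⁻¹ * ‖y‖ := by
      rw [inv_mul_eq_div, le_div_iff₀ (by positivity)]; linarith
    calc c * 2⁻¹ ^ N ≤ c * ((1 + ‖y‖)⁻¹ * ‖y‖) ^ N := by gcongr
      _ = c * (1 + ‖y‖)⁻¹ ^ N * ‖y‖ ^ N := by rw [mul_pow]; ring
      _ ≤ _ := by gcongr; exact hlow y
  have hSb : BddAbove S := by
    by_contra hS'
    refine h.false_of_kelvin_le hV fun x l hl y hy => ?_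
    obtain ⟨B, ⟨_, X, hX⟩, hB⟩ := not_bddAbove_iff.1 hS' (l ^ N * V x)
    exact h.kelvin_le_of_lt hV hl hX hB hy
  set β := sSup S with hβ
  have hβ0 : 0 < β := hSne.1.trans_le (le_csSup hSb hSne)
  obtain ⟨l, hl, hlβ⟩ : ∃ l > 0, l ^ N = β :=
    ⟨β ^ (N:ℝ)⁻¹, by positivity, Real.rpow_inv_natCast_pow hβ0.le hN⟩
  have hk : ∀ y, l ≤ ‖y‖ → kelvin 0 l V y ≤ V y := by
    intro y hy
    have h1 : ∀ s ∈ Ioo 0 l, kelvin 0 s V y ≤ V y := by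
      intro s hs
      have h2 : s ^ N < β := by rw [← hlβ]; exact pow_lt_pow_left₀ hs.2 hs.1.le hN
      obtain ⟨B, ⟨_, X, hX⟩, hB⟩ := exists_lt_of_lt_csSup ⟨_, hSne⟩ h2
      exact h.kelvin_le_of_lt hV hs.1 hX (by rwa [hV.zero, mul_one])
        (by rw [sub_zero]; linarith [hs.2])
    have h2 : Continuous fun s => kelvin 0 s V y := by
      have := hV.continuous
      simp only [kelvin_eq, inv]
      fun_prop
    refine le_of_tendsto (h2.continuousAt.mono_left nhdsWithin_le_nhds : Tendsto _ (𝓝[<] l) _) ?_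
    filter_upwards [Ioo_mem_nhdsLT hl] using h1
  have heq : ∀ y, l < ‖y‖ → V y ≤ kelvin 0 l V y := by
    by_contra! hne
    obtain ⟨y₀, h0, hy₀⟩ := hne
    obtain ⟨b, hb, X, hX⟩ := h.exists_tail_gt hV hl h0 hk hy₀
    have : b ≤ β := le_csSup hSb ⟨by rw [hlβ] at hb; linarith, X, hX⟩
    rw [hlβ] at hb
    linarith
  refine ⟨(1 + l) ^ N, by positivity, fun y => ?_⟩
  rw [← mul_pow]
  rcases le_or_gt ‖y‖ l with hy | hy
  · refine (hV.le_one y).trans (one_le_pow₀ ?_)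
    rw [← div_eq_mul_inv, one_le_div (by positivity)]
    linarith
  · refine (heq y hy).trans ?_
    have hy0 : 0 < ‖y‖ := hl.trans hy
    rw [kelvin_eq, sub_zero]
    calc (l * ‖y‖⁻¹) ^ N * V (inv 0 l y) ≤ (l * ‖y‖⁻¹) ^ N * 1 := by gcongr; exact hV.le_one _
      _ = (l * ‖y‖⁻¹) ^ N := mul_one _
      _ ≤ _ := by
        refine pow_le_pow_left₀ (by positivity) ?_ N
        rw [← div_eq_mul_inv, ← div_eq_mul_inv, div_le_div_iff₀ hy0 (by positivity)]
        nlinarith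

end BlowupSeq

end

section

variable {n N : ℕ}

lemma kelvin_rpow_one_add {x y : Euc (N + 2)} {l : ℝ} {v : Euc (N + 2) → ℝ} (hN : N ≠ 0)
    (hl : 0 ≤ l) (hv : 0 ≤ v (inv x l y)) :
    kelvin x l v y ^ (1 + 4 / (N : ℝ)) =
      (l * ‖y - x‖⁻¹) ^ (N + 4) * v (inv x l y) ^ (1 + 4 / (N : ℝ)) := by
  rw [kelvin_eq, Real.mul_rpow (by positivity) hv, ← Real.rpow_natCast _ N,
    ← Real.rpow_mul (by positivity), ← Real.rpow_natCast _ (N + 4)]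
  congr 2
  push_cast; field_simp

lemma kelvin_rpow {x y : Euc (N + 2)} {l : ℝ} {v : Euc (N + 2) → ℝ} (hN : N ≠ 0)
    (hl : 0 ≤ l) (hv : 0 ≤ v (inv x l y)) :
    kelvin x l v y ^ (4 / (N : ℝ)) = (l * ‖y - x‖⁻¹) ^ 4 * v (inv x l y) ^ (4 / (N : ℝ)) := by
  rw [kelvin_eq, Real.mul_rpow (by positivity) hv, ← Real.rpow_natCast _ N,
    ← Real.rpow_mul (by positivity), ← Real.rpow_natCast _ 4]
  congr 2
  push_cast; field_simp

lemma inv_sub_self (x y : Euc n) (l : ℝ) :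
    inv x l y - y = ((l * ‖y - x‖⁻¹) ^ 2 - 1) • (y - x) := by
  rw [inv, sub_smul, one_smul]; abel

lemma exists_mul_pow_le {δ : ℝ} (hδ : 0 < δ) {D : ℝ} (hD : 0 ≤ D) (m : ℕ) :
    ∃ B ≥ 0, ∀ a ≥ 0, ∀ s ≥ 0, D * s * (a + D * s) ^ m ≤ δ * a ^ (m + 1) + B * s ^ (m + 1) := by
  set η : ℝ := min 1 (δ / 2 ^ m) with hη
  have hη0 : 0 < η := by positivity
  refine ⟨D ^ (m + 1) * (η⁻¹ + 1) ^ m, by positivity, fun a ha s hs => ?_⟩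
  rcases le_or_gt (D * s) (η * a) with h | h
  · have h' : D * s ≤ 1 * a := h.trans (mul_le_mul_of_nonneg_right (min_le_left _ _) ha)
    calc D * s * (a + D * s) ^ m ≤ η * a * (a + 1 * a) ^ m :=
          mul_le_mul h (pow_le_pow_left₀ (by positivity) (by linarith) m) (by positivity)
            (by positivity)
      _ = (η * 2 ^ m) * a ^ (m + 1) := by ring
      _ ≤ δ * a ^ (m + 1) := by
          gcongr
          calc η * 2 ^ m ≤ δ / 2 ^ m * 2 ^ m := by gcongr; exact min_le_right _ _
            _ = δ := by field_simp
      _ ≤ _ := by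
          have : 0 ≤ D ^ (m + 1) * (η⁻¹ + 1) ^ m * s ^ (m + 1) := by positivity
          linarith
  · have h1 : a ≤ η⁻¹ * (D * s) := by rw [inv_mul_eq_div, le_div_iff₀ hη0]; linarith
    calc D * s * (a + D * s) ^ m ≤ D * s * (η⁻¹ * (D * s) + D * s) ^ m := by gcongr
      _ = D ^ (m + 1) * (η⁻¹ + 1) ^ m * s ^ (m + 1) := by
          rw [show η⁻¹ * (D * s) + D * s = (η⁻¹ + 1) * (D * s) by ring, mul_pow]
          ring
      _ ≤ _ := by
          have : 0 ≤ δ * a ^ (m + 1) := by positivity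
          linarith

namespace BlowupSeq

variable {ℓ : Fin (N + 2)} {C : ℝ} {F : Ultrafilter ℕ} {v k : ℕ → Euc (N + 2) → ℝ}
  {q : ℕ → Euc (N + 2)} {g ε T R A : ℕ → ℝ}

lemma inv_mem_closedBall {x y : Euc (N + 2)} {l l₁ : ℝ} (hl : 0 < l) (hl₁ : l ≤ l₁)
    (hy : l < ‖y - x‖) : inv x l y ∈ closedBall (0 : Euc (N + 2)) (‖x‖ + l₁) := by
  have h1 := norm_inv_sub_le (x := x) hl hy.le
  have h2 := norm_le_norm_add_norm_sub' (inv x l y) x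
  rw [mem_closedBall_zero_iff]
  linarith

lemma eventually_k_inv_sub (h : BlowupSeq ℓ C F v k q g ε T R A) (x : Euc (N + 2)) {l₀ l₁ : ℝ}
    (hl₀ : 0 < l₀) {δ : ℝ} (hδ : 0 < δ) :
    ∃ B ≥ 0, ∀ᶠ i in F, ∀ l, l₀ ≤ l → l ≤ l₁ → ∀ y ∈ domInt ℓ (8 * ε i)⁻¹ (T i), l < ‖y - x‖ →
      k i (inv x l y) - k i y ≤ ε i * inner ℝ (q i) (inv x l y - y) +
        δ * (ε i * ‖q i‖ * ‖inv x l y - y‖) + B * ε i ^ N * ‖y - x‖ ^ N := by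
  have hC : 0 < C := zero_lt_one.trans_le h.one_le
  have hN2 := h.two_le
  have hm : N - 2 + 1 = N - 1 := by omega
  set D := ‖x‖ * l₀⁻¹ + 1 with hD
  obtain ⟨B, hB, hBs⟩ := exists_mul_pow_le (δ := δ / C) (by positivity)
    (show 0 ≤ D by positivity) (N - 2)
  refine ⟨C * B, by positivity, ?_⟩
  filter_upwards [h.eventually_mem (‖x‖ + l₁)] with i hi l hl hl₁ y hy hly
  have hr := h.resc i
  have hε := hr.ε_pos
  have hl0 : 0 < l := hl₀.trans_le hl
  have hz := inv_mem_closedBall hl0 hl₁ hly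
  have hr0 : 0 < ‖y - x‖ := hl0.trans hly
  have h1 : ‖x‖ ≤ ‖x‖ * l₀⁻¹ * ‖y - x‖ := by
    rw [mul_assoc]
    refine le_mul_of_one_le_right (norm_nonneg _) ?_
    rw [inv_mul_eq_div, one_le_div hl₀]; linarith
  have h2 : ‖y‖ ≤ D * ‖y - x‖ := by
    have := norm_le_norm_add_norm_sub' y x
    rw [hD]; linarith
  have h3 : ‖inv x l y‖ ≤ D * ‖y - x‖ := by
    have := norm_le_norm_add_norm_sub' (inv x l y) x
    have := norm_inv_sub_le (x := x) hl0 hly.le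
    rw [hD]; linarith
  have h4 := (le_abs_self _).trans (hr.k_diff _ _ (hi _ hz).2.1 y (domInt_subset_dom _ _ _ hy) h3 h2)
  have h5 : ‖inv x l y - y‖ ≤ ‖y - x‖ := by
    rw [inv_sub_self, norm_smul, Real.norm_eq_abs]
    refine mul_le_of_le_one_left (norm_nonneg _) ?_
    have h6 := mul_norm_inv_le_one (x := x) hl0 hly.le
    have h7 : 0 ≤ l * ‖y - x‖⁻¹ := by positivity
    rw [abs_le]
    constructor <;> nlinarith
  have h6 := hBs (g i) hr.g_nonneg (ε i * ‖y - x‖) (by positivity)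
  rw [hm, hr.g_pow] at h6
  have h7 : C * ε i * ‖inv x l y - y‖ * (ε i * (D * ‖y - x‖) * (g i + ε i * (D * ‖y - x‖)) ^ (N - 2))
      ≤ δ * (ε i * ‖q i‖ * ‖inv x l y - y‖) + C * B * ε i ^ N * ‖y - x‖ ^ N := by
    calc _ = C * ε i * ‖inv x l y - y‖ *
          (D * (ε i * ‖y - x‖) * (g i + D * (ε i * ‖y - x‖)) ^ (N - 2)) := by ring_nf
      _ ≤ C * ε i * ‖inv x l y - y‖ * (δ / C * ‖q i‖ + B * (ε i * ‖y - x‖) ^ (N - 1)) := by gcongr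
      _ = δ * (ε i * ‖q i‖ * ‖inv x l y - y‖) +
          C * B * (ε i * ‖inv x l y - y‖ * (ε i * ‖y - x‖) ^ (N - 1)) := by field_simp
      _ ≤ δ * (ε i * ‖q i‖ * ‖inv x l y - y‖) +
          C * B * (ε i * ‖y - x‖ * (ε i * ‖y - x‖) ^ (N - 1)) := by gcongr
      _ = _ := by
          rw [← pow_succ', show N - 1 + 1 = N by omega, mul_pow, mul_assoc (C * B)]
  linarith

/-- If the gradient of the curvature vanishes fast enough there is no blow-up. -/
lemma false_of_g_le (h : BlowupSeq ℓ C F v k q g ε T R A) {C₁ : ℝ}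
    (hg : ∀ᶠ i in F, g i ≤ C₁ * ε i) : False := by
  obtain ⟨V, hV, -⟩ := h.exists_lim
  have hC : 0 < C := zero_lt_one.trans_le h.one_le
  have hN2 := h.two_le
  have hN2' : (2:ℝ) ≤ N := by exact_mod_cast hN2
  have hN0 : N ≠ 0 := by omega
  refine h.false_of_kelvin_le hV fun x l₁ hl₁ => ?_
  obtain ⟨l₀, hl₀, hl₀₁, hcrit⟩ := h.kelvin_le_of_interior hV x hl₁
  obtain ⟨B, hB, hkB⟩ := h.eventually_k_inv_sub x (l₁ := l₁) hl₀ one_pos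
  set C₂ := max C₁ 0 with hC₂
  have hC₂0 : 0 ≤ C₂ := le_max_right _ _
  set B' := 2 * C₂ ^ (N - 1) * l₀⁻¹ ^ (N - 1) + B with hB'
  have hB'0 : 0 ≤ B' := by positivity
  set p := 1 + 4 / (N : ℝ) with hp
  set C' := B' * l₁ ^ (N + 3) + C * p * (l₁ ^ 4 * l₀⁻¹ ^ (N + 1)) + 1 with hC'
  have hC'0 : 0 ≤ C' := by positivity
  have hε0 : Tendsto (fun i => ε i ^ N) F (𝓝 0) := by
    have := h.ε_lim.pow N
    rwa [zero_pow hN0] at this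
  refine hcrit C' (fun _ => 0) (fun i => ε i ^ N) (fun i => C' * ε i ^ N) hC'0 (.of_forall fun _ => le_rfl)
    (.of_forall fun i => pow_pos (h.resc i).ε_pos N)
    (.of_forall fun i => ⟨mul_nonneg hC'0 (pow_nonneg (h.resc i).ε_pos.le N), le_rfl⟩)
    tendsto_const_nhds hε0 ?_
  filter_upwards [hkB, hg, h.eventually_mem (‖x‖ + l₁)] with i hk hg hmem l hl hl' y hy hly
  have hr := h.resc i
  have hε := hr.ε_pos
  have hl0 : 0 < l := hl₀.trans_le hl
  have hr0 : 0 < ‖y - x‖ := hl0.trans hly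
  obtain ⟨-, -, hz3, hz4⟩ := hmem _ (inv_mem_closedBall hl0 hl' hly)
  have hlω := mul_norm_inv_le_one (x := x) hl0 hly.le
  have hωl : ‖y - x‖⁻¹ ≤ l₀⁻¹ := by gcongr; linarith
  have hk := hk l hl hl' y hy hly
  have hin : ε i * inner ℝ (q i) (inv x l y - y) + 1 * (ε i * ‖q i‖ * ‖inv x l y - y‖) ≤
      2 * C₂ ^ (N - 1) * l₀⁻¹ ^ (N - 1) * ε i ^ N * ‖y - x‖ ^ N := by
    have h1 := real_inner_le_norm (q i) (inv x l y - y)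
    have h5 : ‖inv x l y - y‖ ≤ ‖y - x‖ := by
      rw [inv_sub_self, norm_smul, Real.norm_eq_abs]
      refine mul_le_of_le_one_left (norm_nonneg _) ?_
      have h7 : 0 ≤ l * ‖y - x‖⁻¹ := by positivity
      rw [abs_le]
      constructor <;> nlinarith
    have h6 : ‖q i‖ ≤ (C₂ * ε i) ^ (N - 1) := by
      rw [← hr.g_pow]
      refine pow_le_pow_left₀ hr.g_nonneg (hg.trans ?_) _
      gcongr; exact le_max_left _ _
    have h7 : 1 ≤ l₀⁻¹ * ‖y - x‖ := by rw [inv_mul_eq_div, one_le_div hl₀]; linarith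
    calc _ ≤ ε i * (‖q i‖ * ‖inv x l y - y‖) + 1 * (ε i * ‖q i‖ * ‖inv x l y - y‖) := by gcongr
      _ = 2 * ε i * (‖q i‖ * ‖inv x l y - y‖) := by ring
      _ ≤ 2 * ε i * ((C₂ * ε i) ^ (N - 1) * ‖y - x‖) := by gcongr
      _ ≤ 2 * ε i * ((C₂ * ε i) ^ (N - 1) * ‖y - x‖) * (l₀⁻¹ * ‖y - x‖) ^ (N - 1) :=
          le_mul_of_one_le_right (by positivity) (one_le_pow₀ h7)
      _ = _ := by
          rw [mul_pow, mul_pow]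
          have e1 : ε i ^ N = ε i * ε i ^ (N - 1) := by
            rw [← pow_succ', show N - 1 + 1 = N by omega]
          have e2 : ‖y - x‖ ^ N = ‖y - x‖ * ‖y - x‖ ^ (N - 1) := by
            rw [← pow_succ', show N - 1 + 1 = N by omega]
          rw [e1, e2]; ring
  have hk' : k i (inv x l y) - k i y ≤ B' * ε i ^ N * ‖y - x‖ ^ N := by
    rw [hB']; linarith
  have hω0 : 0 < ‖y - x‖⁻¹ := by positivity
  rw [kelvin_rpow_one_add hN0 hl0.le hz3.le, kelvin_rpow hN0 hl0.le hz3.le]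
  have h1 : v i (inv x l y) ^ (1 + 4 / (N : ℝ)) ≤ 1 :=
    Real.rpow_le_one hz3.le hz4 (by positivity)
  have h2 : v i (inv x l y) ^ (4 / (N : ℝ)) ≤ 1 := Real.rpow_le_one hz3.le hz4 (by positivity)
  have h3 : 0 ≤ v i (inv x l y) ^ (1 + 4 / (N : ℝ)) := Real.rpow_nonneg hz3.le _
  set ω := ‖y - x‖⁻¹ with hω
  have hrω : ‖y - x‖ ^ N * ω ^ N = 1 := by
    rw [← mul_pow, mul_inv_cancel₀ hr0.ne', one_pow]
  have h4 : (k i (inv x l y) - k i y) * ((l * ω) ^ (N + 4) * v i (inv x l y) ^ (1 + 4 / (N : ℝ))) ≤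
      B' * l₁ ^ (N + 3) * ε i ^ N * ω ^ 3 := by
    calc _ ≤ B' * ε i ^ N * ‖y - x‖ ^ N * ((l * ω) ^ (N + 4) * v i (inv x l y) ^ (1 + 4 / (N : ℝ))) := by
          gcongr
      _ ≤ B' * ε i ^ N * ‖y - x‖ ^ N * ((l * ω) ^ (N + 4) * 1) := by gcongr
      _ = B' * ε i ^ N * (‖y - x‖ ^ N * ω ^ N) * (l ^ (N + 3) * ω ^ 3) * (l * ω) := by ring
      _ = B' * ε i ^ N * (l ^ (N + 3) * ω ^ 3) * (l * ω) := by rw [hrω, mul_one]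
      _ ≤ B' * ε i ^ N * (l₁ ^ (N + 3) * ω ^ 3) * 1 := by gcongr
      _ = _ := by ring
  have h5 : C * p * ((l * ω) ^ 4 * v i (inv x l y) ^ (4 / (N : ℝ))) *
      (0 * (ω ^ N / l - ω ^ (N + 1)) + ε i ^ N * ω ^ N) ≤
      C * p * (l₁ ^ 4 * l₀⁻¹ ^ (N + 1)) * ε i ^ N * ω ^ 3 := by
    calc _ ≤ C * p * ((l * ω) ^ 4 * 1) * (0 * (ω ^ N / l - ω ^ (N + 1)) + ε i ^ N * ω ^ N) := by
          rw [zero_mul, zero_add]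
          gcongr
      _ = C * p * (l ^ 4 * ω ^ (N + 1)) * ε i ^ N * ω ^ 3 := by ring
      _ ≤ _ := by gcongr
  have h6 : 0 < ε i ^ N * ω ^ 3 := by positivity
  have h7 : C' * (ε i ^ N * ω ^ 3) ≤ C' * ε i ^ N * (N - 1) * ω ^ 3 := by
    have : C' * (ε i ^ N * ω ^ 3) * 1 ≤ C' * (ε i ^ N * ω ^ 3) * ((N:ℝ) - 1) := by
      gcongr; linarith
    linarith
  have h8 : C' * (ε i ^ N * ω ^ 3) = B' * l₁ ^ (N + 3) * ε i ^ N * ω ^ 3 +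
    C * p * (l₁ ^ 4 * l₀⁻¹ ^ (N + 1)) * ε i ^ N * ω ^ 3 + ε i ^ N * ω ^ 3 := by rw [hC']; ring
  rw [zero_mul  ((N:ℝ) + 1), zero_mul, zero_add]
  linarith

end BlowupSeq

end

section

variable {n N : ℕ}

lemma mul_pow_rpow_div (hN : N ≠ 0) {D s : ℝ} (hD : 0 ≤ D) (hs : 0 ≤ s) :
    (D * s ^ N) ^ (4 / (N : ℝ)) = D ^ (4 / (N : ℝ)) * s ^ 4 := by
  rw [Real.mul_rpow hD (by positivity), ← Real.rpow_natCast _ N, ← Real.rpow_mul hs,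
    ← Real.rpow_natCast _ 4]
  congr 2
  push_cast; field_simp

set_option maxHeartbeats 1000000 in
/-- The interior inequality needed to move spheres centred far away in the direction opposite to
the gradient of the curvature. -/
lemma exists_far_center (hN : 2 ≤ N) {K D M : ℝ} (hK : 0 < K) (hD : 0 < D) (hM : 0 < M) :
    ∃ b > 0, ∃ R ≥ 1, ∀ e z θ : Euc (N + 2), ‖e‖ = 1 → ‖θ‖ = 1 → ∀ l τ a : ℝ, 0 < l → l ≤ M * R →
      0 < τ → τ < 1 → z = -(R • e) + (l * τ) • θ → 0 ≤ a → a ≤ 1 → a ≤ D * (1 + ‖z‖)⁻¹ ^ N →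
      K * a ^ (4 / (N : ℝ)) * (b * (l ^ 2 * (τ - τ ^ 2)) + R⁻¹ ^ 3 * (l ^ 3 * τ)) +
        l ^ (N + 4) * ((1 - τ ^ 2) * (-inner ℝ e θ + 1 / 6)) * (a * a ^ (4 / (N : ℝ))) ≤
        b * (N + 1) := by
  have hN0 : N ≠ 0 := by omega
  have hN' : (2:ℝ) ≤ N := by exact_mod_cast hN
  set D' := D ^ (4 / (N : ℝ)) with hD'
  have hD'0 : 0 < D' := by positivity
  set b := 7 / 6 * (M ^ (N + 4) * 2 ^ (N + 4)) * (D * D') + K * M ^ 3 + 1 with hb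
  have hb0 : 0 < b := by positivity
  set M' := 6 * K * b * 2 ^ (N + 2) with hM'
  have hM'0 : 0 < M' := by positivity
  set M'' := M' ^ (4 / (N : ℝ)) with hM''
  have hM''0 : 0 < M'' := by positivity
  set E := 16 * K * D' * (M ^ 2 + M ^ 3) with hE
  have hE0 : 0 < E := by positivity
  set R := 1 + E + K * M ^ 2 * M'' with hR
  have hR1 : 1 ≤ R := by rw [hR]; have : 0 < K * M ^ 2 * M'' := by positivity
                         linarith
  have hR0 : 0 < R := by linarith
  have hER : E ≤ R ^ 2 := by
    have : 0 < K * M ^ 2 * M'' := by positivity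
    exact (show E ≤ R by linarith).trans (le_self_pow₀ hR1 two_ne_zero)
  have hER' : K * M ^ 2 * M'' ≤ R ^ 2 :=
    (show K * M ^ 2 * M'' ≤ R by linarith).trans (le_self_pow₀ hR1 two_ne_zero)
  refine ⟨b, hb0, R, hR1, fun e z θ he hθ l τ a hl hlR hτ hτ1 hz ha ha1 haD => ?_⟩
  have haq : 0 ≤ a ^ (4 / (N : ℝ)) := Real.rpow_nonneg ha _
  have hτ2 : 0 ≤ 1 - τ ^ 2 := by nlinarith
  have hτ3 : τ - τ ^ 2 ≤ 1 := by nlinarith [sq_nonneg τ]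
  have hτ4 : 0 ≤ τ - τ ^ 2 := by nlinarith
  have hζ : R⁻¹ ^ 3 * (l ^ 3 * τ) ≤ M ^ 3 := by
    calc _ ≤ R⁻¹ ^ 3 * ((M * R) ^ 3 * 1) := by gcongr
      _ = M ^ 3 := by field_simp
  have hζ0 : 0 ≤ R⁻¹ ^ 3 * (l ^ 3 * τ) := by positivity
  have hbK : K * M ^ 3 ≤ b := by
    rw [hb]; have : 0 < 7 / 6 * (M ^ (N + 4) * 2 ^ (N + 4)) * (D * D') := by positivity
    linarith
  have hb1 : 1 ≤ b := by
    rw [hb]; have : 0 < 7 / 6 * (M ^ (N + 4) * 2 ^ (N + 4)) * (D * D') := by positivity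
    have : 0 < K * M ^ 3 := by positivity
    linarith
  have hbN : b * 3 ≤ b * (N + 1) := by gcongr; linarith
  refine le_trans ?_ hbN
  rcases le_or_gt (R / 2) ‖z‖ with hzR | hzR
  · have h1 : (1 + ‖z‖)⁻¹ ≤ 2 * R⁻¹ := by
      rw [show 2 * R⁻¹ = (R / 2)⁻¹ by field_simp]
      gcongr; linarith
    have h2 : a ≤ D * (2 * R⁻¹) ^ N := haD.trans (by gcongr)
    have h3 : a ^ (4 / (N : ℝ)) ≤ D' * (2 * R⁻¹) ^ 4 := by
      rw [hD', ← mul_pow_rpow_div hN0 hD.le (by positivity)]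
      exact Real.rpow_le_rpow ha h2 (by positivity)
    have h4 : (1 - τ ^ 2) * (-inner ℝ e θ + 1 / 6) ≤ 1 * (7 / 6) := by
      have := (abs_le.1 (abs_real_inner_le_norm e θ)).1
      rw [he, hθ] at this
      have h5 : (1 - τ ^ 2) * (-inner ℝ e θ + 1 / 6) ≤ (1 - τ ^ 2) * (7 / 6) := by
        gcongr; linarith
      linarith [sq_nonneg τ]
    have h6 : l ^ (N + 4) * ((1 - τ ^ 2) * (-inner ℝ e θ + 1 / 6)) * (a * a ^ (4 / (N : ℝ))) ≤
        b := by
      calc _ ≤ l ^ (N + 4) * (1 * (7 / 6)) * (a * a ^ (4 / (N : ℝ))) := by gcongr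
        _ ≤ (M * R) ^ (N + 4) * (1 * (7 / 6)) * ((D * (2 * R⁻¹) ^ N) * (D' * (2 * R⁻¹) ^ 4)) := by
            gcongr
        _ = 7 / 6 * (M ^ (N + 4) * 2 ^ (N + 4)) * (D * D') * (R * R⁻¹) ^ (N + 4) := by ring_nf
        _ = 7 / 6 * (M ^ (N + 4) * 2 ^ (N + 4)) * (D * D') := by
            rw [mul_inv_cancel₀ hR0.ne', one_pow, mul_one]
        _ ≤ b := by
            rw [hb]; have : 0 < K * M ^ 3 := by positivity
            linarith
    have h7 : K * a ^ (4 / (N : ℝ)) * (b * (l ^ 2 * (τ - τ ^ 2)) + R⁻¹ ^ 3 * (l ^ 3 * τ)) ≤ b := by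
      calc _ ≤ K * (D' * (2 * R⁻¹) ^ 4) * (b * ((M * R) ^ 2 * 1) + M ^ 3) := by gcongr
        _ ≤ K * (D' * (2 * R⁻¹) ^ 4) * (b * ((M * R) ^ 2 * 1) + b * (M ^ 3 * R ^ 2)) := by
            gcongr
            calc M ^ 3 = 1 * (M ^ 3 * 1) := by ring
              _ ≤ b * (M ^ 3 * R ^ 2) := by gcongr; exact one_le_pow₀ hR1
        _ = b * (E * R⁻¹ ^ 2) * (R * R⁻¹) ^ 2 := by rw [hE]; ring
        _ ≤ b * (R ^ 2 * R⁻¹ ^ 2) * (R * R⁻¹) ^ 2 := by gcongr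
        _ = b := by field_simp
    linarith
  · have hs : (l * τ) • θ = z + R • e := by rw [hz]; abel
    have hs0 : 0 < l * τ := by positivity
    have h1 : l * τ ≤ 3 / 2 * R := by
      have := norm_add_le z (R • e)
      rw [← hs, norm_smul, norm_smul, he, hθ, Real.norm_eq_abs, Real.norm_eq_abs,
        abs_of_pos hR0, abs_of_pos hs0] at this
      linarith
    have h2 : R / 2 ≤ l * τ * inner ℝ e θ := by
      rw [← inner_smul_right, hs, inner_add_right, inner_smul_right, real_inner_self_eq_norm_sq, he]
      have := (abs_le.1 (abs_real_inner_le_norm e z)).1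
      rw [he] at this
      linarith
    have ht1 : inner ℝ e θ ≤ 1 := by
      have := real_inner_le_norm e θ
      rwa [he, hθ, mul_one] at this
    have ht : 1 / 3 ≤ inner ℝ e θ := by
      by_contra! hlt
      have : l * τ * inner ℝ e θ < l * τ * (1 / 3) := by gcongr
      linarith
    have hlR2 : R / 2 ≤ l := by
      have h3 : l * τ * inner ℝ e θ ≤ l * 1 * 1 := by gcongr
      linarith
    have h3 : l ^ (N + 4) * ((1 - τ ^ 2) * (-inner ℝ e θ + 1 / 6)) * (a * a ^ (4 / (N : ℝ))) ≤
        -(l ^ (N + 4) * ((τ - τ ^ 2) * (1 / 6)) * (a * a ^ (4 / (N : ℝ)))) := by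
      have h4 : (1 - τ ^ 2) * (-inner ℝ e θ + 1 / 6) ≤ -((τ - τ ^ 2) * (1 / 6)) := by
        nlinarith
      rw [← neg_mul, ← mul_neg]
      gcongr
    have h5 : K * a ^ (4 / (N : ℝ)) * (R⁻¹ ^ 3 * (l ^ 3 * τ)) ≤ b := by
      have : a ^ (4 / (N : ℝ)) ≤ 1 := Real.rpow_le_one ha ha1 (by positivity)
      calc _ ≤ K * 1 * M ^ 3 := by gcongr
        _ ≤ b := by linarith
    have h6 : K * a ^ (4 / (N : ℝ)) * (b * (l ^ 2 * (τ - τ ^ 2))) -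
        l ^ (N + 4) * ((τ - τ ^ 2) * (1 / 6)) * (a * a ^ (4 / (N : ℝ))) =
        a ^ (4 / (N : ℝ)) * (l ^ 2 * (τ - τ ^ 2)) * (K * b - l ^ (N + 2) * a / 6) := by ring
    have h7 : a ^ (4 / (N : ℝ)) * (l ^ 2 * (τ - τ ^ 2)) * (K * b - l ^ (N + 2) * a / 6) ≤ b := by
      rcases le_or_gt (K * b) (l ^ (N + 2) * a / 6) with h8 | h8
      · refine le_trans (mul_nonpos_of_nonneg_of_nonpos (by positivity) (by linarith)) hb0.le
      · have h9 : a ≤ M' * R⁻¹ ^ N := by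
          have h10 : (R / 2) ^ (N + 2) * a ≤ 6 * K * b := by
            calc (R / 2) ^ (N + 2) * a ≤ l ^ (N + 2) * a := by gcongr
              _ ≤ _ := by linarith
          have h11 : R ^ N * a ≤ M' := by
            calc R ^ N * a ≤ R ^ (N + 2) * a := by gcongr; omega
              _ = 2 ^ (N + 2) * ((R / 2) ^ (N + 2) * a) := by rw [div_pow]; field_simp
              _ ≤ 2 ^ (N + 2) * (6 * K * b) := by gcongr
              _ = M' := by rw [hM']; ring
          rw [inv_pow, ← div_eq_mul_inv, le_div_iff₀ (by positivity)]
          linarith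
        have h10 : a ^ (4 / (N : ℝ)) ≤ M'' * R⁻¹ ^ 4 := by
          rw [hM'', ← mul_pow_rpow_div hN0 hM'0.le (by positivity)]
          exact Real.rpow_le_rpow ha h9 (by positivity)
        have h11 : 0 ≤ l ^ (N + 2) * a / 6 := by positivity
        calc _ ≤ M'' * R⁻¹ ^ 4 * ((M * R) ^ 2 * 1) * (K * b) := by
              gcongr
              linarith
          _ = b * ((K * M ^ 2 * M'') * R⁻¹ ^ 2) * (R * R⁻¹) ^ 2 := by ring
          _ ≤ b * (R ^ 2 * R⁻¹ ^ 2) * (R * R⁻¹) ^ 2 := by gcongr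
          _ = b := by field_simp
    rw [mul_add]
    linarith

end

section

variable {n N : ℕ}

namespace BlowupSeq

variable {ℓ : Fin (N + 2)} {C : ℝ} {F : Ultrafilter ℕ} {v k : ℕ → Euc (N + 2) → ℝ}
  {q : ℕ → Euc (N + 2)} {g ε T R A : ℕ → ℝ}

lemma eventually_le_decay {L B : ℝ} {V : Euc (N + 2) → ℝ}
    (hV : BlowupLim F v L V) (hB : 0 < B) (hVB : ∀ y, V y ≤ B * (1 + ‖y‖)⁻¹ ^ N) {X : ℝ}
    (hX : 0 ≤ X) :
    ∀ᶠ i in F, ∀ y ∈ closedBall (0 : Euc (N + 2)) X, v i y ≤ 2 * B * (1 + ‖y‖)⁻¹ ^ N := by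
  filter_upwards [hV.unif X (B * (1 + X)⁻¹ ^ N) (by positivity)] with i hi y hy
  have h1 := (abs_le.1 (hi y hy)).2
  have h2 := hVB y
  rw [mem_closedBall_zero_iff] at hy
  have h3 : B * (1 + X)⁻¹ ^ N ≤ B * (1 + ‖y‖)⁻¹ ^ N := by gcongr
  linarith

/-- A nontrivial limit with the optimal decay cannot dominate its Kelvin transforms of large
radius. -/
lemma exists_lt_kelvin {L B : ℝ} {V : Euc (N + 2) → ℝ}
    (hV : BlowupLim F v L V) (hVB : ∀ y, V y ≤ B * (1 + ‖y‖)⁻¹ ^ N) {e : Euc (N + 2)}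
    (he : ‖e‖ = 1) {x : Euc (N + 2)} {l : ℝ} (hl : 0 < l) (hlB : B < l ^ N * V x) :
    ∃ y, l ≤ ‖y - x‖ ∧ V y < kelvin x l V y := by
  by_contra! hk
  have h1 : Tendsto (fun s : ℝ => B * ((1 + s⁻¹ * (1 - ‖x‖))⁻¹) ^ N) atTop (𝓝 B) := by
    have := (((((tendsto_inv_atTop_zero (𝕜 := ℝ)).mul_const (1 - ‖x‖)).const_add 1).inv₀
      (by simp)).pow N).const_mul B
    simpa using this
  have h2 : Tendsto (fun s : ℝ => l ^ N * V (x + (l ^ 2 * s⁻¹) • e)) atTop (𝓝 (l ^ N * V x)) := by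
    have h3 := (((tendsto_inv_atTop_zero (𝕜 := ℝ)).const_mul (l ^ 2)).smul_const e).const_add x
    rw [mul_zero, zero_smul, add_zero] at h3
    exact ((hV.continuous.tendsto x).comp h3).const_mul _
  refine absurd (le_of_tendsto_of_tendsto h2 h1 ?_) (not_le.2 hlB)
  filter_upwards [eventually_ge_atTop l, eventually_gt_atTop ‖x‖] with s hs hsx
  have hs0 : 0 < s := hl.trans_le hs
  have hn : ‖x + s • e - x‖ = s := by
    rw [add_sub_cancel_left, norm_smul, he, mul_one, Real.norm_eq_abs, abs_of_pos hs0]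
  have h3 := (hk (x + s • e) (by rwa [hn])).trans (hVB _)
  have h4 : inv x l (x + s • e) = x + (l ^ 2 * s⁻¹) • e := by
    rw [inv, hn, add_sub_cancel_left, smul_smul]
    congr 2
    field_simp
  rw [kelvin_eq, h4, hn] at h3
  have h5 : s - ‖x‖ ≤ ‖x + s • e‖ := by
    have := norm_sub_norm_le (s • e) (-x)
    rw [sub_neg_eq_add, norm_neg, norm_smul, he, mul_one, Real.norm_eq_abs, abs_of_pos hs0,
      add_comm (s • e)] at this
    exact this
  have h6 : 0 < 1 + (s - ‖x‖) := by linarith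
  have hB : 0 ≤ B := by
    have := (hV.pos 0).le.trans (hVB 0)
    simpa using this
  have h7 : (1 + s⁻¹ * (1 - ‖x‖))⁻¹ = s * (1 + (s - ‖x‖))⁻¹ := by
    have : 1 + s⁻¹ * (1 - ‖x‖) = s⁻¹ * (1 + (s - ‖x‖)) := by field_simp; ring
    rw [this, mul_inv, inv_inv]
  have h8 : (1 + ‖x + s • e‖)⁻¹ ≤ (1 + (s - ‖x‖))⁻¹ := by gcongr
  rw [h7, mul_pow]
  calc l ^ N * V (x + (l ^ 2 * s⁻¹) • e) = s ^ N * ((l * s⁻¹) ^ N * V (x + (l ^ 2 * s⁻¹) • e)) := by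
        rw [mul_pow, inv_pow]; field_simp
    _ ≤ s ^ N * (B * (1 + ‖x + s • e‖)⁻¹ ^ N) := by gcongr
    _ ≤ s ^ N * (B * (1 + (s - ‖x‖))⁻¹ ^ N) := by gcongr
    _ = _ := by ring

lemma exists_direction (q : ℕ → Euc (N + 2)) (F : Ultrafilter ℕ) (hq : ∀ᶠ i in F, q i ≠ 0) :
    ∃ e : Euc (N + 2), ‖e‖ = 1 ∧ ∀ δ > 0, ∀ᶠ i in F, ‖q i - ‖q i‖ • e‖ ≤ δ * ‖q i‖ := by
  obtain ⟨e, he, hlim⟩ := (isCompact_sphere (0 : Euc (N + 2)) 1).ultrafilter_le_nhds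
    (F.map fun i => ‖q i‖⁻¹ • q i) (by
      rw [le_principal_iff]
      change ∀ᶠ i in F, ‖q i‖⁻¹ • q i ∈ sphere (0 : Euc (N + 2)) 1
      filter_upwards [hq] with i hi
      have := norm_ne_zero_iff.2 hi
      rw [mem_sphere_zero_iff_norm, norm_smul, norm_inv, norm_norm, inv_mul_cancel₀ this])
  refine ⟨e, by simpa using he, fun δ hδ => ?_⟩
  have hlim' : Tendsto (fun i => ‖q i‖⁻¹ • q i) F (𝓝 e) := hlim
  filter_upwards [hq, (Metric.tendsto_nhds.1 hlim' δ hδ)] with i hi hd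
  have h0 := norm_pos_iff.2 hi
  rw [dist_eq_norm] at hd
  have : q i - ‖q i‖ • e = ‖q i‖ • (‖q i‖⁻¹ • q i - e) := by
    rw [smul_sub, smul_smul, mul_inv_cancel₀ h0.ne', one_smul]
  rw [this, norm_smul, norm_norm, mul_comm]
  gcongr

end BlowupSeq

end

section

variable {n N : ℕ}

namespace BlowupSeq

variable {ℓ : Fin (N + 2)} {C : ℝ} {F : Ultrafilter ℕ} {v k : ℕ → Euc (N + 2) → ℝ}
  {q : ℕ → Euc (N + 2)} {g ε T R A : ℕ → ℝ}

lemma false_of_ne_zero (h : BlowupSeq ℓ C F v k q g ε T R A) (hq : ∀ᶠ i in F, q i ≠ 0) :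
    False := by
  obtain ⟨V, hV, c, hc, hlow⟩ := h.exists_lim
  obtain ⟨B, hB, hVB⟩ := h.decay hV hc hlow
  obtain ⟨e, he, hqe⟩ := exists_direction q F hq
  have hC : 0 < C := zero_lt_one.trans_le h.one_le
  have hN2 := h.two_le
  have hN2' : (2:ℝ) ≤ N := by exact_mod_cast hN2
  have hN0 : N ≠ 0 := by omega
  set p := 1 + 4 / (N : ℝ) with hp
  set M := 2 * max 1 (2 * B / c) with hM
  have hM0 : 0 < M := by positivity
  obtain ⟨b, hb, R₀, hR₀, hineq⟩ := exists_far_center hN2 (K := C * p) (D := 2 * B) (M := M)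
    (by positivity) (by positivity) hM0
  have hR0 : 0 < R₀ := by linarith
  set x : Euc (N + 2) := -(R₀ • e) with hx
  have hxn : ‖x‖ = R₀ := by
    rw [hx, norm_neg, norm_smul, he, mul_one, Real.norm_eq_abs, abs_of_pos hR0]
  set l₁ := M * R₀ with hl₁
  have hl₁0 : 0 < l₁ := by positivity
  have hlV : B < l₁ ^ N * V x := by
    have h1 : 2 * B / c ≤ (M / 2) ^ N := by
      rw [hM, mul_div_cancel_left₀ _ two_ne_zero]
      exact (le_max_right _ _).trans (le_self_pow₀ (le_max_left _ _) hN0)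
    have h2 : M / 2 ≤ l₁ * (1 + ‖x‖)⁻¹ := by
      rw [hxn, ← div_eq_mul_inv, le_div_iff₀ (by positivity), hl₁]
      nlinarith
    calc B < 2 * B / c * c := by field_simp; linarith
      _ ≤ (l₁ * (1 + ‖x‖)⁻¹) ^ N * c := by
          gcongr
          exact h1.trans (by gcongr)
      _ = l₁ ^ N * (c * (1 + ‖x‖)⁻¹ ^ N) := by rw [mul_pow]; ring
      _ ≤ _ := by gcongr; exact hlow x
  obtain ⟨y, hy, hlt⟩ := exists_lt_kelvin hV hVB he hl₁0 hlV
  refine absurd hlt (not_lt.2 ?_)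
  obtain ⟨l₀, hl₀, hl₀₁, hcrit⟩ := h.kelvin_le_of_interior hV x hl₁0
  obtain ⟨B', hB', hkB⟩ := h.eventually_k_inv_sub x (l₁ := l₁) hl₀ (show (0:ℝ) < 1 / 12 by norm_num)
  have hG : Tendsto (fun i => ε i * ‖q i‖) F (𝓝 0) := by
    have h1 := h.ε_lim.mul_const C
    rw [zero_mul] at h1
    refine squeeze_zero (fun i => mul_nonneg (h.resc i).ε_pos.le (norm_nonneg _)) (fun i => ?_) h1
    have := (h.resc i).ε_pos
    gcongr
    exact (h.resc i).q_le
  refine hcrit (B' * l₁ ^ (N + 3) + 1) (fun i => b * (ε i * ‖q i‖))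
    (fun i => R₀⁻¹ ^ 3 * (ε i * ‖q i‖)) (fun i => (B' * l₁ ^ (N + 3) + 1) * ε i ^ N)
    (by positivity) (.of_forall fun i => ?_) ?_ (.of_forall fun i => ?_) ?_ ?_ ?_ y hy
  · have := (h.resc i).ε_pos
    positivity
  · filter_upwards [hq] with i hi
    have := (h.resc i).ε_pos
    have := norm_pos_iff.2 hi
    positivity
  · have := (h.resc i).ε_pos
    exact ⟨by positivity, le_rfl⟩
  · simpa using hG.const_mul b
  · have := hG.const_mul (R₀⁻¹ ^ 3)
    rwa [mul_zero] at this
  filter_upwards [hkB, hqe (1 / 12) (by norm_num), h.eventually_mem (‖x‖ + l₁),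
    eventually_le_decay hV hB hVB (X := ‖x‖ + l₁) (by positivity)]
    with i hk hqi hmem hdec l hl hl' y hy hly
  have hr := h.resc i
  have hε := hr.ε_pos
  have hl0 : 0 < l := hl₀.trans_le hl
  have hr0 : 0 < ‖y - x‖ := hl0.trans hly
  have hz := inv_mem_closedBall hl0 hl' hly
  obtain ⟨-, -, hz3, hz4⟩ := hmem _ hz
  have hdec := hdec _ hz
  have hk := hk l hl hl' y hy hly
  have hlω : l * ‖y - x‖⁻¹ < 1 := by rwa [← div_eq_mul_inv, div_lt_one hr0]
  rw [kelvin_rpow_one_add hN0 hl0.le hz3.le, kelvin_rpow hN0 hl0.le hz3.le,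
    Real.rpow_one_add' hz3.le (by positivity)]
  have hθ : ‖‖y - x‖⁻¹ • (y - x)‖ = 1 := by
    rw [norm_smul, norm_inv, norm_norm, inv_mul_cancel₀ hr0.ne']
  have hzθ : inv x l y = x + (l * (l * ‖y - x‖⁻¹)) • (‖y - x‖⁻¹ • (y - x)) := by
    rw [inv, smul_smul]
    congr 2
    ring
  have hmain := hineq e (inv x l y) _ he hθ l (l * ‖y - x‖⁻¹) (v i (inv x l y)) hl0 hl'
    (by positivity) hlω hzθ hz3.le hz4 hdec
  have hzy := inv_sub_self x y l
  have hzyn : ‖inv x l y - y‖ = (1 - (l * ‖y - x‖⁻¹) ^ 2) * ‖y - x‖ := by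
    rw [hzy, norm_smul, Real.norm_eq_abs, abs_sub_comm, abs_of_nonneg]
    have : 0 < l * ‖y - x‖⁻¹ := by positivity
    nlinarith
  have hin : inner ℝ (q i) (inv x l y - y) ≤
      1 / 12 * ‖q i‖ * ‖inv x l y - y‖ + ‖q i‖ * inner ℝ e (inv x l y - y) := by
    have h1 := (real_inner_le_norm (q i - ‖q i‖ • e) (inv x l y - y)).trans
      (mul_le_mul_of_nonneg_right hqi (norm_nonneg _))
    rw [inner_sub_left, real_inner_smul_left] at h1
    linarith
  have hie : inner ℝ e (inv x l y - y) = -((1 - (l * ‖y - x‖⁻¹) ^ 2) * ‖y - x‖ *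
      inner ℝ e (‖y - x‖⁻¹ • (y - x))) := by
    rw [hzy, inner_smul_right, inner_smul_right]
    field_simp
    ring
  rw [hie] at hin
  rw [hzyn] at hin hk
  have hqn := norm_nonneg (q i)
  set t := inner ℝ e (‖y - x‖⁻¹ • (y - x)) with ht
  set a := v i (inv x l y) with ha
  have ha4 : 0 ≤ a ^ (4 / (N : ℝ)) := Real.rpow_nonneg hz3.le _
  have ha4' : a ^ (4 / (N : ℝ)) ≤ 1 := Real.rpow_le_one hz3.le hz4 (by positivity)
  set r := ‖y - x‖ with hrdef
  have hrω : r * r⁻¹ = 1 := mul_inv_cancel₀ hr0.ne'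
  have hω0 : 0 < r⁻¹ := by positivity
  set ω := r⁻¹ with hω
  have hk' : k i (inv x l y) - k i y ≤
      ε i * ‖q i‖ * ((1 - (l * ω) ^ 2) * (-t + 1 / 6)) * r + B' * ε i ^ N * r ^ N := by
    have := mul_le_mul_of_nonneg_left hin hε.le
    linarith
  have h1 : (k i (inv x l y) - k i y) * ((l * ω) ^ (N + 4) * (a * a ^ (4 / (N : ℝ)))) ≤
      ε i * ‖q i‖ * ω ^ (N + 3) * (l ^ (N + 4) * ((1 - (l * ω) ^ 2) * (-t + 1 / 6)) *
        (a * a ^ (4 / (N : ℝ)))) + B' * l₁ ^ (N + 3) * ε i ^ N * ω ^ 3 := by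
    have h2 : B' * ε i ^ N * l ^ (N + 3) * ω ^ 3 * (l * ω) * (a * a ^ (4 / (N : ℝ))) ≤
        B' * ε i ^ N * l₁ ^ (N + 3) * ω ^ 3 * 1 * (1 * 1) := by gcongr
    calc _ ≤ (ε i * ‖q i‖ * ((1 - (l * ω) ^ 2) * (-t + 1 / 6)) * r + B' * ε i ^ N * r ^ N) *
          ((l * ω) ^ (N + 4) * (a * a ^ (4 / (N : ℝ)))) := by gcongr
      _ = ε i * ‖q i‖ * ω ^ (N + 3) * (l ^ (N + 4) * ((1 - (l * ω) ^ 2) * (-t + 1 / 6)) *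
          (a * a ^ (4 / (N : ℝ)))) * (r * ω) +
          B' * ε i ^ N * l ^ (N + 3) * ω ^ 3 * (l * ω) * (a * a ^ (4 / (N : ℝ))) * (r * ω) ^ N := by
          ring
      _ ≤ _ := by
          rw [hrω, one_pow]
          linarith
  have h2 : C * p * ((l * ω) ^ 4 * a ^ (4 / (N : ℝ))) *
      (b * (ε i * ‖q i‖) * (ω ^ N / l - ω ^ (N + 1)) + R₀⁻¹ ^ 3 * (ε i * ‖q i‖) * ω ^ N) =
      ε i * ‖q i‖ * ω ^ (N + 3) * (C * p * a ^ (4 / (N : ℝ)) *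
        (b * (l ^ 2 * (l * ω - (l * ω) ^ 2)) + R₀⁻¹ ^ 3 * (l ^ 3 * (l * ω)))) := by
    have key : (l * ω) ^ 4 * (ω ^ N / l) = ω ^ (N + 3) * (l ^ 2 * (l * ω)) := by
      rw [mul_div_assoc', div_eq_iff hl0.ne']
      ring
    linear_combination (C * p * a ^ (4 / (N : ℝ)) * b * ε i * ‖q i‖) * key
  have h3 := mul_le_mul_of_nonneg_left hmain
    (show 0 ≤ ε i * ‖q i‖ * ω ^ (N + 3) by positivity)
  have h4 : 0 < ε i ^ N * ω ^ 3 := by positivity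
  have h5 : (B' * l₁ ^ (N + 3) + 1) * (ε i ^ N * ω ^ 3) * 1 ≤
      (B' * l₁ ^ (N + 3) + 1) * (ε i ^ N * ω ^ 3) * ((N:ℝ) - 1) := by
    gcongr; linarith
  rw [h2]
  linarith

lemma false_of_blowupSeq (h : BlowupSeq ℓ C F v k q g ε T R A) : False := by
  by_cases hq : ∀ᶠ i in F, q i ≠ 0
  · exact h.false_of_ne_zero hq
  · refine h.false_of_g_le (C₁ := 0) ?_
    filter_upwards [Ultrafilter.eventually_not.2 hq] with i hi
    have hN2 := h.two_le
    have hg := (h.resc i).g_pow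
    rw [not_not] at hi
    rw [hi, norm_zero] at hg
    rw [eq_zero_of_pow_eq_zero hg, zero_mul]

end BlowupSeq

end

section

variable {n N : ℕ}

/-- Gradient growth along a segment when the Hessian is controlled by a power of the gradient. -/
lemma norm_fderivWithin_le_of_hessian {S : Set (Euc n)} (hS : Convex ℝ S)
    (hU : UniqueDiffOn ℝ S) {K : Euc n → ℝ} (hK : ContDiffOn ℝ 2 K S) {D : ℝ} (hD : 0 ≤ D)
    {m : ℕ} (hm : 1 ≤ m)
    (h2 : ∀ x ∈ S, ‖fderivWithin ℝ (fderivWithin ℝ K S) S x‖ ≤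
      D * ‖fderivWithin ℝ K S x‖ ^ (((m : ℝ) - 1) / m))
    {x y : Euc n} (hx : x ∈ S) (hy : y ∈ S) {g : ℝ} (hg : 0 ≤ g)
    (hgm : g ^ m = ‖fderivWithin ℝ K S x‖) :
    ‖fderivWithin ℝ K S y‖ ≤ (g + D * ‖y - x‖) ^ m := by
  set G := fderivWithin ℝ K S with hG
  have hGd : DifferentiableOn ℝ G S :=
    (hK.fderivWithin hU (m := 1) (by norm_num)).differentiableOn one_ne_zero
  have hm0 : (0 : ℝ) < m := by exact_mod_cast hm
  have key : ∀ δ : ℝ, 0 < δ → ‖G y‖ ≤ (g + δ + (D * ‖y - x‖ + δ)) ^ m := by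
    intro δ hδ
    have hpath : ∀ s ∈ Icc (0 : ℝ) 1, x + s • (y - x) ∈ S := fun s hs =>
      hS.add_smul_sub_mem hx hy hs
    have hline : ∀ s : ℝ, HasDerivWithinAt (fun s : ℝ => x + s • (y - x)) (y - x) (Icc 0 1) s :=
      fun s => by
        simpa using (((hasDerivAt_id s).smul_const (y - x)).const_add x).hasDerivWithinAt
    have hd : ∀ s ∈ Icc (0 : ℝ) 1, HasDerivWithinAt (fun s : ℝ => G (x + s • (y - x)))
        (fderivWithin ℝ G S (x + s • (y - x)) (y - x)) (Icc 0 1) s := fun s hs =>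
      (hGd _ (hpath s hs)).hasFDerivWithinAt.comp_hasDerivWithinAt s (hline s)
        (fun s hs => hpath s hs)
    have := image_norm_le_of_norm_deriv_right_lt_deriv_boundary'
      (f := fun s : ℝ => G (x + s • (y - x))) (a := 0) (b := 1)
      (f' := fun s => fderivWithin ℝ G S (x + s • (y - x)) (y - x))
      (B := fun s => (g + δ + (D * ‖y - x‖ + δ) * s) ^ m)
      (B' := fun s => m * (g + δ + (D * ‖y - x‖ + δ) * s) ^ (m - 1) * (D * ‖y - x‖ + δ))
      (fun s hs => (hd s hs).continuousWithinAt)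
      (fun s hs => ((hd s ⟨hs.1, hs.2.le⟩).mono_of_mem_nhdsWithin
        (Icc_mem_nhdsGE_of_mem hs)))
      (by
        simp only [zero_smul, add_zero, mul_zero, ← hgm]
        gcongr; linarith)
      (by fun_prop)
      (fun s hs => by
        have h1 : HasDerivAt (fun s : ℝ => g + δ + (D * ‖y - x‖ + δ) * s) (D * ‖y - x‖ + δ) s := by
          simpa using ((hasDerivAt_id s).const_mul (D * ‖y - x‖ + δ)).const_add (g + δ)
        exact (h1.pow m).hasDerivWithinAt)
      (fun s hs hcon => by
        set a := g + δ + (D * ‖y - x‖ + δ) * s with ha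
        have hapos : 0 < a := by
          have : 0 ≤ (D * ‖y - x‖ + δ) * s := mul_nonneg (by positivity) hs.1
          rw [ha]; linarith
        have h3 := h2 _ (hpath s ⟨hs.1, hs.2.le⟩)
        rw [hcon] at h3
        have h4 : (a ^ m) ^ (((m : ℝ) - 1) / m) = a ^ (m - 1) := by
          rw [← Real.rpow_natCast, ← Real.rpow_mul hapos.le, mul_div_cancel₀ _ hm0.ne',
            ← Real.rpow_natCast, Nat.cast_sub hm, Nat.cast_one]
        rw [h4] at h3
        calc _ ≤ ‖fderivWithin ℝ G S (x + s • (y - x))‖ * ‖y - x‖ :=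
              ContinuousLinearMap.le_opNorm _ _
          _ ≤ D * a ^ (m - 1) * ‖y - x‖ := by gcongr
          _ = 1 * a ^ (m - 1) * (D * ‖y - x‖) := by ring
          _ < 1 * a ^ (m - 1) * (D * ‖y - x‖ + δ) := by gcongr; linarith
          _ ≤ m * a ^ (m - 1) * (D * ‖y - x‖ + δ) := by
              gcongr; exact_mod_cast hm)
      (right_mem_Icc.2 zero_le_one)
    simpa using this
  have hlim : Tendsto (fun δ : ℝ => (g + δ + (D * ‖y - x‖ + δ)) ^ m) (𝓝[>] 0)
      (𝓝 ((g + D * ‖y - x‖) ^ m)) := by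
    have : Continuous fun δ : ℝ => (g + δ + (D * ‖y - x‖ + δ)) ^ m := by fun_prop
    have := this.tendsto 0
    simp only [add_zero] at this
    exact this.mono_left nhdsWithin_le_nhds
  exact ge_of_tendsto hlim (eventually_mem_nhdsWithin.mono fun δ hδ => key δ hδ)

/-- Second order Taylor estimate when the Hessian is controlled by a power of the gradient. -/
lemma taylor_of_hessian_le {S : Set (Euc n)} (hS : Convex ℝ S)
    (hU : UniqueDiffOn ℝ S) {K : Euc n → ℝ} (hK : ContDiffOn ℝ 2 K S) {D : ℝ} (hD : 1 ≤ D)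
    {m : ℕ} (hm : 1 ≤ m)
    (h2 : ∀ x ∈ S, ‖fderivWithin ℝ (fderivWithin ℝ K S) S x‖ ≤
      D * ‖fderivWithin ℝ K S x‖ ^ (((m : ℝ) - 1) / m))
    {x y z : Euc n} (hx : x ∈ S) (hy : y ∈ S) (hz : z ∈ S) {g : ℝ} (hg : 0 ≤ g)
    (hgm : g ^ m = ‖fderivWithin ℝ K S x‖) {ρ : ℝ} (hyρ : ‖y - x‖ ≤ ρ) (hzρ : ‖z - x‖ ≤ ρ) :
    |K y - K z - fderivWithin ℝ K S x (y - z)| ≤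
      D ^ m * (ρ * (g + ρ) ^ (m - 1)) * ‖y - z‖ := by
  set G := fderivWithin ℝ K S with hG
  have hGd : DifferentiableOn ℝ G S :=
    (hK.fderivWithin hU (m := 1) (by norm_num)).differentiableOn one_ne_zero
  have hm0 : (0 : ℝ) < m := by exact_mod_cast hm
  have hρ : 0 ≤ ρ := (norm_nonneg _).trans hyρ
  set S' := S ∩ closedBall x ρ with hS'
  have hS'c : Convex ℝ S' := hS.inter (convex_closedBall x ρ)
  have hmem : ∀ {w}, w ∈ S → ‖w - x‖ ≤ ρ → w ∈ S' := fun h1 h2 =>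
    ⟨h1, by rwa [mem_closedBall, dist_eq_norm]⟩
  have hess : ∀ w ∈ S', ‖fderivWithin ℝ G S w‖ ≤ D ^ m * (g + ρ) ^ (m - 1) := by
    rintro w ⟨hw, hwρ⟩
    rw [mem_closedBall, dist_eq_norm] at hwρ
    have h1 := norm_fderivWithin_le_of_hessian hS hU hK (zero_le_one.trans hD) hm h2 hx hw hg hgm
    have h0 : 0 ≤ D * (g + ρ) := by positivity
    have h3 : g + D * ‖w - x‖ ≤ D * (g + ρ) := by nlinarith
    have h4 : ((D * (g + ρ)) ^ m) ^ (((m : ℝ) - 1) / m) = (D * (g + ρ)) ^ (m - 1) := by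
      rw [← Real.rpow_natCast, ← Real.rpow_mul h0, mul_div_cancel₀ _ hm0.ne',
        ← Nat.cast_one, ← Nat.cast_sub hm, Real.rpow_natCast]
    calc _ ≤ D * ‖G w‖ ^ (((m : ℝ) - 1) / m) := h2 w hw
      _ ≤ D * ((D * (g + ρ)) ^ m) ^ (((m : ℝ) - 1) / m) := by
          have : (1 : ℝ) ≤ m := by exact_mod_cast hm
          have h5 : 0 ≤ ((m : ℝ) - 1) / m := div_nonneg (by linarith) hm0.le
          gcongr
          exact h1.trans (by gcongr)
      _ = D ^ m * (g + ρ) ^ (m - 1) := by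
          rw [h4, mul_pow, ← mul_assoc, mul_pow_sub_one (by omega)]
  have grad : ∀ w ∈ S', ‖G w - G x‖ ≤ D ^ m * (ρ * (g + ρ) ^ (m - 1)) := by
    intro w hw
    have := hS'c.norm_image_sub_le_of_norm_hasFDerivWithin_le
      (fun v hv => ((hGd v hv.1).hasFDerivWithinAt.mono inter_subset_left)) hess
      (hmem hx (by simpa using hρ)) hw
    refine this.trans ?_
    have hw2 := hw.2
    rw [mem_closedBall, dist_eq_norm] at hw2
    calc _ ≤ D ^ m * (g + ρ) ^ (m - 1) * ρ := by gcongr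
      _ = _ := by ring
  have := hS'c.norm_image_sub_le_of_norm_hasFDerivWithin_le (f := fun v => K v - G x v)
    (f' := fun v => G v - G x)
    (fun v hv => (((hK.differentiableOn two_ne_zero v hv.1).hasFDerivWithinAt.mono
      inter_subset_left).sub (G x).hasFDerivWithinAt)) grad (hmem hz hzρ) (hmem hy hyρ)
  rw [Real.norm_eq_abs] at this
  convert this using 2
  rw [map_sub]; ring

lemma closure_halfBall (h0 : 0 < n) {r : ℝ} (hr : 0 < r) :
    closure (halfBall n h0 r) = {x | ‖x‖ ≤ r ∧ 0 ≤ x (lastIdx n h0)} := by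
  set ℓ := lastIdx n h0
  apply Subset.antisymm
  · refine closure_minimal ?_ ?_
    · rintro x ⟨hx, hx'⟩
      exact ⟨(mem_ball_zero_iff.1 hx).le, le_of_lt hx'⟩
    · exact (isClosed_le continuous_norm continuous_const).inter
        (isClosed_le continuous_const (continuous_coord ℓ))
  · rintro x ⟨hx, hx'⟩
    have hc : Tendsto (fun t : ℝ => (1 - t) • x + (t * (r / 2)) • nu ℓ) (𝓝[>] 0) (𝓝 x) := by
      have : Continuous fun t : ℝ => (1 - t) • x + (t * (r / 2)) • nu ℓ := by fun_prop
      have := this.tendsto 0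
      simp only [sub_zero, one_smul, zero_mul, zero_smul, add_zero] at this
      exact this.mono_left nhdsWithin_le_nhds
    refine mem_closure_of_tendsto hc ?_
    filter_upwards [Ioo_mem_nhdsGT zero_lt_one] with t ht
    obtain ⟨ht0, ht1⟩ := ht
    refine ⟨mem_ball_zero_iff.2 ?_, ?_⟩
    · calc _ ≤ ‖(1 - t) • x‖ + ‖(t * (r / 2)) • nu ℓ‖ := norm_add_le _ _
        _ = (1 - t) * ‖x‖ + t * (r / 2) := by
            rw [norm_smul, norm_smul, PiLp.norm_single, Real.norm_of_nonneg (by linarith),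
              Real.norm_of_nonneg (by positivity)]
            simp
        _ < r := by nlinarith
    · have : 0 < t * (r / 2) := by positivity
      have h2 : 0 ≤ (1 - t) * x ℓ := mul_nonneg (by linarith) hx'
      simp only [upperHalf, mem_ofPred_eq, PiLp.add_apply, PiLp.smul_apply, smul_eq_mul]
      simp only [nu, PiLp.single_apply, ℓ]
      simp only [if_true]
      linarith

lemma nonneg_of_mem_closure_upperHalf {h0 : 0 < n} {x : Euc n}
    (hx : x ∈ closure (upperHalf n h0)) : 0 ≤ x (lastIdx n h0) := by
  have : closure (upperHalf n h0) ⊆ {x | 0 ≤ x (lastIdx n h0)} :=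
    closure_minimal (fun z (hz : 0 < z (lastIdx n h0)) => hz.le)
      (isClosed_le continuous_const (continuous_coord _))
  exact this hx

lemma mem_closure_halfBall {h0 : 0 < n} {x : Euc n} (hx : x ∈ closure (upperHalf n h0)) {r : ℝ}
    (hxr : ‖x‖ ≤ r) (hr : 0 < r) : x ∈ closure (halfBall n h0 r) := by
  rw [closure_halfBall h0 hr]
  exact ⟨hxr, nonneg_of_mem_closure_upperHalf hx⟩

lemma isOpen_halfBall (h0 : 0 < n) (r : ℝ) : IsOpen (halfBall n h0 r) :=
  isOpen_ball.inter (isOpen_lt continuous_const (continuous_coord _))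

lemma convex_closure_halfBall (h0 : 0 < n) (r : ℝ) : Convex ℝ (closure (halfBall n h0 r)) := by
  refine ((convex_ball _ _).inter ?_).closure
  exact convex_halfSpace_gt (𝕜 := ℝ) (EuclideanSpace.proj (lastIdx n h0)).isLinear 0

lemma uniqueDiffOn_closure_halfBall (h0 : 0 < n) {r : ℝ} (hr : 0 < r) :
    UniqueDiffOn ℝ (closure (halfBall n h0 r)) := by
  refine uniqueDiffOn_convex (convex_closure_halfBall h0 r) ?_
  have : (halfBall n h0 r).Nonempty := by
    by_contra h
    rw [not_nonempty_iff_eq_empty] at h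
    have h1 := closure_halfBall h0 hr
    rw [h, closure_empty] at h1
    have h2 : (0 : Euc n) ∈ {x : Euc n | ‖x‖ ≤ r ∧ 0 ≤ x (lastIdx n h0)} := by
      simpa using hr.le
    rw [← h1] at h2
    exact h2
  exact this.mono ((isOpen_halfBall h0 r).subset_interior_iff.2 subset_closure)

end

section

variable {n N : ℕ}

/-- The normalised gradient `∇K(x) / K(x)`. -/
def relGrad (n : ℕ) (h0 : 0 < n) (K : Euc n → ℝ) (x : Euc n) : Euc n :=
  (K x)⁻¹ • (InnerProductSpace.toDual ℝ (Euc n)).symm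
    (fderivWithin ℝ K (closure (halfBall n h0 1)) x)

lemma inner_relGrad (h0 : 0 < n) (K : Euc n → ℝ) (x w : Euc n) :
    inner ℝ (relGrad n h0 K x) w =
      (K x)⁻¹ * fderivWithin ℝ K (closure (halfBall n h0 1)) x w := by
  rw [relGrad, real_inner_smul_left, InnerProductSpace.toDual_symm_apply]

lemma norm_relGrad (h0 : 0 < n) {K : Euc n → ℝ} {x : Euc n} (hK : 0 < K x) :
    ‖relGrad n h0 K x‖ = (K x)⁻¹ * ‖fderivWithin ℝ K (closure (halfBall n h0 1)) x‖ := by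
  rw [relGrad, norm_smul, LinearIsometryEquiv.norm_map, Real.norm_of_nonneg (by positivity)]

section Coefficient

variable {h0 : 0 < N + 2} {C₀ Λ : ℝ} {K : Euc (N + 2) → ℝ} {x : Euc (N + 2)}

lemma CondK2.pos (hΛ : 0 < Λ) (hK2 : CondK2 (N + 2) h0 Λ K)
    (hx : x ∈ closure (halfBall (N + 2) h0 1)) : 0 < K x :=
  (one_div_pos.2 hΛ).trans_le (hK2 x hx).1

lemma CondK2.inv_le (hΛ : 0 < Λ) (hK2 : CondK2 (N + 2) h0 Λ K)
    (hx : x ∈ closure (halfBall (N + 2) h0 1)) : (K x)⁻¹ ≤ Λ := by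
  rw [inv_le_comm₀ (hK2.pos hΛ hx) hΛ, ← one_div]
  exact (hK2 x hx).1

lemma CondK2.norm_fderivWithin_le (hN : 2 ≤ N) (hK2 : CondK2 (N + 2) h0 Λ K)
    (hx : x ∈ closure (halfBall (N + 2) h0 1)) :
    ‖fderivWithin ℝ K (closure (halfBall (N + 2) h0 1)) x‖ ≤ Λ := by
  rw [← norm_iteratedFDerivWithin_one K (uniqueDiffOn_closure_halfBall h0 one_pos x hx)]
  exact (hK2 x hx).2 1 le_rfl (by omega)

lemma CondK2.norm_relGrad_le (hN : 2 ≤ N) (hΛ : 0 < Λ) (hK2 : CondK2 (N + 2) h0 Λ K)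
    (hx : x ∈ closure (halfBall (N + 2) h0 1)) : ‖relGrad (N + 2) h0 K x‖ ≤ Λ * Λ := by
  rw [norm_relGrad h0 (hK2.pos hΛ hx)]
  exact mul_le_mul (hK2.inv_le hΛ hx) (hK2.norm_fderivWithin_le hN hx) (norm_nonneg _) hΛ.le

lemma CondK1.contDiffOn_two (hN : 2 ≤ N) (hK1 : CondK1 (N + 2) h0 C₀ K) :
    ContDiffOn ℝ 2 K (closure (halfBall (N + 2) h0 1)) :=
  hK1.1.of_le (by exact_mod_cast (by omega : 2 ≤ N + 2 - 2))

lemma div_le_of_condK (hN : 2 ≤ N) (hΛ : 0 < Λ) (hK1 : CondK1 (N + 2) h0 C₀ K)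
    (hK2 : CondK2 (N + 2) h0 Λ K) {y : Euc (N + 2)}
    (hx : x ∈ closure (halfBall (N + 2) h0 1)) (hy : y ∈ closure (halfBall (N + 2) h0 1))
    (hxy : ‖y - x‖ ≤ 1) : K y / K x ≤ 1 + Λ * Λ := by
  have h1 := (convex_closure_halfBall h0 1).norm_image_sub_le_of_norm_fderivWithin_le
    ((hK1.contDiffOn_two hN).differentiableOn two_ne_zero)
    (fun z hz => hK2.norm_fderivWithin_le hN hz) hx hy
  have h2 : K y - K x ≤ Λ := by
    refine (le_abs_self _).trans (h1.trans ?_)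
    nlinarith
  have hKx := hK2.pos hΛ hx
  calc K y / K x = 1 + (K y - K x) * (K x)⁻¹ := by field_simp; ring
    _ ≤ 1 + Λ * Λ := by
      gcongr
      exact hK2.inv_le hΛ hx

lemma norm_hessian_le_of_condK1 (hN : 2 ≤ N) (hC₀ : 0 < C₀) (hΛ : 0 < Λ)
    (hK1 : CondK1 (N + 2) h0 C₀ K) (hK2 : CondK2 (N + 2) h0 Λ K)
    (hx : x ∈ closure (halfBall (N + 2) h0 1)) {z : Euc (N + 2)}
    (hz : z ∈ closure (halfBall (N + 2) h0 1)) :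
    ‖fderivWithin ℝ (fderivWithin ℝ ((K x)⁻¹ • K) (closure (halfBall (N + 2) h0 1)))
      (closure (halfBall (N + 2) h0 1)) z‖ ≤ (1 + C₀ * (1 + Λ)) *
      ‖fderivWithin ℝ ((K x)⁻¹ • K) (closure (halfBall (N + 2) h0 1)) z‖ ^
        ((((N - 1 : ℕ) : ℝ) - 1) / (N - 1 : ℕ)) := by
  set S := closure (halfBall (N + 2) h0 1)
  have hU : UniqueDiffOn ℝ S := uniqueDiffOn_closure_halfBall h0 one_pos
  have hK := hK1.contDiffOn_two hN
  have hκ : 0 < (K x)⁻¹ := inv_pos.2 (hK2.pos hΛ hx)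
  have hκΛ := hK2.inv_le hΛ hx
  have hcast : ((N - 1 : ℕ) : ℝ) = (N : ℝ) - 1 := by
    rw [Nat.cast_sub (by omega), Nat.cast_one]
  have hN' : (2 : ℝ) ≤ N := by exact_mod_cast hN
  rw [← norm_iteratedFDerivWithin_one (fderivWithin ℝ ((K x)⁻¹ • K) S) (hU z hz),
    norm_iteratedFDerivWithin_fderivWithin hU hz,
    ← norm_iteratedFDerivWithin_one ((K x)⁻¹ • K) (hU z hz),
    iteratedFDerivWithin_const_smul_apply (hK z hz) hU hz,
    iteratedFDerivWithin_const_smul_apply ((hK z hz).of_le (by norm_num)) hU hz,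
    norm_smul, norm_smul, Real.norm_of_nonneg hκ.le]
  have h2 := hK1.2 z hz 2 (by norm_num) (by omega)
  have he : (((N + 2 : ℕ) : ℝ) - 2 - ((2 : ℕ) : ℝ)) / (((N + 2 : ℕ) : ℝ) - 3) =
      (((N - 1 : ℕ) : ℝ) - 1) / (N - 1 : ℕ) := by
    rw [hcast]; push_cast; congr 1 <;> ring
  rw [he] at h2
  set θ := (((N - 1 : ℕ) : ℝ) - 1) / (N - 1 : ℕ) with hθ
  have hθ0 : 0 ≤ θ := by rw [hθ, hcast]; exact div_nonneg (by linarith) (by linarith)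
  have hθ1 : θ ≤ 1 := by
    rw [hθ, hcast]; exact div_le_one_of_le₀ (by linarith) (by linarith)
  set κ := (K x)⁻¹
  set G := ‖iteratedFDerivWithin ℝ 1 K S z‖
  have hG : 0 ≤ G := norm_nonneg _
  have h3 : κ ≤ (1 + Λ) * κ ^ θ := by
    calc κ = κ ^ (1 - θ) * κ ^ θ := by rw [← Real.rpow_add hκ]; simp
      _ ≤ (1 + Λ) ^ (1 - θ) * κ ^ θ := by gcongr; linarith
      _ ≤ (1 + Λ) ^ (1 : ℝ) * κ ^ θ := by gcongr <;> linarith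
      _ = _ := by rw [Real.rpow_one]
  rw [Real.mul_rpow hκ.le hG]
  calc κ * ‖iteratedFDerivWithin ℝ 2 K S z‖ ≤ ((1 + Λ) * κ ^ θ) * (C₀ * G ^ θ) := by gcongr
    _ = C₀ * (1 + Λ) * (κ ^ θ * G ^ θ) := by ring
    _ ≤ (1 + C₀ * (1 + Λ)) * (κ ^ θ * G ^ θ) := by gcongr; linarith

lemma taylor_of_condK (hN : 2 ≤ N) (hC₀ : 0 < C₀) (hΛ : 0 < Λ)
    (hK1 : CondK1 (N + 2) h0 C₀ K) (hK2 : CondK2 (N + 2) h0 Λ K)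
    (hx : x ∈ closure (halfBall (N + 2) h0 1)) {y z : Euc (N + 2)}
    (hy : y ∈ closure (halfBall (N + 2) h0 1)) (hz : z ∈ closure (halfBall (N + 2) h0 1))
    {g : ℝ} (hg : 0 ≤ g) (hgm : g ^ (N - 1) = ‖relGrad (N + 2) h0 K x‖) {ρ : ℝ}
    (hyρ : ‖y - x‖ ≤ ρ) (hzρ : ‖z - x‖ ≤ ρ) :
    |K y / K x - K z / K x - inner ℝ (relGrad (N + 2) h0 K x) (y - z)| ≤
      (1 + C₀ * (1 + Λ)) ^ (N - 1) * (ρ * (g + ρ) ^ (N - 2)) * ‖y - z‖ := by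
  have hU := uniqueDiffOn_closure_halfBall h0 one_pos
  have hK := hK1.contDiffOn_two hN
  have hd : fderivWithin ℝ ((K x)⁻¹ • K) (closure (halfBall (N + 2) h0 1)) x =
      (K x)⁻¹ • fderivWithin ℝ K (closure (halfBall (N + 2) h0 1)) x :=
    fderivWithin_const_smul (hU x hx) (hK.differentiableOn two_ne_zero x hx) _
  have hKx := hK2.pos hΛ hx
  have := taylor_of_hessian_le (convex_closure_halfBall h0 1) hU (hK.const_smul (K x)⁻¹)
    (D := 1 + C₀ * (1 + Λ)) (by nlinarith) (m := N - 1) (by omega)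
    (fun w hw => norm_hessian_le_of_condK1 hN hC₀ hΛ hK1 hK2 hx hw) hx hy hz hg
    (by
      change _ = ‖fderivWithin ℝ ((K x)⁻¹ • K) (closure (halfBall (N + 2) h0 1)) x‖
      rw [hgm, norm_relGrad h0 hKx, hd, norm_smul, Real.norm_of_nonneg (by positivity)])
    hyρ hzρ
  rw [inner_relGrad, div_eq_inv_mul, div_eq_inv_mul]
  change |(K x)⁻¹ * K y - (K x)⁻¹ * K z -
    fderivWithin ℝ ((K x)⁻¹ • K) (closure (halfBall (N + 2) h0 1)) x (y - z)| ≤ _ at this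
  rw [hd, show N - 1 - 1 = N - 2 by omega] at this
  exact this

end Coefficient

section Solution

variable {h0 : 0 < n} {K c u : Euc n → ℝ}

lemma closure_halfBall_mem_nhds {r : ℝ} {y : Euc n} (hy : y ∈ halfBall n h0 r) :
    closure (halfBall n h0 r) ∈ 𝓝 y :=
  mem_of_superset ((isOpen_halfBall h0 r).mem_nhds hy) subset_closure

lemma IsYamabeSol.contDiffAt (h : IsYamabeSol n h0 K c u) {y : Euc n}
    (hy : y ∈ halfBall n h0 1) : ContDiffAt ℝ 2 u y :=
  h.1.contDiffAt (closure_halfBall_mem_nhds hy)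

lemma IsYamabeSol.hasLap (h : IsYamabeSol n h0 K c u) {y : Euc n}
    (hy : y ∈ halfBall n h0 1) :
    HasLap u y (-(K y * u y ^ (((n : ℝ) + 2) / ((n : ℝ) - 2)))) := by
  have h1 := hasLap_of_contDiffAt (h.contDiffAt hy)
  have h2 := h.2.2.1 y hy
  have h3 : Laplacian.laplacian u y = lapWithin n (closure (halfBall n h0 1)) u y := by
    rw [InnerProductSpace.laplacian_eq_iteratedFDeriv_orthonormalBasis u
      (EuclideanSpace.basisFun (Fin n) ℝ), lapWithin]
    refine Finset.sum_congr rfl fun i _ => ?_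
    rw [iteratedFDerivWithin_eq_iteratedFDeriv (uniqueDiffOn_closure_halfBall h0 one_pos)
      (h.contDiffAt hy) (subset_closure hy), EuclideanSpace.basisFun_apply]
  rw [h3] at h1
  convert h1 using 1
  linarith

lemma IsYamabeSol.hasDerivWithinAt (h : IsYamabeSol n h0 K c u) {y : Euc n}
    (hy : y ∈ flatBdry n h0 1) :
    HasDerivWithinAt (fun s : ℝ => u (y + s • nu (lastIdx n h0)))
      (c y * u y ^ ((n : ℝ) / ((n : ℝ) - 2))) (Ici 0) 0 := by
  rw [← h.2.2.2 y hy, normalDerivWithin]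
  have hy1 : ‖y‖ < 1 := mem_ball_zero_iff.1 hy.1
  have hyc : y ∈ closure (halfBall n h0 1) := by
    rw [closure_halfBall h0 one_pos]
    exact ⟨hy1.le, le_of_eq hy.2.symm⟩
  have hu := (h.1.differentiableOn two_ne_zero y hyc).hasFDerivWithinAt
  have hline : HasDerivWithinAt (fun s : ℝ => y + s • nu (lastIdx n h0))
      (nu (lastIdx n h0)) (Icc 0 (1 - ‖y‖)) 0 := by
    simpa using (((hasDerivAt_id (0 : ℝ)).smul_const (nu (lastIdx n h0))).const_add
      y).hasDerivWithinAt
  have hmaps : MapsTo (fun s : ℝ => y + s • nu (lastIdx n h0)) (Icc 0 (1 - ‖y‖))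
      (closure (halfBall n h0 1)) := by
    intro s hs
    rw [closure_halfBall h0 one_pos]
    refine ⟨(norm_add_le _ _).trans ?_, ?_⟩
    · rw [norm_smul, Real.norm_of_nonneg hs.1]
      have := hs.2
      simp
      linarith
    · have h2 : y (lastIdx n h0) = 0 := hy.2
      simp [h2, hs.1]
  have hu' : HasFDerivWithinAt u (fderivWithin ℝ u (closure (halfBall n h0 1)) y)
      (closure (halfBall n h0 1)) (y + (0 : ℝ) • nu (lastIdx n h0)) := by simpa using hu
  exact (hu'.comp_hasDerivWithinAt (0 : ℝ) hline hmaps).mono_of_mem_nhdsWithin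
    (Icc_mem_nhdsGE (by linarith))

end Solution

end

section

variable {n N : ℕ}

/-- The length scale of the solution `u` at the point `x`. -/
def scale (N : ℕ) (K u : Euc (N + 2) → ℝ) (x : Euc (N + 2)) : ℝ :=
  (u x ^ (2 / (N : ℝ)) * √(K x))⁻¹

/-- A common bound for all the constants of the rescaled problems. -/
def rescConst (N : ℕ) (C₀ Λ b : ℝ) : ℝ :=
  1 + b * √Λ + Λ * Λ + (1 + C₀ * (1 + Λ)) ^ (N - 1)

/-- The rescaling of a solution of the boundary Yamabe system. -/
lemma resc_of_isYamabeSol (hN : 2 ≤ N) {h0 : 0 < N + 2} {C₀ Λ b : ℝ} (hC₀ : 0 < C₀)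
    (hΛ : 0 < Λ) (hb : 0 < b) {K c u : Euc (N + 2) → ℝ} {x : Euc (N + 2)} {σ a : ℝ}
    (hK1 : CondK1 (N + 2) h0 C₀ K) (hK2 : CondK2 (N + 2) h0 Λ K)
    (hc : ∀ z ∈ flatBdry (N + 2) h0 1, |c z| ≤ b) (hsol : IsYamabeSol (N + 2) h0 K c u)
    (hx : x ∈ closure (upperHalf (N + 2) h0) ∩ ball (0 : Euc (N + 2)) (1 / 2))
    (hloc : ∀ z ∈ ball x σ ∩ upperHalf (N + 2) h0, u z ≤ u x) (ha : 0 ≤ a)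
    (hblow : a < u x * sInf (u '' closure (halfBall (N + 2) h0 (2 / 3)))) :
    Resc (lastIdx (N + 2) h0) (rescConst N C₀ Λ b)
      (fun y => u (x + scale N K u x • y) / u x) (fun y => K (x + scale N K u x • y) / K x)
      (relGrad (N + 2) h0 K x) (‖relGrad (N + 2) h0 K x‖ ^ ((N - 1 : ℕ) : ℝ)⁻¹)
      (scale N K u x) (x (lastIdx (N + 2) h0) / scale N K u x) (σ / scale N K u x)
      (a * (√Λ ^ N)⁻¹) := by
  set ℓ := lastIdx (N + 2) h0 with hℓ
  have hN0 : (0 : ℝ) < N := by exact_mod_cast (by omega : 0 < N)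
  have hxn : ‖x‖ < 1 / 2 := mem_ball_zero_iff.1 hx.2
  have hxℓ : 0 ≤ x ℓ := nonneg_of_mem_closure_upperHalf hx.1
  have hxS : x ∈ closure (halfBall (N + 2) h0 1) :=
    mem_closure_halfBall hx.1 (by linarith) one_pos
  have hKx := hK2.pos hΛ hxS
  have hM : 0 < u x := hsol.2.1 x hxS
  set M := u x with hMdef
  set κ := K x with hκdef
  set ε := scale N K u x
  have hεdef : ε = (M ^ (2 / (N : ℝ)) * √κ)⁻¹ := rfl
  have hμ : 0 < M ^ (2 / (N : ℝ)) := Real.rpow_pos_of_pos hM _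
  have hs : 0 < √κ := Real.sqrt_pos.2 hKx
  have hε : 0 < ε := inv_pos.2 (mul_pos hμ hs)
  have hεμ : ε * M ^ (2 / (N : ℝ)) = (√κ)⁻¹ := by
    rw [hεdef]; field_simp
  have hsΛ : (√κ)⁻¹ ≤ √Λ := by
    rw [← Real.sqrt_inv]
    exact Real.sqrt_le_sqrt (hK2.inv_le hΛ hxS)
  have hpow2 : (M ^ (2 / (N : ℝ))) ^ 2 = M ^ (4 / (N : ℝ)) := by
    rw [← Real.rpow_natCast, ← Real.rpow_mul hM.le]; congr 1; push_cast; ring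
  have hpowN : (M ^ (2 / (N : ℝ))) ^ N = M ^ 2 := by
    rw [← Real.rpow_natCast, ← Real.rpow_mul hM.le, div_mul_cancel₀ _ hN0.ne',
      ← Real.rpow_natCast]
    norm_num
  have he1 : (((N + 2 : ℕ) : ℝ) + 2) / (((N + 2 : ℕ) : ℝ) - 2) = 1 + 4 / (N : ℝ) := by
    push_cast; rw [add_sub_cancel_right]; field_simp; ring
  have he2 : ((N + 2 : ℕ) : ℝ) / (((N + 2 : ℕ) : ℝ) - 2) = 1 + 2 / (N : ℝ) := by
    push_cast; rw [add_sub_cancel_right]; field_simp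
  have hΛ2 : 0 ≤ b * √Λ := by positivity
  have hD : 0 ≤ (1 + C₀ * (1 + Λ)) ^ (N - 1) := by positivity
  have hball : ∀ {y : Euc (N + 2)} {r : ℝ}, ‖y‖ ≤ r → ‖(x + ε • y) - x‖ ≤ ε * r := by
    intro y r hy
    rw [add_sub_cancel_left, norm_smul, Real.norm_of_nonneg hε.le]; gcongr
  have hnorm : ∀ {y : Euc (N + 2)}, ‖y‖ ≤ (8 * ε)⁻¹ → ‖x + ε • y‖ < 2 / 3 ∧
      ‖(x + ε • y) - x‖ ≤ 1 / 8 := by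
    intro y hy
    have h1 : ‖(x + ε • y) - x‖ ≤ 1 / 8 := (hball hy).trans (le_of_eq (by field_simp))
    refine ⟨?_, h1⟩
    have := norm_add_le x ((x + ε • y) - x)
    rw [add_sub_cancel] at this
    linarith
  have hcoord : ∀ y : Euc (N + 2), (x + ε • y) ℓ = ε * (x ℓ / ε + y ℓ) := by
    intro y
    simp only [PiLp.add_apply, PiLp.smul_apply, smul_eq_mul]
    field_simp
  have hS23 : ∀ y ∈ dom ℓ (8 * ε)⁻¹ (x ℓ / ε),
      x + ε • y ∈ closure (halfBall (N + 2) h0 (2 / 3)) := by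
    intro y hy
    rw [closure_halfBall h0 (by norm_num)]
    refine ⟨(hnorm hy.1).1.le, ?_⟩
    rw [hcoord]
    exact mul_nonneg hε.le (by linarith [hy.2])
  have hS : ∀ y ∈ dom ℓ (8 * ε)⁻¹ (x ℓ / ε),
      x + ε • y ∈ closure (halfBall (N + 2) h0 1) := fun y hy =>
    closure_mono (inter_subset_inter_left _ (ball_subset_ball (by norm_num))) (hS23 y hy)
  have hSi : ∀ y ∈ domInt ℓ (8 * ε)⁻¹ (x ℓ / ε), x + ε • y ∈ halfBall (N + 2) h0 1 := by
    intro y hy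
    refine ⟨mem_ball_zero_iff.2 ((hnorm hy.1.le).1.trans (by norm_num)), ?_⟩
    change 0 < (x + ε • y) ℓ
    rw [hcoord]
    exact mul_pos hε (by linarith [hy.2])
  have hcont : Continuous fun y : Euc (N + 2) => x + ε • y := by fun_prop
  have hupos : ∀ y ∈ dom ℓ (8 * ε)⁻¹ (x ℓ / ε), 0 < u (x + ε • y) := fun y hy =>
    hsol.2.1 _ (hS y hy)
  have hq := hK2.norm_relGrad_le hN hΛ hxS
  refine ⟨hε, ?_, ?_, ?_, ?_, ?_, ?_, ?_, ?_, ?_, ?_, ?_, ?_, ?_, ?_, ?_⟩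
  · exact (hsol.1.continuousOn.comp hcont.continuousOn hS).div_const _
  · exact fun y hy => div_pos (hupos y hy) hM
  · intro y hy
    have h1 := hsol.contDiffAt (hSi y hy)
    have h2 : ContDiffAt ℝ 2 (fun y : Euc (N + 2) => x + ε • y) y := by fun_prop
    exact (h1.comp y h2).div_const _
  · intro y hy
    have hp := hupos y (domInt_subset_dom _ _ _ hy)
    have h1 := ((hsol.hasLap (hSi y hy)).comp_affine x ε).const_mul M⁻¹
    convert h1 using 1
    · ext z; rw [div_eq_inv_mul]
    · rw [he1, Real.div_rpow hp.le hM.le, Real.rpow_add hM, Real.rpow_one, ← hpow2]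
      have h3 : ε ^ 2 = ((M ^ (2 / (N : ℝ))) ^ 2)⁻¹ * κ⁻¹ := by
        rw [hεdef, inv_pow, mul_pow, Real.sq_sqrt hKx.le, mul_inv]
      rw [h3]
      field_simp
  · intro y hy hyT
    have hyd : y ∈ dom ℓ (8 * ε)⁻¹ (x ℓ / ε) := ⟨hy.le, hyT.ge⟩
    have hp := hupos y hyd
    have hfl : x + ε • y ∈ flatBdry (N + 2) h0 1 := by
      refine ⟨mem_ball_zero_iff.2 ((hnorm hy.le).1.trans (by norm_num)), ?_⟩
      change (x + ε • y) ℓ = 0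
      rw [hcoord, hyT]; ring
    have h1 := hsol.hasDerivWithinAt hfl
    have h2 : HasDerivWithinAt (fun s : ℝ => ε * s) ε (Ici 0) 0 := by
      simpa using ((hasDerivAt_id (0 : ℝ)).const_mul ε).hasDerivWithinAt
    have h1' : HasDerivWithinAt (fun s : ℝ => u (x + ε • y + s • nu ℓ))
      (c (x + ε • y) * u (x + ε • y) ^ (((N + 2 : ℕ) : ℝ) / (((N + 2 : ℕ) : ℝ) - 2))) (Ici 0)
      (ε * 0) := by rw [mul_zero]; exact h1
    have h3 := (h1'.comp (0 : ℝ) h2 (fun s hs => mul_nonneg hε.le hs)).div_const M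
    rw [he2] at h3
    refine ⟨_, ?_, h3.congr (fun s _ => ?_) ?_⟩
    · rw [Real.div_rpow hp.le hM.le, Real.rpow_add hM, Real.rpow_one]
      have h4 : c (x + ε • y) * u (x + ε • y) ^ (1 + 2 / (N : ℝ)) * ε / M =
          c (x + ε • y) * (ε * M ^ (2 / (N : ℝ))) *
            (u (x + ε • y) ^ (1 + 2 / (N : ℝ)) / (M * M ^ (2 / (N : ℝ)))) := by
        field_simp
      rw [h4, hεμ]
      have h5 : 0 ≤ u (x + ε • y) ^ (1 + 2 / (N : ℝ)) / (M * M ^ (2 / (N : ℝ))) := by positivity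
      refine mul_le_mul_of_nonneg_right ?_ h5
      have h6 := (le_abs_self _).trans (hc _ hfl)
      calc c (x + ε • y) * (√κ)⁻¹ ≤ b * (√κ)⁻¹ := by gcongr
        _ ≤ b * √Λ := by gcongr
        _ ≤ _ := by rw [rescConst]; nlinarith
    · simp only [Function.comp_apply]
      congr 2
      rw [smul_add, smul_smul, add_assoc]
    · simp
  · intro y hy
    have h1 : sInf (u '' closure (halfBall (N + 2) h0 (2 / 3))) ≤ u (x + ε • y) := by
      refine csInf_le ⟨0, ?_⟩ (mem_image_of_mem u (hS23 y hy))
      rintro _ ⟨z, hz, rfl⟩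
      exact (hsol.2.1 z (closure_mono (inter_subset_inter_left _
        (ball_subset_ball (by norm_num))) hz)).le
    have h2 : a ≤ M * u (x + ε • y) := hblow.le.trans (by gcongr)
    have h3 : ε ^ N = (M ^ 2)⁻¹ * ((√κ)⁻¹) ^ N := by
      rw [hεdef, mul_inv, mul_pow, inv_pow, hpowN]
    have h4 : ((√κ)⁻¹) ^ N ≤ √Λ ^ N := by gcongr
    have h5 : 0 < √Λ ^ N := pow_pos (Real.sqrt_pos.2 hΛ) _
    calc a * (√Λ ^ N)⁻¹ * ε ^ N ≤ a * (√Λ ^ N)⁻¹ * ((M ^ 2)⁻¹ * √Λ ^ N) := by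
          rw [h3]; gcongr
      _ = a * (M ^ 2)⁻¹ := by field_simp
      _ ≤ M * u (x + ε • y) * (M ^ 2)⁻¹ := by gcongr
      _ = u (x + ε • y) / M := by field_simp
  · simp [← hMdef, hM.ne']
  · intro y hy hyR
    rw [div_le_one hM]
    refine hloc _ ⟨?_, (hSi y hy).2⟩
    rw [mem_ball, dist_eq_norm, add_sub_cancel_left, norm_smul, Real.norm_of_nonneg hε.le]
    rw [lt_div_iff₀ hε] at hyR
    linarith
  · exact fun y hy => div_pos (hK2.pos hΛ (hS y hy)) hKx
  · intro y hy
    refine (div_le_of_condK hN hΛ hK1 hK2 hxS (hS y hy)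
      ((hnorm hy.1).2.trans (by norm_num))).trans ?_
    rw [rescConst]; linarith
  · simp [← hκdef, hKx.ne']
  · positivity
  · exact Real.rpow_inv_natCast_pow (norm_nonneg _) (by omega)
  · rw [rescConst]; linarith
  · intro r y hy z hz hyr hzr
    have h1 := taylor_of_condK hN hC₀ hΛ hK1 hK2 hxS (hS y hy) (hS z hz)
      (g := ‖relGrad (N + 2) h0 K x‖ ^ ((N - 1 : ℕ) : ℝ)⁻¹) (by positivity)
      (Real.rpow_inv_natCast_pow (norm_nonneg _) (by omega)) (hball hyr) (hball hzr)
    rw [add_sub_add_left_eq_sub, ← smul_sub, real_inner_smul_right, norm_smul,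
      Real.norm_of_nonneg hε.le] at h1
    refine h1.trans ?_
    have hr : 0 ≤ r := (norm_nonneg _).trans hyr
    set g := ‖relGrad (N + 2) h0 K x‖ ^ ((N - 1 : ℕ) : ℝ)⁻¹
    have hg : 0 ≤ g := by positivity
    have h2 : 0 ≤ ε * ‖y - z‖ * (ε * r * (g + ε * r) ^ (N - 2)) := by positivity
    calc _ = (1 + C₀ * (1 + Λ)) ^ (N - 1) *
          (ε * ‖y - z‖ * (ε * r * (g + ε * r) ^ (N - 2))) := by ring
      _ ≤ rescConst N C₀ Λ b * (ε * ‖y - z‖ * (ε * r * (g + ε * r) ^ (N - 2))) := by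
          gcongr; rw [rescConst]; nlinarith
      _ = _ := by ring

end

lemma tendsto_atTop_mul_of_le {f s : ℕ → ℝ} {δ : ℝ} (hδ : 0 < δ) (hf : Tendsto f atTop atTop)
    (hs : ∀ i, δ ≤ s i) : Tendsto (fun i => f i * s i) atTop atTop := by
  refine tendsto_atTop_mono' _ ?_ (hf.atTop_mul_const hδ)
  filter_upwards [hf.eventually_ge_atTop 0] with i hi
  exact mul_le_mul_of_nonneg_left (hs i) hi

lemma exists_subseq_tendsto_atTop {t : ℕ → ℝ} (ht : ∀ a : ℝ, 0 < a → ∃ i, a < t i) :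
    ∃ φ : ℕ → ℕ, (∀ k, k ≤ φ k) ∧ Tendsto (fun k => t (φ k)) atTop atTop := by
  have key : ∀ k : ℕ, ∃ i, k ≤ i ∧ (k : ℝ) ≤ t i := by
    intro k
    have hsum : 0 ≤ ∑ j ∈ Finset.range k, |t j| := Finset.sum_nonneg fun j _ => abs_nonneg _
    obtain ⟨i, hi⟩ := ht (1 + k + ∑ j ∈ Finset.range k, |t j|) (by positivity)
    have hk : (0 : ℝ) ≤ k := k.cast_nonneg
    refine ⟨i, not_lt.1 fun hik => ?_, by linarith⟩
    have h1 := Finset.single_le_sum (f := fun j => |t j|) (fun j _ => abs_nonneg _)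
      (Finset.mem_range.2 hik)
    have h2 := le_abs_self (t i)
    linarith
  choose φ h1 h2 using key
  exact ⟨φ, h1, tendsto_atTop_mono h2 tendsto_natCast_atTop_atTop⟩

/-- blow-up can only occur near the flat boundary. -/
theorem blowup_near_flat_boundary (n : ℕ) (hn : 4 ≤ n) (h0 : 0 < n)
    (C₀ Λ b : ℝ) (hC₀ : 0 < C₀) (hΛ : 0 < Λ) (hb : 0 < b)
    (K : ℕ → Euc n → ℝ) (c : ℕ → Euc n → ℝ) (u : ℕ → Euc n → ℝ)
    (x : ℕ → Euc n) (σ : ℕ → ℝ)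
    (hK1 : ∀ i, CondK1 n h0 C₀ (K i))
    (hK2 : ∀ i, CondK2 n h0 Λ (K i))
    (hK3 : ∀ i, CondK3 n h0 (K i))
    (hc : ∀ i, ∀ z ∈ flatBdry n h0 1, |c i z| ≤ b)
    (hsol : ∀ i, IsYamabeSol n h0 (K i) (c i) (u i))
    (hx : ∀ i, x i ∈ closure (upperHalf n h0) ∩ Metric.ball (0 : Euc n) (1/2))
    (hmax : ∀ i, sSup (u i '' closure (halfBall n h0 (1/3))) ≤ u i (x i))
    (hσ0 : Filter.Tendsto σ Filter.atTop (nhds 0))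
    (hloc : ∀ i, ∀ z ∈ Metric.ball (x i) (σ i) ∩ upperHalf n h0, u i z ≤ u i (x i))
    (hσInf : Filter.Tendsto (fun i => u i (x i) ^ ((2 : ℝ) / ((n : ℝ) - 2)) * σ i)
      Filter.atTop Filter.atTop)
    (hblow : ∀ i : ℕ, (i : ℝ) < u i (x i) * sInf (u i '' closure (halfBall n h0 (2/3)))) :
    ∃ C₁ : ℝ, 0 < C₁ ∧
      ∀ i, x i (lastIdx n h0) * u i (x i) ^ ((2 : ℝ) / ((n : ℝ) - 2)) ≤ C₁ := by
  obtain ⟨N, rfl⟩ : ∃ N, n = N + 2 := ⟨n - 2, by omega⟩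
  have hN : 2 ≤ N := by omega
  have he : (2 : ℝ) / (((N + 2 : ℕ) : ℝ) - 2) = 2 / (N : ℝ) := by
    push_cast; rw [add_sub_cancel_right]
  rw [he] at hσInf ⊢
  by_contra! hcon
  obtain ⟨φ, hφ, ht⟩ := exists_subseq_tendsto_atTop hcon
  have hφ' : Tendsto φ atTop atTop := tendsto_atTop_mono hφ tendsto_id
  set μ : ℕ → ℝ := fun i => u i (x i) ^ (2 / (N : ℝ)) with hμ
  have hxS : ∀ i, x i ∈ closure (halfBall (N + 2) h0 1) := fun i =>
    mem_closure_halfBall (hx i).1 ((mem_ball_zero_iff.1 (hx i).2).le.trans (by norm_num)) one_pos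
  have hμpos : ∀ i, 0 < μ i := fun i => Real.rpow_pos_of_pos ((hsol i).2.1 _ (hxS i)) _
  have hδ : 0 < (√Λ)⁻¹ := inv_pos.2 (Real.sqrt_pos.2 hΛ)
  have hκ : ∀ i, (√Λ)⁻¹ ≤ √(K i (x i)) := by
    intro i
    rw [← Real.sqrt_inv]
    refine Real.sqrt_le_sqrt ?_
    rw [← one_div]
    exact ((hK2 i) _ (hxS i)).1
  have hμlim : Tendsto μ atTop atTop := by
    refine tendsto_atTop_mono' _ ?_ hσInf
    filter_upwards [hσ0.eventually_lt_const one_pos] with i hi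
    exact (mul_le_mul_of_nonneg_left hi.le (hμpos i).le).trans_eq (mul_one _)
  have hscale : ∀ (i : ℕ) (a : ℝ),
      a / scale N (K i) (u i) (x i) = a * μ i * √(K i (x i)) := by
    intro i a
    rw [scale, div_inv_eq_mul, mul_assoc]
  have hF : ((Ultrafilter.of atTop : Ultrafilter ℕ) : Filter ℕ) ≤ atTop := Ultrafilter.of_le _
  have hC : 1 ≤ rescConst N C₀ Λ b := by
    have : 0 ≤ b * √Λ + Λ * Λ + (1 + C₀ * (1 + Λ)) ^ (N - 1) := by positivity
    rw [rescConst]; linarith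
  refine BlowupSeq.false_of_blowupSeq (F := Ultrafilter.of atTop) ⟨hN, hC,
    fun k => resc_of_isYamabeSol hN hC₀ hΛ hb (hK1 (φ k)) (hK2 (φ k)) (hc (φ k)) (hsol (φ k))
      (hx (φ k)) (hloc (φ k)) (φ k).cast_nonneg (hblow (φ k)), ?_, ?_, ?_, ?_⟩
  · refine Tendsto.mono_left ?_ hF
    exact (tendsto_atTop_mul_of_le hδ hμlim hκ).inv_tendsto_atTop.comp hφ'
  · refine Tendsto.mono_left ?_ hF
    simp_rw [hscale]
    exact tendsto_atTop_mul_of_le hδ ht fun k => hκ (φ k)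
  · refine Tendsto.mono_left ?_ hF
    simp_rw [hscale, mul_comm (σ _)]
    exact (tendsto_atTop_mul_of_le hδ hσInf hκ).comp hφ'
  · refine Tendsto.mono_left ?_ hF
    exact (tendsto_natCast_atTop_atTop.comp hφ').atTop_mul_const
      (inv_pos.2 (pow_pos (Real.sqrt_pos.2 hΛ) N))
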